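/- Let a be a real number and let λ_a : ℝ → ℝ denote the map x ↦ a·x. The first-order theory of the structure S_a = (ℝ; <, +, ℤ, λ_a) is decidable (i.e., there is an algorithm deciding, for every first-order sentence in the language {<, +, Z, λ}, whether it holds in S_a) if and only if a is quadratic, i.e., a is a root of a nonzero polynomial of degree at most 2 with rational coefficients. -/

import Mathlib

open FirstOrder

/-- A Gödel numbering for sentences of a language whose symbols are encodable, obtained
from Mathlib's list encoding of first-order formulas. -/
noncomputable def sentenceEncode {L : FirstOrder.Language}
    (eF : ∀ n, Encodable (L.Functions n)) (eR : ∀ n, Encodable (L.Relations n))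
    (φ : L.Sentence) : ℕ :=
  letI := eF
  letI := eR
  Encodable.encode (FirstOrder.Language.BoundedFormula.listEncode φ)

/-- The first-order theory of an `L`-structure `M` is decidable: the symbols of `L` admit
a Gödel numbering with respect to which the set of sentences true in `M` is computable. -/
def TheoryDecidable (L : FirstOrder.Language) (M : Type*) [L.Structure M] : Prop :=
  ∃ (eF : ∀ n, Encodable (L.Functions n)) (eR : ∀ n, Encodable (L.Relations n))
    (f : ℕ → Bool), Computable f ∧
      ∀ φ : L.Sentence, (f (sentenceEncode eF eR φ) = true ↔ M ⊨ φ)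

/-- The language of `S_a`: a unary function `λ_a`, a binary function `+`,
a unary predicate for `ℤ` and a binary relation `<`. -/
def sLang : FirstOrder.Language where
  Functions := fun n => match n with
    | 1 => Unit
    | 2 => Unit
    | _ => Empty
  Relations := fun n => match n with
    | 1 => Unit
    | 2 => Unit
    | _ => Empty

/-- The structure `S_a = (ℝ; <, +, ℤ, λ_a)`, where `λ_a x = a·x`. -/
def sStruc (a : ℝ) : sLang.Structure ℝ where
  funMap {n} f v :=
    match n, f, v with
    | 1, _, v => a * v 0
    | 2, _, v => v 0 + v 1
  RelMap {n} r v :=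
    match n, r, v with
    | 1, _, v => ∃ z : ℤ, v 0 = (z : ℝ)
    | 2, _, v => v 0 < v 1

/-- `1`, `a`, `a²` are linearly independent over the integers. -/
def QuadFree (a : ℝ) : Prop :=
  ∀ n₁ n₂ n₃ : ℤ, (n₁ : ℝ) + n₂ * a + n₃ * a ^ 2 = 0 → n₁ = 0 ∧ n₂ = 0 ∧ n₃ = 0

theorem exists_recurrence (a b : ℝ) (ε : ℝ) (hε : 0 < ε) (n : ℕ) :
    ∃ Q : ℕ, n < Q ∧ ∃ l l' : ℤ, |Q * a - l| < ε ∧ |Q * b - l'| < ε := by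
  let u : ℕ → ℝ × ℝ := fun m => (Int.fract (m * a), Int.fract (m * b))
  have hb : Bornology.IsBounded (Set.Icc (0 : ℝ) 1 ×ˢ Set.Icc (0 : ℝ) 1) :=
    (Metric.isBounded_Icc 0 1).prod (Metric.isBounded_Icc 0 1)
  obtain ⟨p, -, φ, hφ, hlim⟩ := tendsto_subseq_of_bounded hb (x := u) (fun m =>
    ⟨⟨Int.fract_nonneg _, (Int.fract_lt_one _).le⟩, ⟨Int.fract_nonneg _, (Int.fract_lt_one _).le⟩⟩)
  obtain ⟨N, hN⟩ := Metric.cauchySeq_iff'.1 hlim.cauchySeq ε hε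
  have hφk : φ N + (n + 1) ≤ φ (N + (n + 1)) := by
    generalize n + 1 = k
    induction k with
    | zero => simp
    | succ k ih =>
      have := hφ (show N + k < N + (k + 1) by omega)
      omega
  have h1 := hN (N + (n + 1)) (by omega)
  simp only [Function.comp, u, Prod.dist_eq, Real.dist_eq, max_lt_iff] at h1
  refine ⟨φ (N + (n + 1)) - φ N, by omega, ⌊(φ (N + (n + 1)) : ℝ) * a⌋ - ⌊(φ N : ℝ) * a⌋,
    ⌊(φ (N + (n + 1)) : ℝ) * b⌋ - ⌊(φ N : ℝ) * b⌋, ?_, ?_⟩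
  · rw [Nat.cast_sub (by omega)]
    have e : ((φ (N + (n + 1)) : ℝ) - φ N) * a - (⌊(φ (N + (n + 1)) : ℝ) * a⌋ - ⌊(φ N : ℝ) * a⌋ : ℤ)
        = Int.fract ((φ (N + (n + 1)) : ℝ) * a) - Int.fract ((φ N : ℝ) * a) := by
      rw [Int.fract, Int.fract]
      push_cast
      ring
    rw [e]
    exact h1.1
  · rw [Nat.cast_sub (by omega)]
    have e : ((φ (N + (n + 1)) : ℝ) - φ N) * b - (⌊(φ (N + (n + 1)) : ℝ) * b⌋ - ⌊(φ N : ℝ) * b⌋ : ℤ)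
        = Int.fract ((φ (N + (n + 1)) : ℝ) * b) - Int.fract ((φ N : ℝ) * b) := by
      rw [Int.fract, Int.fract]
      push_cast
      ring
    rw [e]
    exact h1.2

/-- The values of the functional `v ↦ w₁ v₂ - w₂ v₁` on the group `ℤ (a, b) + ℤ²`. -/
def detSubgroup (a b w₁ w₂ : ℝ) : AddSubgroup ℝ where
  carrier := {s | ∃ m l l' : ℤ, s = w₁ * (m * b - l') - w₂ * (m * a - l)}
  zero_mem' := ⟨0, 0, 0, by simp⟩
  add_mem' := by
    rintro _ _ ⟨m, l, l', rfl⟩ ⟨n, k, k', rfl⟩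
    exact ⟨m + n, l + k, l' + k', by push_cast; ring⟩
  neg_mem' := by
    rintro _ ⟨m, l, l', rfl⟩
    exact ⟨-m, -l, -l', by push_cast; ring⟩

theorem detSubgroup_dense {a : ℝ} (ha : QuadFree a) {w₁ w₂ : ℝ} (hw : w₁ ≠ 0 ∨ w₂ ≠ 0) :
    Dense (detSubgroup a (a ^ 2) w₁ w₂ : Set ℝ) := by
  refine (AddSubgroup.dense_or_cyclic _).resolve_right ?_
  rintro ⟨c, hc⟩
  have key : ∀ m l l' : ℤ, ∃ k : ℤ, (k : ℝ) * c = w₁ * (m * a ^ 2 - l') - w₂ * (m * a - l) := by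
    intro m l l'
    have : w₁ * (m * a ^ 2 - l') - w₂ * (m * a - l) ∈ detSubgroup a (a ^ 2) w₁ w₂ :=
      ⟨m, l, l', rfl⟩
    rw [hc, AddSubgroup.mem_closure_singleton] at this
    simpa using this
  obtain ⟨k₁, h₁⟩ := key 0 0 (-1)
  obtain ⟨k₂, h₂⟩ := key 0 1 0
  obtain ⟨k₃, h₃⟩ := key 1 0 0
  norm_num at h₁ h₂ h₃
  have hc0 : c ≠ 0 := by
    rintro rfl
    simp at h₁ h₂
    rcases hw with h | h
    · exact h h₁.symm
    · exact h h₂.symm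
  have h := ha k₃ k₂ (-k₁)
  have := h (by
    have : c * ((k₃ : ℝ) + k₂ * a + (-k₁ : ℤ) * a ^ 2) = 0 := by
      push_cast
      linear_combination h₃ + a * h₂ - a ^ 2 * h₁
    exact (mul_eq_zero.1 this).resolve_left hc0)
  obtain ⟨-, e2, e1⟩ := this
  have e1' : k₁ = 0 := by omega
  have e2' : k₂ = 0 := by omega
  subst e1' e2'
  simp at h₁ h₂
  rcases hw with h | h
  · exact h h₁.symm
  · exact h h₂.symm

theorem kronecker {a : ℝ} (ha : QuadFree a) (x y ε : ℝ) (hε : 0 < ε) (n : ℕ) :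
    ∃ m : ℕ, n < m ∧ ∃ l l' : ℤ, |m * a - l - x| < ε ∧ |m * a ^ 2 - l' - y| < ε := by
  suffices H : ∃ m l l' : ℤ, |m * a - l - x| < ε / 2 ∧ |m * a ^ 2 - l' - y| < ε / 2 by
    obtain ⟨m, l, l', h1, h2⟩ := H
    obtain ⟨Q, hQ, k, k', h3, h4⟩ := exists_recurrence a (a ^ 2) (ε / 2) (by linarith)
      (n + m.natAbs)
    refine ⟨(m + Q).toNat, by omega, l + k, l' + k', ?_, ?_⟩
    · have : (((m + Q).toNat : ℕ) : ℝ) = m + Q := by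
        have : (((m + Q).toNat : ℕ) : ℤ) = m + Q := by omega
        exact_mod_cast this
      rw [this]
      push_cast
      rw [abs_lt] at *
      constructor <;> linarith
    · have : (((m + Q).toNat : ℕ) : ℝ) = m + Q := by
        have : (((m + Q).toNat : ℕ) : ℤ) = m + Q := by omega
        exact_mod_cast this
      rw [this]
      push_cast
      rw [abs_lt] at *
      constructor <;> linarith
  obtain ⟨Q, hQ, k, k', h1, h2⟩ := exists_recurrence a (a ^ 2) (ε / 2) (by linarith) 0
  obtain ⟨w₁, hw₁⟩ : ∃ z, z = Q * a - k := ⟨_, rfl⟩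
  obtain ⟨w₂, hw₂⟩ : ∃ z, z = Q * a ^ 2 - k' := ⟨_, rfl⟩
  rw [← hw₁] at h1
  rw [← hw₂] at h2
  have hw : w₁ ≠ 0 := by
    intro h
    have := ha (-k) Q 0 (by push_cast; linarith)
    omega
  obtain ⟨D, hDdef⟩ : ∃ z, z = w₁ ^ 2 + w₂ ^ 2 := ⟨_, rfl⟩
  have hD : 0 < D := by rw [hDdef]; positivity
  obtain ⟨s, hs, m, l, l', rfl⟩ :=
    Metric.dense_iff.1 (detSubgroup_dense ha (w₁ := w₁) (w₂ := w₂) (Or.inl hw))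
      (w₁ * y - w₂ * x) (D / 2) (by positivity)
  rw [Metric.mem_ball, Real.dist_eq] at hs
  obtain ⟨v₁, hv₁⟩ : ∃ z, z = x - (m * a - l) := ⟨_, rfl⟩
  obtain ⟨v₂, hv₂⟩ : ∃ z, z = y - (m * a ^ 2 - l') := ⟨_, rfl⟩
  obtain ⟨t, ht⟩ : ∃ z, z = round ((v₁ * w₁ + v₂ * w₂) / D) := ⟨_, rfl⟩
  have hr : |(v₁ * w₁ + v₂ * w₂) / D - t| ≤ 1 / 2 := ht ▸ abs_sub_round _
  have hr' : |(v₁ - t * w₁) * w₁ + (v₂ - t * w₂) * w₂| ≤ D / 2 := by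
    have e : (v₁ - t * w₁) * w₁ + (v₂ - t * w₂) * w₂ = ((v₁ * w₁ + v₂ * w₂) / D - t) * D := by
      field_simp
      rw [hDdef]; ring
    rw [e, abs_mul, abs_of_pos hD]
    nlinarith
  have hd : |w₁ * (v₂ - t * w₂) - w₂ * (v₁ - t * w₁)| ≤ D / 2 := by
    rw [abs_sub_comm] at hs
    refine le_trans (le_of_eq ?_) hs.le
    congr 1
    rw [hv₁, hv₂]; ring
  have hsum : ((v₁ - t * w₁) ^ 2 + (v₂ - t * w₂) ^ 2) ≤ D / 2 := by
    have e : ((v₁ - t * w₁) ^ 2 + (v₂ - t * w₂) ^ 2) * D =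
        ((v₁ - t * w₁) * w₁ + (v₂ - t * w₂) * w₂) ^ 2 +
        (w₁ * (v₂ - t * w₂) - w₂ * (v₁ - t * w₁)) ^ 2 := by rw [hDdef]; ring
    have e1 := sq_le_sq' (abs_le.1 hr').1 (abs_le.1 hr').2
    have e2 := sq_le_sq' (abs_le.1 hd).1 (abs_le.1 hd).2
    nlinarith
  have hDε : D < 2 * (ε / 2) ^ 2 := by
    have e1 := sq_lt_sq' (abs_lt.1 h1).1 (abs_lt.1 h1).2
    have e2 := sq_lt_sq' (abs_lt.1 h2).1 (abs_lt.1 h2).2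
    linarith
  refine ⟨m + t * (Q : ℤ), l + t * k, l' + t * k', ?_, ?_⟩
  · have : |v₁ - t * w₁| < ε / 2 := abs_lt_of_sq_lt_sq (by linarith [sq_nonneg (v₂ - t * w₂)])
      (by linarith)
    have e : ((m + t * (Q : ℤ) : ℤ) : ℝ) * a - (l + t * k : ℤ) - x = -(v₁ - t * w₁) := by
      rw [hv₁, hw₁]
      push_cast
      ring
    rw [e, abs_neg]
    exact this
  · have : |v₂ - t * w₂| < ε / 2 := abs_lt_of_sq_lt_sq (by linarith [sq_nonneg (v₁ - t * w₁)])
      (by linarith)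
    have e : ((m + t * (Q : ℤ) : ℤ) : ℝ) * a ^ 2 - (l' + t * k' : ℤ) - y = -(v₂ - t * w₂) := by
      rw [hv₂, hw₂]
      push_cast
      ring
    rw [e, abs_neg]
    exact this

/-- Among the points `k a` modulo one with `k ≤ n`, the point `m a` is the closest one
to the left of `c`. -/
def IsCursor (a c n m : ℝ) : Prop :=
  m ≤ n ∧ ∃ l : ℤ, a * m < c + l ∧
    ∀ m' : ℕ, (m' : ℝ) ≤ n → ∀ l' : ℤ, a * m' < c + l' → a * m' + l ≤ a * m + l'

/-- The point `a² m` lies, modulo one, within `η` to the right of `a² k`. -/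
def HasColor (a η N m k : ℝ) : Prop :=
  k ≤ N ∧ ∃ l : ℤ, a * (a * k) + l < a * (a * m) ∧ a * (a * m) < a * (a * k) + l + η

/-- The pair `(x, y)` is stored at position `n`. -/
def IsStored (a c₁ c₂ η N n x y : ℝ) : Prop :=
  ∃ m₁ : ℕ, IsCursor a c₁ n m₁ ∧ HasColor a η N m₁ x ∧
    ∃ m₂ : ℕ, IsCursor a c₂ n m₂ ∧ HasColor a η N m₂ y

/-- A first-order rendering of the transitive closure of a relation between pairs. -/
def ChainExists (a : ℝ) (R : ℝ → ℝ → ℝ → ℝ → Prop) (x₀ y₀ x₁ y₁ : ℝ) : Prop :=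
  ∃ p c₁ c₂ η : ℝ, ∃ N ns ne : ℕ, (ns : ℝ) ≤ ne ∧ IsCursor a p ns ns ∧ IsCursor a p ne ne ∧
    (∀ x y : ℕ, IsStored a c₁ c₂ η N ns x y → (x : ℝ) = x₀ ∧ (y : ℝ) = y₀) ∧
    (∀ n n' : ℕ, (ns : ℝ) ≤ n → (n : ℝ) < n' → (n' : ℝ) ≤ ne → IsCursor a p n n →
      IsCursor a p n' n' → (∀ k : ℕ, (n : ℝ) < k → (k : ℝ) < n' → ¬ IsCursor a p k k) →
      ∀ x' y' : ℕ, IsStored a c₁ c₂ η N n' x' y' →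
        ∃ x y : ℕ, IsStored a c₁ c₂ η N n x y ∧ R x y x' y') ∧
    IsStored a c₁ c₂ η N ne x₁ y₁

theorem ChainExists.reflTransGen {a : ℝ} {R : ℝ → ℝ → ℝ → ℝ → Prop} {x₀ y₀ x₁ y₁ : ℕ}
    (h : ChainExists a R x₀ y₀ x₁ y₁) :
    Relation.ReflTransGen (fun p q : ℕ × ℕ => R p.1 p.2 q.1 q.2) (x₀, y₀) (x₁, y₁) := by
  obtain ⟨p, c₁, c₂, η, N, ns, ne, hle, hs, he, h1, h2, h3⟩ := h
  suffices H : ∀ n : ℕ, ns ≤ n → n ≤ ne → IsCursor a p n n → ∀ x y : ℕ,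
      IsStored a c₁ c₂ η N n x y →
      Relation.ReflTransGen (fun p q : ℕ × ℕ => R p.1 p.2 q.1 q.2) (x₀, y₀) (x, y) from
    H ne (by exact_mod_cast hle) le_rfl he _ _ h3
  intro n
  induction n using Nat.strong_induction_on with
  | _ n ih =>
    intro hn hne hc x y hxy
    rcases hn.eq_or_lt with rfl | hlt
    · obtain ⟨e1, e2⟩ := h1 x y hxy
      rw [Nat.cast_inj.1 e1, Nat.cast_inj.1 e2]
    · classical
      let S : Finset ℕ := (Finset.range n).filter fun k : ℕ => IsCursor a p k k
      have hS : ns ∈ S := Finset.mem_filter.2 ⟨Finset.mem_range.2 hlt, hs⟩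
      have hm := S.max'_mem ⟨ns, hS⟩
      have hle' := S.le_max' ns hS
      set m := S.max' ⟨ns, hS⟩ with hmdef
      obtain ⟨hm1, hm2⟩ := Finset.mem_filter.1 hm
      rw [Finset.mem_range] at hm1
      obtain ⟨x', y', hst, hR⟩ := h2 m n (by exact_mod_cast hle') (by exact_mod_cast hm1)
        (by exact_mod_cast hne) hm2 hc (by
          intro k hk1 hk2 hk
          have hk1' : m < k := by exact_mod_cast hk1
          have := S.le_max' k (Finset.mem_filter.2
            ⟨Finset.mem_range.2 (by exact_mod_cast hk2), hk⟩)
          omega) x y hxy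
      exact (ih m hm1 hle' (by omega) hm2 x' y' hst).tail hR

/-- Nonzero values of `d b - l` with `|d| ≤ N` have absolute value at least `η`. -/
def Separated (b : ℝ) (N : ℕ) (η : ℝ) : Prop :=
  ∀ d l : ℤ, d.natAbs ≤ N → (d ≠ 0 ∨ l ≠ 0) → η ≤ |d * b - l|

theorem Separated.mono {b : ℝ} {N N' : ℕ} {η η' : ℝ} (h : Separated b N η) (hN : N' ≤ N)
    (hη : η' ≤ η) : Separated b N' η' :=
  fun d l hd hdl => hη.trans (h d l (hd.trans hN) hdl)

theorem exists_separated {b : ℝ} (hb : ∀ d l : ℤ, d ≠ 0 → (d : ℝ) * b - l ≠ 0) (N : ℕ) :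
    ∃ η : ℝ, 0 < η ∧ Separated b N η := by
  induction N with
  | zero =>
    refine ⟨1, one_pos, fun d l h hdl => ?_⟩
    have hd : d = 0 := by omega
    have hl : l ≠ 0 := by tauto
    have := Int.one_le_abs hl
    rw [hd]
    simp only [Int.cast_zero, zero_mul, zero_sub, abs_neg]
    exact_mod_cast this
  | succ N ih =>
    obtain ⟨η, hη, h⟩ := ih
    have hpos : 0 < |((N + 1 : ℕ) : ℤ) * b - round (((N + 1 : ℕ) : ℤ) * b)| :=
      abs_pos.2 (hb _ _ (by omega))
    refine ⟨min η |((N + 1 : ℕ) : ℤ) * b - round (((N + 1 : ℕ) : ℤ) * b)|, lt_min hη hpos,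
      fun d l hdN hdl => ?_⟩
    rcases Nat.lt_or_ge N d.natAbs with hlt | hge
    · refine (min_le_right _ _).trans ?_
      have : d = ((N + 1 : ℕ) : ℤ) ∨ d = -((N + 1 : ℕ) : ℤ) := by omega
      rcases this with rfl | rfl
      · exact round_le _ _
      · refine (round_le _ (-l)).trans (le_of_eq ?_)
        rw [← abs_neg]
        congr 1
        push_cast
        ring
    · exact (min_le_left _ _).trans (h d l hge hdl)

theorem isCursor_iff {a c ε : ℝ} {n m : ℕ} {l : ℤ} (hmn : m ≤ n) (hε : Separated a n ε)
    (h1 : a * m < c + l) (h2 : c + l < a * m + ε) (k : ℕ) :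
    IsCursor a c n k ↔ k = m := by
  have key : ∀ k : ℕ, k ≤ n → ∀ l' : ℤ, a * k < c + l' → (k ≠ m ∨ l' ≠ l) →
      a * k + l + ε ≤ a * m + l' := by
    intro k hk l' hkl hne
    by_contra! hlt
    have h3 := hε ((k : ℤ) - m) (l' - l) (by omega) (by omega)
    rcases abs_cases ((((k : ℤ) - m : ℤ) : ℝ) * a - (l' - l : ℤ)) with ⟨h4, -⟩ | ⟨h4, -⟩
    · rw [h4] at h3
      push_cast at h3
      nlinarith
    · rw [h4] at h3
      push_cast at h3
      nlinarith
  constructor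
  · rintro ⟨hk, l', hl', hmax⟩
    by_contra hne
    have e1 := key k (by exact_mod_cast hk) l' hl' (Or.inl hne)
    have e2 := hmax m (by exact_mod_cast hmn) l h1
    linarith
  · rintro rfl
    refine ⟨by exact_mod_cast hmn, l, h1, fun m' hm' l' h => ?_⟩
    by_cases hne : m' ≠ k ∨ l' ≠ l
    · have := key m' (by exact_mod_cast hm') l' h hne
      linarith
    · push Not at hne
      rw [hne.1, hne.2]

theorem HasColor.unique {a η : ℝ} {N m k k' : ℕ} (hη : Separated (a ^ 2) N η)
    (h : HasColor a η N m k) (h' : HasColor a η N m k') : k = k' := by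
  obtain ⟨hk, l, h1, h2⟩ := h
  obtain ⟨hk', l', h1', h2'⟩ := h'
  by_contra hne
  have hk0 : k ≤ N := by exact_mod_cast hk
  have hk0' : k' ≤ N := by exact_mod_cast hk'
  have h3 := hη ((k : ℤ) - k') (l' - l) (by omega) (by omega)
  rcases abs_cases ((((k : ℤ) - k' : ℤ) : ℝ) * a ^ 2 - (l' - l : ℤ)) with ⟨h4, -⟩ | ⟨h4, -⟩
  · rw [h4] at h3
    push_cast at h3
    nlinarith
  · rw [h4] at h3
    push_cast at h3
    nlinarith

/-- An interval of values of `c` for which the cursor at `n` has a prescribed colour. -/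
theorem exists_cursor_interval {a η C D : ℝ} (ha : QuadFree a) (hη : 0 < η) (hCD : C < D)
    {N k : ℕ} (hk : k ≤ N) :
    ∃ m : ℕ, ∃ l : ℤ, C < a * m - l ∧ a * m - l < D ∧ HasColor a η N m k := by
  obtain ⟨m, -, l, l', h1, h2⟩ := kronecker ha ((C + D) / 2) (a ^ 2 * k + η / 2)
    (min ((D - C) / 2) (η / 2)) (by apply lt_min <;> linarith) 0
  have h1' := abs_lt.1 (h1.trans_le (min_le_left _ _))
  have h2' := abs_lt.1 (h2.trans_le (min_le_right _ _))
  refine ⟨m, l, by linarith [h1'.1], by linarith [h1'.2], by exact_mod_cast hk, l', ?_, ?_⟩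
  · nlinarith [h2'.1]
  · nlinarith [h2'.2]

theorem isStored_iff {a c₁ c₂ ε η : ℝ} {N n m₁ m₂ k₁ k₂ : ℕ} {l₁ l₂ : ℤ} (h₁ : m₁ ≤ n) (h₂ : m₂ ≤ n)
    (hε : Separated a n ε) (hη : Separated (a ^ 2) N η)
    (hc₁ : a * m₁ - l₁ < c₁) (hc₁' : c₁ < a * m₁ - l₁ + ε)
    (hc₂ : a * m₂ - l₂ < c₂) (hc₂' : c₂ < a * m₂ - l₂ + ε)
    (hk₁ : HasColor a η N m₁ k₁) (hk₂ : HasColor a η N m₂ k₂) (x y : ℕ) :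
    IsStored a c₁ c₂ η N n x y ↔ x = k₁ ∧ y = k₂ := by
  have e₁ := isCursor_iff (c := c₁) (l := l₁) h₁ hε (by linarith) (by linarith)
  have e₂ := isCursor_iff (c := c₂) (l := l₂) h₂ hε (by linarith) (by linarith)
  constructor
  · rintro ⟨m, hm, hx, m', hm', hy⟩
    rw [e₁] at hm
    rw [e₂] at hm'
    subst hm hm'
    exact ⟨hx.unique hη hk₁, hy.unique hη hk₂⟩
  · rintro ⟨rfl, rfl⟩
    exact ⟨m₁, (e₁ _).2 rfl, hk₁, m₂, (e₂ _).2 rfl, hk₂⟩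

theorem QuadFree.sep₁ {a : ℝ} (ha : QuadFree a) (d l : ℤ) (hd : d ≠ 0) : (d : ℝ) * a - l ≠ 0 :=
  fun h => hd (ha (-l) d 0 (by push_cast; linarith)).2.1

theorem QuadFree.sep₂ {a : ℝ} (ha : QuadFree a) (d l : ℤ) (hd : d ≠ 0) :
    (d : ℝ) * a ^ 2 - l ≠ 0 :=
  fun h => hd (ha (-l) 0 d (by push_cast; linarith)).2.2

/-- The smallest positive `q` for which `a q` lies, modulo one, in `[0, η)`. -/
theorem exists_first_return {a η : ℝ} (ha : QuadFree a) (hη : 0 < η) :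
    ∃ q : ℕ, 0 < q ∧ (∃ j : ℤ, 0 < a * q - j ∧ a * q - j < η) ∧
      ∀ d : ℕ, 0 < d → d < q → ∀ j : ℤ, 0 ≤ a * d - j → η ≤ a * d - j := by
  classical
  have hex : ∃ q : ℕ, 0 < q ∧ ∃ j : ℤ, 0 ≤ a * q - j ∧ a * q - j < η := by
    obtain ⟨m, hm, l, -, h1, -⟩ := kronecker ha (η / 2) 0 (η / 2) (by linarith) 0
    have h1' := abs_lt.1 h1
    exact ⟨m, hm, l, by linarith [h1'.1], by linarith [h1'.2]⟩
  obtain ⟨hq, j, hj, hj'⟩ := Nat.find_spec hex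
  refine ⟨Nat.find hex, hq, ⟨j, lt_of_le_of_ne hj fun h0 => ?_, hj'⟩, fun d hd hdq j hj => ?_⟩
  · exact ha.sep₁ (Nat.find hex : ℤ) j (by omega) (by push_cast; linarith)
  · by_contra! hlt
    exact Nat.find_min hex hdq ⟨hd, j, hj, hlt⟩

theorem chainExists_of_bounded {a : ℝ} (ha : QuadFree a) {R : ℝ → ℝ → ℝ → ℝ → Prop}
    {x₀ y₀ x₁ y₁ N : ℕ} (hx₀ : x₀ ≤ N) (hy₀ : y₀ ≤ N)
    (h : Relation.ReflTransGen (fun p q : ℕ × ℕ => R p.1 p.2 q.1 q.2 ∧ q.1 ≤ N ∧ q.2 ≤ N)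
      (x₀, y₀) (x₁, y₁)) : ChainExists a R x₀ y₀ x₁ y₁ := by
  obtain ⟨η, hη0, hη⟩ := exists_separated ha.sep₂ N
  suffices H : ∀ r : ℕ × ℕ, Relation.ReflTransGen
      (fun p q : ℕ × ℕ => R p.1 p.2 q.1 q.2 ∧ q.1 ≤ N ∧ q.2 ≤ N) (x₀, y₀) r →
      ∃ ns n : ℕ, ∃ l : ℤ, ∃ ε C₁ D₁ C₂ D₂ : ℝ, ns ≤ n ∧ 0 < ε ∧ C₁ < D₁ ∧ C₂ < D₂ ∧
        ∀ p c₁ c₂, a * n - l < p → p < a * n - l + ε → C₁ < c₁ → c₁ < D₁ → C₂ < c₂ → c₂ < D₂ →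
          IsCursor a p ns ns ∧ IsCursor a p n n ∧
          (∀ x y : ℕ, IsStored a c₁ c₂ η N ns x y → x = x₀ ∧ y = y₀) ∧
          (∀ k k' : ℕ, ns ≤ k → k < k' → k' ≤ n → IsCursor a p k k →
            IsCursor a p k' k' → (∀ i : ℕ, k < i → i < k' → ¬ IsCursor a p i i) →
            ∀ x' y' : ℕ, IsStored a c₁ c₂ η N k' x' y' →
              ∃ x y : ℕ, IsStored a c₁ c₂ η N k x y ∧ R x y x' y') ∧
          ∀ x y : ℕ, IsStored a c₁ c₂ η N n x y ↔ x = r.1 ∧ y = r.2 by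
    obtain ⟨ns, n, l, ε, C₁, D₁, C₂, D₂, hle, hε, h₁, h₂, H⟩ := H _ h
    obtain ⟨e1, e2, e3, e4, e5⟩ := H (a * n - l + ε / 2) ((C₁ + D₁) / 2) ((C₂ + D₂) / 2)
      (by linarith) (by linarith) (by linarith) (by linarith) (by linarith) (by linarith)
    refine ⟨_, _, _, η, N, ns, n, by exact_mod_cast hle, e1, e2, fun x y hxy => ?_,
      fun k k' h1 h2 h3 h4 h5 h6 => ?_, (e5 _ _).2 ⟨rfl, rfl⟩⟩
    · obtain ⟨rfl, rfl⟩ := e3 x y hxy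
      exact ⟨rfl, rfl⟩
    · exact e4 k k' (by exact_mod_cast h1) (by exact_mod_cast h2) (by exact_mod_cast h3) h4 h5
        fun i hi hi' => h6 i (by exact_mod_cast hi) (by exact_mod_cast hi')
  intro r hr
  induction hr with
  | refl =>
    obtain ⟨m₁, l₁, -, -, hc₁⟩ := exists_cursor_interval ha hη0 one_pos hx₀
    obtain ⟨m₂, l₂, -, -, hc₂⟩ := exists_cursor_interval ha hη0 one_pos hy₀
    obtain ⟨ε, hε0, hε⟩ := exists_separated ha.sep₁ (max m₁ m₂)
    refine ⟨max m₁ m₂, max m₁ m₂, 0, ε, a * m₁ - l₁, a * m₁ - l₁ + ε, a * m₂ - l₂, a * m₂ - l₂ + ε,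
      le_rfl, hε0, by linarith, by linarith, fun p c₁ c₂ h1 h2 h3 h4 h5 h6 => ?_⟩
    have hcur : IsCursor a p (max m₁ m₂ : ℕ) (max m₁ m₂ : ℕ) :=
      (isCursor_iff (l := 0) le_rfl hε (by push_cast at *; linarith)
        (by push_cast at *; linarith) _).2 rfl
    have hst := isStored_iff (le_max_left m₁ m₂) (le_max_right m₁ m₂) hε hη h3 h4 h5 h6 hc₁ hc₂
    exact ⟨hcur, hcur, fun x y => (hst x y).1, fun k k' h1 h2 h3 => by omega, hst⟩
  | @tail s r _ hsr ih =>
    obtain ⟨ns, n, l, ε, C₁, D₁, C₂, D₂, hle, hε0, h₁, h₂, H⟩ := ih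
    obtain ⟨hR, hN₁, hN₂⟩ := hsr
    obtain ⟨m₁, l₁, hm₁, hm₁', hc₁⟩ := exists_cursor_interval ha hη0 h₁ hN₁
    obtain ⟨m₂, l₂, hm₂, hm₂', hc₂⟩ := exists_cursor_interval ha hη0 h₂ hN₂
    obtain ⟨δ, hδ0, hδ⟩ := exists_separated ha.sep₁ (max m₁ m₂)
    obtain ⟨q, hq0, ⟨j, hj0, hj1⟩, hq⟩ := exists_first_return ha (lt_min hδ0 hε0)
    have hqm : max m₁ m₂ < q := by
      by_contra! hqm
      have h1 := hδ q j (by omega) (by omega)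
      have h2 := min_le_left δ ε
      push_cast at h1
      rw [mul_comm, abs_of_pos hj0] at h1
      linarith
    have hm₁q : m₁ ≤ n + q := by have := le_max_left m₁ m₂; omega
    have hm₂q : m₂ ≤ n + q := by have := le_max_right m₁ m₂; omega
    obtain ⟨ζ, hζ0, hζ⟩ := exists_separated ha.sep₁ (n + q)
    obtain ⟨θ, hθ⟩ : ∃ θ, θ = min ζ (min (min δ ε - (a * q - j))
      (min (D₁ - (a * m₁ - l₁)) (D₂ - (a * m₂ - l₂)))) := ⟨_, rfl⟩
    have hθ0 : 0 < θ := by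
      rw [hθ]
      refine lt_min hζ0 (lt_min ?_ (lt_min ?_ ?_)) <;> linarith
    have hθ1 : θ ≤ ζ := hθ.le.trans (min_le_left _ _)
    have hθ' := hθ.le.trans (min_le_right _ _)
    have hθ2 : θ ≤ min δ ε - (a * q - j) := hθ'.trans (min_le_left _ _)
    have hθ3 : θ ≤ D₁ - (a * m₁ - l₁) := (hθ'.trans (min_le_right _ _)).trans (min_le_left _ _)
    have hθ4 : θ ≤ D₂ - (a * m₂ - l₂) := (hθ'.trans (min_le_right _ _)).trans (min_le_right _ _)
    have hζ' := hζ.mono le_rfl hθ1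
    have hmin := min_le_right δ ε
    refine ⟨ns, n + q, l + j, θ, a * m₁ - l₁, a * m₁ - l₁ + θ, a * m₂ - l₂, a * m₂ - l₂ + θ,
      by omega, hθ0, by linarith, by linarith, fun p c₁ c₂ h1 h2 h3 h4 h5 h6 => ?_⟩
    push_cast at h1 h2
    have hcur : IsCursor a p (n + q : ℕ) (n + q : ℕ) :=
      (isCursor_iff (l := l + j) le_rfl hζ' (by push_cast; linarith)
        (by push_cast; linarith) _).2 rfl
    have hst := isStored_iff hm₁q hm₂q hζ' hη h3 h4 h5 h6 hc₁ hc₂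
    obtain ⟨i1, i2, i3, i4, i5⟩ := H p c₁ c₂ (by linarith) (by linarith) (by linarith)
      (by linarith) (by linarith) (by linarith)
    refine ⟨i1, hcur, i3, fun k k' hk hkk' hk' hck hck' hno x' y' hs' => ?_, hst⟩
    rcases Nat.lt_or_ge n k' with hnk' | hnk'
    · have hk'eq : k' = n + q := by
        by_contra hne
        obtain ⟨-, l'', hl1, hl2⟩ := hck'
        have hl3 := hl2 n (by exact_mod_cast hnk'.le) l (by linarith)
        have hd := hq (k' - n) (by omega) (by omega) (l'' - l) (by
          push_cast [hnk'.le]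
          linarith)
        push_cast [hnk'.le] at hd
        linarith
      have hkn : k = n := by
        rcases Nat.lt_trichotomy k n with hlt | heq | hgt
        · exact absurd i2 (hno n hlt (by omega))
        · exact heq
        · exfalso
          obtain ⟨-, l'', hl1, hl2⟩ := hck
          have hl3 := hl2 n (by exact_mod_cast hgt.le) l (by linarith)
          have hd := hq (k - n) (by omega) (by omega) (l'' - l) (by
            push_cast [hgt.le]
            linarith)
          push_cast [hgt.le] at hd
          linarith
      subst hk'eq hkn
      obtain ⟨rfl, rfl⟩ := (hst x' y').1 hs'
      exact ⟨s.1, s.2, (i5 _ _).2 ⟨rfl, rfl⟩, hR⟩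
    · exact i4 k k' hk hkk' hnk' hck hck' hno x' y' hs'

theorem chainExists_iff {a : ℝ} (ha : QuadFree a) {R : ℝ → ℝ → ℝ → ℝ → Prop}
    {x₀ y₀ x₁ y₁ : ℕ} : ChainExists a R x₀ y₀ x₁ y₁ ↔
      Relation.ReflTransGen (fun p q : ℕ × ℕ => R p.1 p.2 q.1 q.2) (x₀, y₀) (x₁, y₁) := by
  refine ⟨ChainExists.reflTransGen, fun h => ?_⟩
  obtain ⟨N, hx, hy, hN⟩ : ∃ N, x₀ ≤ N ∧ y₀ ≤ N ∧ Relation.ReflTransGen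
      (fun p q : ℕ × ℕ => R p.1 p.2 q.1 q.2 ∧ q.1 ≤ N ∧ q.2 ≤ N) (x₀, y₀) (x₁, y₁) := by
    generalize (x₁, y₁) = r at h
    induction h with
    | refl => exact ⟨max x₀ y₀, le_max_left _ _, le_max_right _ _, .refl⟩
    | @tail s r _ hsr ih =>
      obtain ⟨N, hx, hy, hN⟩ := ih
      refine ⟨max N (max r.1 r.2), hx.trans (le_max_left _ _), hy.trans (le_max_left _ _), ?_⟩
      refine Relation.ReflTransGen.tail (Relation.ReflTransGen.mono
        (fun p q h => ⟨h.1, h.2.1.trans (le_max_left _ _), h.2.2.trans (le_max_left _ _)⟩) _ _ hN)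
        ⟨hsr, (le_max_left _ _).trans (le_max_right _ _),
          (le_max_right _ _).trans (le_max_right _ _)⟩
  exact chainExists_of_bounded ha hx hy hN

section Definability

open FirstOrder Language

/-- The unary function symbol `λ`. -/
def mulSymbol : sLang.Functions 1 := ()

/-- The binary function symbol `+`. -/
def addSymbol : sLang.Functions 2 := ()

/-- The unary relation symbol for `ℤ`. -/
def intSymbol : sLang.Relations 1 := ()

/-- The binary relation symbol `<`. -/
def ltSymbol : sLang.Relations 2 := ()

/-- Prepend a value to an assignment. -/
def consEnv {α : Type*} (x : α) (v : ℕ → α) : ℕ → α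
  | 0 => x
  | n + 1 => v n

/-- The relation `P` on assignments is definable in `S_a`. -/
def IsDef (a : ℝ) (P : (ℕ → ℝ) → Prop) : Prop :=
  letI := sStruc a
  ∃ φ : sLang.Formula ℕ, ∀ v, φ.Realize v ↔ P v

/-- The function `t` on assignments is given by a term of `S_a`. -/
def IsTerm (a : ℝ) (t : (ℕ → ℝ) → ℝ) : Prop :=
  letI := sStruc a
  ∃ τ : sLang.Term ℕ, ∀ v, τ.realize v = t v

section definability

variable {a : ℝ}

theorem IsTerm.var (i : ℕ) : IsTerm a fun v => v i := ⟨Term.var i, fun _ => rfl⟩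

theorem IsTerm.smul {t : (ℕ → ℝ) → ℝ} (h : IsTerm a t) : IsTerm a fun v => a * t v := by
  obtain ⟨τ, hτ⟩ := h
  exact ⟨Term.func mulSymbol fun _ => τ, fun v => congrArg (a * ·) (hτ v)⟩

theorem IsTerm.add {t s : (ℕ → ℝ) → ℝ} (h : IsTerm a t) (h' : IsTerm a s) :
    IsTerm a fun v => t v + s v := by
  obtain ⟨τ, hτ⟩ := h
  obtain ⟨σ, hσ⟩ := h'
  exact ⟨Term.func addSymbol ![τ, σ], fun v => congrArg₂ (· + ·) (hτ v) (hσ v)⟩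

theorem IsDef.iff {P Q : (ℕ → ℝ) → Prop} (h : IsDef a P) (hPQ : ∀ v, Q v ↔ P v) : IsDef a Q := by
  rwa [show Q = P from funext fun v => propext (hPQ v)]

theorem IsDef.lt {t s : (ℕ → ℝ) → ℝ} (h : IsTerm a t) (h' : IsTerm a s) :
    IsDef a fun v => t v < s v := by
  let _ := sStruc a
  obtain ⟨τ, hτ⟩ := h
  obtain ⟨σ, hσ⟩ := h'
  refine ⟨Relations.formula ltSymbol ![τ, σ], fun v => ?_⟩
  beta_reduce
  rw [Formula.realize_rel, ← hτ, ← hσ]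
  rfl

theorem IsDef.eq {t s : (ℕ → ℝ) → ℝ} (h : IsTerm a t) (h' : IsTerm a s) :
    IsDef a fun v => t v = s v := by
  let _ := sStruc a
  obtain ⟨τ, hτ⟩ := h
  obtain ⟨σ, hσ⟩ := h'
  exact ⟨τ.equal σ, fun v => by beta_reduce; rw [Formula.realize_equal, ← hτ, ← hσ]⟩

theorem IsDef.int {t : (ℕ → ℝ) → ℝ} (h : IsTerm a t) : IsDef a fun v => ∃ z : ℤ, t v = z := by
  let _ := sStruc a
  obtain ⟨τ, hτ⟩ := h
  refine ⟨Relations.formula intSymbol ![τ], fun v => ?_⟩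
  beta_reduce
  rw [Formula.realize_rel, ← hτ]
  rfl

theorem IsDef.imp {P Q : (ℕ → ℝ) → Prop} (h : IsDef a P) (h' : IsDef a Q) :
    IsDef a fun v => P v → Q v := by
  let _ := sStruc a
  obtain ⟨φ, hφ⟩ := h
  obtain ⟨ψ, hψ⟩ := h'
  exact ⟨φ.imp ψ, fun v => by rw [Formula.realize_imp, hφ, hψ]⟩

theorem IsDef.not {P : (ℕ → ℝ) → Prop} (h : IsDef a P) : IsDef a fun v => ¬ P v := by
  let _ := sStruc a
  obtain ⟨φ, hφ⟩ := h
  exact ⟨φ.not, fun v => by rw [Formula.realize_not, hφ]⟩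

theorem IsDef.and {P Q : (ℕ → ℝ) → Prop} (h : IsDef a P) (h' : IsDef a Q) :
    IsDef a fun v => P v ∧ Q v :=
  (h.imp h'.not).not.iff fun v => by tauto

theorem IsDef.or {P Q : (ℕ → ℝ) → Prop} (h : IsDef a P) (h' : IsDef a Q) :
    IsDef a fun v => P v ∨ Q v :=
  (h.not.imp h').iff fun v => by tauto

theorem IsDef.le {t s : (ℕ → ℝ) → ℝ} (h : IsTerm a t) (h' : IsTerm a s) :
    IsDef a fun v => t v ≤ s v :=
  (IsDef.lt h' h).not.iff fun _ => not_lt.symm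

theorem IsDef.rename {P : (ℕ → ℝ) → Prop} (h : IsDef a P) (r : ℕ → ℕ) :
    IsDef a fun v => P fun i => v (r i) := by
  let _ := sStruc a
  obtain ⟨φ, hφ⟩ := h
  exact ⟨φ.relabel r, fun v => by rw [Formula.realize_relabel, hφ]; rfl⟩

theorem IsDef.all {P : ℝ → (ℕ → ℝ) → Prop} (h : IsDef a fun v => P (v 0) fun i => v (i + 1)) :
    IsDef a fun v => ∀ x, P x v := by
  let _ := sStruc a
  obtain ⟨φ, hφ⟩ := h
  refine ⟨(φ.relabel (fun i => Nat.casesOn i (Sum.inr ()) Sum.inl : ℕ → ℕ ⊕ Unit)).iAlls Unit,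
    fun v => ?_⟩
  rw [Formula.realize_iAlls]
  simp only [Formula.realize_relabel, hφ]
  exact ⟨fun H x => H fun _ => x, fun H i => H (i ())⟩

theorem IsDef.ex {P : ℝ → (ℕ → ℝ) → Prop} (h : IsDef a fun v => P (v 0) fun i => v (i + 1)) :
    IsDef a fun v => ∃ x, P x v :=
  (IsDef.all (P := fun x v => ¬ P x v) h.not).not.iff fun v => by simp

theorem IsDef.exInt {P : ℝ → (ℕ → ℝ) → Prop} (h : IsDef a fun v => P (v 0) fun i => v (i + 1)) :
    IsDef a fun v => ∃ z : ℤ, P z v :=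
  (IsDef.ex (P := fun x v => (∃ z : ℤ, x = z) ∧ P x v) ((IsDef.int (.var 0)).and h)).iff
    fun _ => ⟨fun ⟨z, hz⟩ => ⟨z, ⟨z, rfl⟩, hz⟩, fun ⟨_, ⟨z, hz⟩, h⟩ => ⟨z, hz ▸ h⟩⟩

theorem IsDef.allInt {P : ℝ → (ℕ → ℝ) → Prop} (h : IsDef a fun v => P (v 0) fun i => v (i + 1)) :
    IsDef a fun v => ∀ z : ℤ, P z v :=
  (IsDef.exInt (P := fun x v => ¬ P x v) h.not).not.iff fun v => by simp

theorem IsDef.exNat {P : ℝ → (ℕ → ℝ) → Prop} (h : IsDef a fun v => P (v 0) fun i => v (i + 1)) :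
    IsDef a fun v => ∃ n : ℕ, P n v :=
  (IsDef.exInt (P := fun x v => ¬ x + x < x ∧ P x v)
    ((IsDef.lt ((IsTerm.var 0).add (.var 0)) (.var 0)).not.and h)).iff
    fun v => ⟨fun ⟨n, hn⟩ => ⟨n, by simp, hn⟩, fun ⟨z, hz, h⟩ => by
      have hz : (0 : ℝ) ≤ z := by linarith
      lift z to ℕ using (by exact_mod_cast hz)
      exact ⟨z, h⟩⟩

theorem IsDef.allNat {P : ℝ → (ℕ → ℝ) → Prop} (h : IsDef a fun v => P (v 0) fun i => v (i + 1)) :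
    IsDef a fun v => ∀ n : ℕ, P n v :=
  (IsDef.exNat (P := fun x v => ¬ P x v) h.not).not.iff fun v => by simp

theorem IsDef.isCursor (i j k : ℕ) : IsDef a fun v => IsCursor a (v i) (v j) (v k) := by
  refine .and (.le (.var _) (.var _)) (.exInt (P := fun l v => a * v k < v i + l ∧
    ∀ m' : ℕ, (m' : ℝ) ≤ v j → ∀ l' : ℤ, a * m' < v i + l' → a * m' + l ≤ a * v k + l') ?_)
  refine .and (.lt (IsTerm.var _).smul ((IsTerm.var _).add (.var _)))
    (.allNat (P := fun m' v => m' ≤ v (j + 1) → ∀ l' : ℤ, a * m' < v (i + 1) + l' →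
      a * m' + v 0 ≤ a * v (k + 1) + l') ?_)
  refine .imp (.le (.var _) (.var _)) (.allInt (P := fun l' v => a * v 0 < v (i + 2) + l' →
      a * v 0 + v 1 ≤ a * v (k + 2) + l') ?_)
  exact .imp (.lt (IsTerm.var _).smul ((IsTerm.var _).add (.var _)))
    (.le ((IsTerm.var _).smul.add (.var _)) ((IsTerm.var _).smul.add (.var _)))

theorem IsDef.hasColor (i j k l : ℕ) : IsDef a fun v => HasColor a (v i) (v j) (v k) (v l) := by
  refine .and (.le (.var _) (.var _)) (.exInt (P := fun z v => a * (a * v l) + z < a * (a * v k) ∧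
    a * (a * v k) < a * (a * v l) + z + v i) ?_)
  exact .and (.lt ((IsTerm.var _).smul.smul.add (.var _)) (IsTerm.var _).smul.smul)
    (.lt (IsTerm.var _).smul.smul (((IsTerm.var _).smul.smul.add (.var _)).add (.var _)))

theorem IsDef.isStored (i₁ i₂ i₃ i₄ i₅ i₆ i₇ : ℕ) :
    IsDef a fun v => IsStored a (v i₁) (v i₂) (v i₃) (v i₄) (v i₅) (v i₆) (v i₇) := by
  refine .exNat (P := fun m v => IsCursor a (v i₁) (v i₅) m ∧ HasColor a (v i₃) (v i₄) m (v i₆) ∧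
    ∃ m₂ : ℕ, IsCursor a (v i₂) (v i₅) m₂ ∧ HasColor a (v i₃) (v i₄) m₂ (v i₇)) ?_
  refine .and (.isCursor _ _ _) (.and (.hasColor _ _ _ _) (.exNat (P := fun m v =>
    IsCursor a (v (i₂ + 1)) (v (i₅ + 1)) m ∧
      HasColor a (v (i₃ + 1)) (v (i₄ + 1)) m (v (i₇ + 1))) ?_))
  exact .and (.isCursor _ _ _) (.hasColor _ _ _ _)

theorem IsDef.chainExists {R : ℝ → ℝ → ℝ → ℝ → (ℕ → ℝ) → Prop}
    (h : ∀ i j k l s : ℕ, IsDef a fun v => R (v i) (v j) (v k) (v l) fun n => v (n + s)) :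
    IsDef a fun v => ChainExists a (fun x y x' y' => R x y x' y' fun n => v (n + 4))
      (v 0) (v 1) (v 2) (v 3) := by
  refine .ex <| .ex <| .ex <| .ex ?_
  refine .exNat (P := fun N v => ∃ ns ne : ℕ, (ns : ℝ) ≤ ne ∧ IsCursor a (v 3) ns ns ∧
    IsCursor a (v 3) ne ne ∧
    (∀ x y : ℕ, IsStored a (v 2) (v 1) (v 0) N ns x y → (x : ℝ) = v 4 ∧ (y : ℝ) = v 5) ∧
    (∀ n n' : ℕ, (ns : ℝ) ≤ n → (n : ℝ) < n' → (n' : ℝ) ≤ ne → IsCursor a (v 3) n n →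
      IsCursor a (v 3) n' n' → (∀ k : ℕ, (n : ℝ) < k → (k : ℝ) < n' → ¬ IsCursor a (v 3) k k) →
      ∀ x' y' : ℕ, IsStored a (v 2) (v 1) (v 0) N n' x' y' →
        ∃ x y : ℕ, IsStored a (v 2) (v 1) (v 0) N n x y ∧ R x y x' y' fun n => v (n + 8)) ∧
    IsStored a (v 2) (v 1) (v 0) N ne (v 6) (v 7)) ?_
  refine .exNat (P := fun ns v => ∃ ne : ℕ, (ns : ℝ) ≤ ne ∧ IsCursor a (v 4) ns ns ∧
    IsCursor a (v 4) ne ne ∧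
    (∀ x y : ℕ, IsStored a (v 3) (v 2) (v 1) (v 0) ns x y → (x : ℝ) = v 5 ∧ (y : ℝ) = v 6) ∧
    (∀ n n' : ℕ, (ns : ℝ) ≤ n → (n : ℝ) < n' → (n' : ℝ) ≤ ne → IsCursor a (v 4) n n →
      IsCursor a (v 4) n' n' → (∀ k : ℕ, (n : ℝ) < k → (k : ℝ) < n' → ¬ IsCursor a (v 4) k k) →
      ∀ x' y' : ℕ, IsStored a (v 3) (v 2) (v 1) (v 0) n' x' y' →
        ∃ x y : ℕ, IsStored a (v 3) (v 2) (v 1) (v 0) n x y ∧ R x y x' y' fun n => v (n + 9)) ∧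
    IsStored a (v 3) (v 2) (v 1) (v 0) ne (v 7) (v 8)) ?_
  refine .exNat (P := fun ne v => v 0 ≤ ne ∧ IsCursor a (v 5) (v 0) (v 0) ∧
    IsCursor a (v 5) ne ne ∧
    (∀ x y : ℕ, IsStored a (v 4) (v 3) (v 2) (v 1) (v 0) x y → (x : ℝ) = v 6 ∧ (y : ℝ) = v 7) ∧
    (∀ n n' : ℕ, v 0 ≤ n → (n : ℝ) < n' → (n' : ℝ) ≤ ne → IsCursor a (v 5) n n →
      IsCursor a (v 5) n' n' → (∀ k : ℕ, (n : ℝ) < k → (k : ℝ) < n' → ¬ IsCursor a (v 5) k k) →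
      ∀ x' y' : ℕ, IsStored a (v 4) (v 3) (v 2) (v 1) n' x' y' →
        ∃ x y : ℕ, IsStored a (v 4) (v 3) (v 2) (v 1) n x y ∧ R x y x' y' fun n => v (n + 10)) ∧
    IsStored a (v 4) (v 3) (v 2) (v 1) ne (v 8) (v 9)) ?_
  refine .and (.le (.var _) (.var _)) <| .and (.isCursor _ _ _) <| .and (.isCursor _ _ _) <|
    .and ?_ <| .and ?_ (.isStored _ _ _ _ _ _ _)
  · refine .allNat (P := fun x v => ∀ y : ℕ, IsStored a (v 5) (v 4) (v 3) (v 2) (v 1) x y →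
      x = v 7 ∧ (y : ℝ) = v 8) <| .allNat (P := fun y v =>
      IsStored a (v 6) (v 5) (v 4) (v 3) (v 2) (v 0) y → v 0 = v 8 ∧ y = v 9) ?_
    exact .imp (.isStored _ _ _ _ _ _ _) (.and (.eq (.var _) (.var _)) (.eq (.var _) (.var _)))
  · refine .allNat (P := fun n v => ∀ n' : ℕ, v 1 ≤ n → (n : ℝ) < n' → (n' : ℝ) ≤ v 0 →
      IsCursor a (v 6) n n → IsCursor a (v 6) n' n' →
      (∀ k : ℕ, n < k → (k : ℝ) < n' → ¬ IsCursor a (v 6) k k) →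
      ∀ x' y' : ℕ, IsStored a (v 5) (v 4) (v 3) (v 2) n' x' y' →
        ∃ x y : ℕ, IsStored a (v 5) (v 4) (v 3) (v 2) n x y ∧ R x y x' y' fun n => v (n + 11)) ?_
    refine .allNat (P := fun n' v => v 2 ≤ v 0 → v 0 < n' → n' ≤ v 1 →
      IsCursor a (v 7) (v 0) (v 0) → IsCursor a (v 7) n' n' →
      (∀ k : ℕ, v 0 < k → (k : ℝ) < n' → ¬ IsCursor a (v 7) k k) →
      ∀ x' y' : ℕ, IsStored a (v 6) (v 5) (v 4) (v 3) n' x' y' →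
        ∃ x y : ℕ, IsStored a (v 6) (v 5) (v 4) (v 3) (v 0) x y ∧
          R x y x' y' fun n => v (n + 12)) ?_
    refine .imp (.le (.var _) (.var _)) <| .imp (.lt (.var _) (.var _)) <|
      .imp (.le (.var _) (.var _)) <| .imp (.isCursor _ _ _) <| .imp (.isCursor _ _ _) <|
      .imp ?_ ?_
    · refine .allNat (P := fun k v => v 1 < k → k < v 0 → ¬ IsCursor a (v 8) k k) ?_
      exact .imp (.lt (.var _) (.var _)) (.imp (.lt (.var _) (.var _)) (IsDef.isCursor _ _ _).not)
    · refine .allNat (P := fun x' v => ∀ y' : ℕ,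
        IsStored a (v 7) (v 6) (v 5) (v 4) (v 0) x' y' →
        ∃ x y : ℕ, IsStored a (v 7) (v 6) (v 5) (v 4) (v 1) x y ∧
          R x y x' y' fun n => v (n + 13)) ?_
      refine .allNat (P := fun y' v => IsStored a (v 8) (v 7) (v 6) (v 5) (v 1) (v 0) y' →
        ∃ x y : ℕ, IsStored a (v 8) (v 7) (v 6) (v 5) (v 2) x y ∧
          R x y (v 0) y' fun n => v (n + 14)) ?_
      refine .imp (.isStored _ _ _ _ _ _ _) (.exNat (P := fun x v =>
        ∃ y : ℕ, IsStored a (v 9) (v 8) (v 7) (v 6) (v 3) x y ∧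
          R x y (v 1) (v 0) fun n => v (n + 15)) ?_)
      refine .exNat (P := fun y v => IsStored a (v 10) (v 9) (v 8) (v 7) (v 4) (v 0) y ∧
          R (v 0) y (v 2) (v 1) fun n => v (n + 16)) ?_
      exact .and (.isStored _ _ _ _ _ _ _) (h _ _ _ _ 17)

/-- The relation `P` on natural numbers is definable in `S_a`. -/
def NatDef (a : ℝ) (P : (ℕ → ℕ) → Prop) : Prop :=
  ∃ Q, IsDef a Q ∧ ∀ v : ℕ → ℕ, (Q fun i => v i) ↔ P v

end definability

end Definability

section definability

variable {a : ℝ}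

theorem NatDef.iff {P Q : (ℕ → ℕ) → Prop} (h : NatDef a P) (hPQ : ∀ v, Q v ↔ P v) :
    NatDef a Q := by
  rwa [show Q = P from funext fun v => propext (hPQ v)]

theorem NatDef.imp {P Q : (ℕ → ℕ) → Prop} (h : NatDef a P) (h' : NatDef a Q) :
    NatDef a fun v => P v → Q v := by
  obtain ⟨φ, hφ, hφ'⟩ := h
  obtain ⟨ψ, hψ, hψ'⟩ := h'
  exact ⟨_, hφ.imp hψ, fun v => imp_congr (hφ' v) (hψ' v)⟩

theorem NatDef.not {P : (ℕ → ℕ) → Prop} (h : NatDef a P) : NatDef a fun v => ¬ P v := by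
  obtain ⟨φ, hφ, hφ'⟩ := h
  exact ⟨_, hφ.not, fun v => not_congr (hφ' v)⟩

theorem NatDef.and {P Q : (ℕ → ℕ) → Prop} (h : NatDef a P) (h' : NatDef a Q) :
    NatDef a fun v => P v ∧ Q v :=
  (h.imp h'.not).not.iff fun v => by tauto

theorem NatDef.or {P Q : (ℕ → ℕ) → Prop} (h : NatDef a P) (h' : NatDef a Q) :
    NatDef a fun v => P v ∨ Q v :=
  (h.not.imp h').iff fun v => by tauto

theorem NatDef.rename {P : (ℕ → ℕ) → Prop} (h : NatDef a P) (r : ℕ → ℕ) :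
    NatDef a fun v => P fun i => v (r i) := by
  obtain ⟨φ, hφ, hφ'⟩ := h
  exact ⟨_, hφ.rename r, fun v => hφ' fun i => v (r i)⟩

theorem NatDef.all {P : ℕ → (ℕ → ℕ) → Prop} (h : NatDef a fun v => P (v 0) fun i => v (i + 1)) :
    NatDef a fun v => ∀ x, P x v := by
  obtain ⟨φ, hφ, hφ'⟩ := h
  refine ⟨_, IsDef.allNat (P := fun x v => φ (consEnv x v)) (hφ.iff fun v => ?_), fun v => ?_⟩
  · refine iff_of_eq (congrArg φ (funext fun i => ?_))
    cases i <;> rfl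
  · refine forall_congr' fun x => Iff.trans (iff_of_eq (congrArg φ (funext fun i => ?_)))
      (hφ' (consEnv x v))
    cases i <;> rfl

theorem NatDef.ex {P : ℕ → (ℕ → ℕ) → Prop} (h : NatDef a fun v => P (v 0) fun i => v (i + 1)) :
    NatDef a fun v => ∃ x, P x v :=
  (NatDef.all (P := fun x v => ¬ P x v) h.not).not.iff fun v => by simp

theorem NatDef.lt (i j : ℕ) : NatDef a fun v => v i < v j :=
  ⟨_, IsDef.lt (.var i) (.var j), fun _ => Nat.cast_lt⟩

theorem NatDef.eq (i j : ℕ) : NatDef a fun v => v i = v j :=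
  ⟨_, IsDef.eq (.var i) (.var j), fun _ => Nat.cast_inj⟩

theorem NatDef.add (i j k : ℕ) : NatDef a fun v => v i = v j + v k :=
  ⟨_, IsDef.eq (.var i) ((IsTerm.var j).add (.var k)), fun _ => by beta_reduce; norm_cast⟩

theorem NatDef.zero (i : ℕ) : NatDef a fun v => v i = 0 :=
  (NatDef.add i i i).iff fun v => by omega

theorem NatDef.succ (i j : ℕ) : NatDef a fun v => v i = v j + 1 :=
  ((NatDef.lt j i).and (NatDef.all (P := fun y v => v j < y → ¬ y < v i)
    ((NatDef.lt _ _).imp (NatDef.lt _ _).not))).iff fun v =>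
    ⟨fun h => ⟨by omega, fun y h1 => by omega⟩, fun ⟨h, h'⟩ => by
      have := h' (v j + 1) (by omega)
      omega⟩

theorem NatDef.reflTransGen {R : ℕ → ℕ → ℕ → ℕ → (ℕ → ℕ) → Prop} (ha : QuadFree a)
    (h : NatDef a fun v => R (v 0) (v 1) (v 2) (v 3) fun n => v (n + 4)) (i j k l s : ℕ) :
    NatDef a fun v => Relation.ReflTransGen
      (fun p q : ℕ × ℕ => R p.1 p.2 q.1 q.2 fun n => v (n + s)) (v i, v j) (v k, v l) := by
  suffices H : NatDef a fun v => Relation.ReflTransGen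
      (fun p q : ℕ × ℕ => R p.1 p.2 q.1 q.2 fun n => v (n + 4)) (v 0, v 1) (v 2, v 3) from
    H.rename (consEnv i (consEnv j (consEnv k (consEnv l fun n => n + s))))
  obtain ⟨φ, hφ, hφ'⟩ := h
  refine ⟨_, IsDef.chainExists (R := fun x y x' y' w =>
    φ (consEnv x (consEnv y (consEnv x' (consEnv y' w))))) fun i j k l s => ?_, fun v => ?_⟩
  · refine (hφ.rename (consEnv i (consEnv j (consEnv k (consEnv l fun n => n + s))))).iff
      fun v => iff_of_eq (congrArg φ (funext fun i => ?_))
    rcases i with _ | _ | _ | _ | i <;> rfl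
  · beta_reduce
    rw [chainExists_iff ha]
    refine iff_of_eq ?_
    congr 1
    funext p q
    refine Eq.trans (congrArg φ (funext fun i => ?_))
      (propext (hφ' (consEnv p.1 (consEnv p.2 (consEnv q.1 (consEnv q.2 fun n => v (n + 4)))))))
    rcases i with _ | _ | _ | _ | i <;> rfl

theorem reflTransGen_iff_rec (G : ℕ → ℕ → Part ℕ) (s : Part ℕ) (n z : ℕ) :
    (∃ s₀ ∈ s, Relation.ReflTransGen (fun p q : ℕ × ℕ => q.1 = p.1 + 1 ∧ q.2 ∈ G p.1 p.2)
      (0, s₀) (n, z)) ↔ z ∈ (Nat.rec s (fun y IH => IH.bind (G y)) n : Part ℕ) := by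
  constructor
  · rintro ⟨s₀, hs, h⟩
    generalize hr : (n, z) = r at h
    have hn : n = r.1 := by rw [← hr]
    have hz : z = r.2 := by rw [← hr]
    rw [hn, hz]
    clear hn hz hr
    induction h with
    | refl => exact hs
    | @tail p q _ hpq ih =>
      rw [hpq.1]
      exact Part.mem_bind ih hpq.2
  · induction n generalizing z with
    | zero => exact fun h => ⟨z, h, .refl⟩
    | succ n ih =>
      intro h
      obtain ⟨y, hy, hz⟩ := Part.mem_bind_iff.1 h
      obtain ⟨s₀, hs, hch⟩ := ih y hy
      exact ⟨s₀, hs, hch.tail ⟨rfl, hz⟩⟩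

theorem NatDef.natRec (ha : QuadFree a) {S : (ℕ → ℕ) → Part ℕ} {G : ℕ → ℕ → (ℕ → ℕ) → Part ℕ}
    (hS : NatDef a fun v => v 0 ∈ S fun i => v (i + 1))
    (hG : NatDef a fun v => v 0 ∈ G (v 1) (v 2) fun i => v (i + 3)) (i j s : ℕ) :
    NatDef a fun v => v i ∈
      (Nat.rec (S fun n => v (n + s)) (fun y IH => IH.bind fun x => G y x fun n => v (n + s))
        (v j) : Part ℕ) := by
  have h := NatDef.reflTransGen (R := fun x y x' y' v => x' = x + 1 ∧ y' ∈ G x y v) ha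
    ((NatDef.succ 2 0).and (hG.rename (consEnv 3 (consEnv 0 (consEnv 1 fun n => n + 4)))))
  refine (NatDef.ex (P := fun s₀ v => s₀ ∈ S (fun n => v (n + s)) ∧ ∃ z, z = 0 ∧
    Relation.ReflTransGen (fun p q : ℕ × ℕ => q.1 = p.1 + 1 ∧ q.2 ∈ G p.1 p.2 fun n => v (n + s))
      (z, s₀) (v j, v i))
    ((hS.rename (consEnv 0 fun n => n + s + 1)).and (NatDef.ex (P := fun z v => z = 0 ∧
    Relation.ReflTransGen (fun p q : ℕ × ℕ => q.1 = p.1 + 1 ∧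
      q.2 ∈ G p.1 p.2 fun n => v (n + s + 1)) (z, v 0) (v (j + 1), v (i + 1)))
      ((NatDef.zero 0).and (h 0 1 (j + 2) (i + 2) (s + 2)))))).iff fun v => ?_
  rw [← reflTransGen_iff_rec]
  simp only [exists_eq_left]

theorem NatDef.mul (ha : QuadFree a) (i j k : ℕ) : NatDef a fun v => v i = v j * v k := by
  refine (NatDef.natRec ha (S := fun _ => Part.some 0) (G := fun _ y v => Part.some (y + v 0))
    ((NatDef.zero 0).iff fun v => Part.mem_some_iff)
    ((NatDef.add 0 2 3).iff fun v => Part.mem_some_iff) i j k).iff fun v => ?_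
  have : ∀ n m : ℕ, (Nat.rec (Part.some 0) (fun y IH => IH.bind fun x => Part.some (x + m)) n :
      Part ℕ) = Part.some (n * m) := by
    intro n m
    induction n with
    | zero => simp
    | succ n ih => simp only [ih, Part.bind_some, Nat.succ_mul]
  beta_reduce
  rw [this, Part.mem_some_iff, Nat.zero_add]

theorem NatDef.pair (ha : QuadFree a) (i j k : ℕ) :
    NatDef a fun v => v i = Nat.pair (v j) (v k) := by
  refine (((NatDef.lt j k).and (NatDef.ex (P := fun s v => s = v k * v k ∧ v i = s + v j)
    ((NatDef.mul ha _ _ _).and (NatDef.add _ _ _)))).or ((NatDef.lt j k).not.and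
    (NatDef.ex (P := fun s v => s = v j * v j ∧ ∃ t, t = s + v j ∧ v i = t + v k)
    ((NatDef.mul ha _ _ _).and (NatDef.ex
      (P := fun t v => t = v 0 + v (j + 1) ∧ v (i + 1) = t + v (k + 1))
      ((NatDef.add _ _ _).and (NatDef.add _ _ _))))))).iff fun v => ?_
  simp only [exists_eq_left, Nat.pair]
  split_ifs with h <;> simp [h]

theorem NatDef.ofPartrec (ha : QuadFree a) {f : ℕ →. ℕ} (hf : Nat.Partrec f) :
    NatDef a fun v => v 1 ∈ f (v 0) := by
  have key : ∀ {f : ℕ →. ℕ}, (NatDef a fun v => v 1 ∈ f (v 0)) →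
      ∀ i j, NatDef a fun v => v i ∈ f (v j) :=
    fun h i j => h.rename (consEnv j fun _ => i)
  induction hf with
  | zero => exact (NatDef.zero 1).iff fun v => Part.mem_some_iff
  | succ => exact (NatDef.succ 1 0).iff fun v => Part.mem_some_iff
  | left =>
    refine (NatDef.ex (P := fun z v => v 0 = Nat.pair (v 1) z) (NatDef.pair ha _ _ _)).iff
      fun v => Part.mem_some_iff.trans ⟨fun h => ⟨(v 0).unpair.2, by rw [h]; simp⟩, ?_⟩
    rintro ⟨z, h⟩
    rw [h]
    simp
  | right =>
    refine (NatDef.ex (P := fun z v => v 0 = Nat.pair z (v 1)) (NatDef.pair ha _ _ _)).iff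
      fun v => Part.mem_some_iff.trans ⟨fun h => ⟨(v 0).unpair.1, by rw [h]; simp⟩, ?_⟩
    rintro ⟨z, h⟩
    rw [h]
    simp
  | @pair f g _ _ hf hg =>
    refine (NatDef.ex (P := fun x v => x ∈ f (v 0) ∧ ∃ y, y ∈ g (v 0) ∧ v 1 = Nat.pair x y)
      ((key hf _ _).and (NatDef.ex (P := fun y v => y ∈ g (v 1) ∧ v 2 = Nat.pair (v 0) y)
        ((key hg _ _).and (NatDef.pair ha _ _ _))))).iff fun v => ?_
    simp only [Seq.seq, Part.map_eq_map, Part.mem_bind_iff, Part.mem_map_iff, Part.bind_map]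
    simp only [eq_comm]
  | @comp f g _ _ hf hg =>
    refine (NatDef.ex (P := fun x v => x ∈ g (v 0) ∧ v 1 ∈ f x)
      ((key hg _ _).and (key hf _ _))).iff fun v => ?_
    exact Part.mem_bind_iff
  | @prec f g _ _ hf hg =>
    have h := NatDef.natRec ha (S := fun v => f (v 0))
      (G := fun y x v => g (Nat.pair (v 0) (Nat.pair y x))) (key hf 0 1)
      ((NatDef.ex (P := fun z v => z = Nat.pair (v 1) (v 2) ∧ ∃ w, w = Nat.pair (v 3) z ∧ v 0 ∈ g w)
      ((NatDef.pair ha _ _ _).and (NatDef.ex (P := fun w v => w = Nat.pair (v 4) (v 0) ∧ v 1 ∈ g w)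
        ((NatDef.pair ha _ _ _).and (key hg _ _))))).iff fun v => by simp)
    refine (NatDef.ex (P := fun x v => ∃ y, v 0 = Nat.pair x y ∧ v 1 ∈ (Nat.rec (f x)
      (fun y IH => IH.bind fun i => g (Nat.pair x (Nat.pair y i))) y : Part ℕ))
      (NatDef.ex (P := fun y v => v 1 = Nat.pair (v 0) y ∧ v 2 ∈ (Nat.rec (f (v 0))
      (fun y IH => IH.bind fun i => g (Nat.pair (v 0) (Nat.pair y i))) y : Part ℕ))
      ((NatDef.pair ha _ _ _).and (h 3 0 1)))).iff fun v => ?_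
    constructor
    · exact fun h => ⟨_, _, (Nat.pair_unpair _).symm, h⟩
    · rintro ⟨x, y, h1, h2⟩
      simp only [Nat.unpaired, h1, Nat.unpair_pair]
      exact h2
  | @rfind f _ hf =>
    have h : ∀ i j, NatDef a fun v => ∃ m, m ∈ f (Nat.pair (v i) (v j)) ∧ m = 0 := fun i j =>
      (NatDef.ex (P := fun z v => z = Nat.pair (v i) (v j) ∧ ∃ m, m ∈ f z ∧ m = 0)
      ((NatDef.pair ha _ _ _).and (NatDef.ex (P := fun m v => m ∈ f (v 0) ∧ m = 0)
        ((key hf _ _).and (NatDef.zero _))))).iff fun v => by simp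
    have h' : ∀ i j, NatDef a fun v => ∃ m, m ∈ f (Nat.pair (v i) (v j)) ∧ ¬ m = 0 := fun i j =>
      (NatDef.ex (P := fun z v => z = Nat.pair (v i) (v j) ∧ ∃ m, m ∈ f z ∧ ¬ m = 0)
      ((NatDef.pair ha _ _ _).and (NatDef.ex (P := fun m v => m ∈ f (v 0) ∧ ¬ m = 0)
        ((key hf _ _).and (NatDef.zero _).not)))).iff fun v => by simp
    refine ((h 0 1).and (NatDef.all (P := fun k v => k < v 1 →
      ∃ m, m ∈ f (Nat.pair (v 0) k) ∧ ¬ m = 0) ((NatDef.lt _ _).imp (h' _ _)))).iff fun v => ?_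
    refine Nat.mem_rfind.trans ?_
    simp [Part.mem_map_iff]

end definability

section Undecidability

open FirstOrder Language

theorem exists_encode_append {α : Type*} [Encodable α] (l : List α) :
    ∃ g : ℕ → ℕ, Primrec g ∧ ∀ r : List α, Encodable.encode (l ++ r) = g (Encodable.encode r) := by
  induction l with
  | nil => exact ⟨id, Primrec.id, fun _ => rfl⟩
  | cons x l ih =>
    obtain ⟨g, hg, h⟩ := ih
    refine ⟨fun r => Nat.succ (Nat.pair (Encodable.encode x) (g r)),
      Primrec.succ.comp (Primrec₂.natPair.comp (Primrec.const _) hg), fun r => ?_⟩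
    rw [List.cons_append, Encodable.encode_list_cons, h]

/-- The sum of `n + 1` copies of the first bound variable. -/
def multipleTerm : ℕ → sLang.Term (Empty ⊕ Fin 2)
  | 0 => Term.var (Sum.inr 0)
  | n + 1 => Term.func addSymbol ![Term.var (Sum.inr 0), multipleTerm n]

theorem realize_multipleTerm (a : ℝ) (n : ℕ) (v : Empty ⊕ Fin 2 → ℝ) :
    letI := sStruc a
    (multipleTerm n).realize v = (n + 1 : ℕ) * v (Sum.inr 0) := by
  induction n with
  | zero => simp [multipleTerm]
  | succ n ih =>
    refine Eq.trans (b := v (Sum.inr 0) + (n + 1 : ℕ) * v (Sum.inr 0)) ?_ ?_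
    · exact congrArg (v (Sum.inr 0) + ·) ih
    · push_cast
      ring

/-- The sentence saying that `B` holds of `n + 1` and that number computed from the unit
characterized by `A`. -/
def numeralSentence (A B : sLang.BoundedFormula Empty 2) (n : ℕ) : sLang.Sentence :=
  BoundedFormula.all (BoundedFormula.all
    (A.imp ((BoundedFormula.equal (multipleTerm n) (Term.var (Sum.inr 1))).imp B)))

theorem primrec_encode_multipleTerm [∀ n, Encodable (sLang.Functions n)] :
    Primrec fun n => Encodable.encode (multipleTerm n) := by
  refine (Primrec.nat_rec₁ (f := fun _ x => Nat.succ (Nat.pair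
    (Encodable.encode (Sum.inr ⟨2, addSymbol⟩ : (Empty ⊕ Fin 2) ⊕ (Σ i, sLang.Functions i)))
    (Nat.succ (Nat.pair
    (Encodable.encode (Sum.inl (Sum.inr 0) : (Empty ⊕ Fin 2) ⊕ (Σ i, sLang.Functions i))) x))))
    (Encodable.encode (multipleTerm 0)) ?_).of_eq fun n => ?_
  · exact Primrec.succ.comp (Primrec₂.natPair.comp (Primrec.const _) (Primrec.succ.comp
      (Primrec₂.natPair.comp (Primrec.const _) Primrec.snd)))
  · induction n with
    | zero => rfl
    | succ n ih =>
      refine (congrArg (fun x => Nat.succ (Nat.pair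
        (Encodable.encode (Sum.inr ⟨2, addSymbol⟩ : (Empty ⊕ Fin 2) ⊕ (Σ i, sLang.Functions i)))
        (Nat.succ (Nat.pair (Encodable.encode
          (Sum.inl (Sum.inr 0) : (Empty ⊕ Fin 2) ⊕ (Σ i, sLang.Functions i))) x)))) ih).trans ?_
      change _ = Encodable.encode (Term.listEncode (multipleTerm (n + 1)))
      rw [multipleTerm, Term.listEncode]
      have : List.finRange 2 = [0, 1] := rfl
      rw [this]
      simp only [List.flatMap_cons, List.flatMap_nil, List.append_nil]
      rw [Encodable.encode_list_cons]
      rfl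

theorem primrec_sentenceEncode_numeralSentence (eF : ∀ n, Encodable (sLang.Functions n))
    (eR : ∀ n, Encodable (sLang.Relations n)) (A B : sLang.BoundedFormula Empty 2) :
    Primrec fun n => sentenceEncode eF eR (numeralSentence A B n) := by
  let _ := eF
  let _ := eR
  let T := (Σ k, sLang.Term (Empty ⊕ Fin k)) ⊕ ((Σ n, sLang.Relations n) ⊕ ℕ)
  obtain ⟨g, hg, hg'⟩ := exists_encode_append (α := T)
    (Sum.inr (Sum.inr 1) :: Sum.inr (Sum.inr 1) :: Sum.inr (Sum.inr 0) ::
      (A.listEncode ++ [Sum.inr (Sum.inr 0)]))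
  refine (hg.comp (Primrec.succ.comp (Primrec₂.natPair.comp
    (Primrec.nat_mul.comp (Primrec.const 2)
      (Primrec₂.natPair.comp (Primrec.const 2) primrec_encode_multipleTerm))
    (Primrec.const (Encodable.encode
      (Sum.inl ⟨2, Term.var (Sum.inr 1)⟩ :: B.listEncode : List T)))))).of_eq fun n => ?_
  have h : (numeralSentence A B n).listEncode = (Sum.inr (Sum.inr 1) :: Sum.inr (Sum.inr 1) ::
      Sum.inr (Sum.inr 0) :: (A.listEncode ++ [Sum.inr (Sum.inr 0)])) ++
      (Sum.inl ⟨2, multipleTerm n⟩ :: (Sum.inl ⟨2, Term.var (Sum.inr 1)⟩ :: B.listEncode) :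
        List T) := by
    simp [numeralSentence, BoundedFormula.listEncode]
  change _ = Encodable.encode (numeralSentence A B n).listEncode
  rw [h, hg', Encodable.encode_list_cons]
  rfl

theorem IsDef.eq_one (a : ℝ) : IsDef a fun v => v 0 = 1 := by
  refine ((IsDef.int (.var 0)).and ((IsDef.lt ((IsTerm.var 0).add (.var 0)) (.var 0)).not.and
    ((IsDef.eq ((IsTerm.var 0).add (.var 0)) (.var 0)).not.and (IsDef.allNat
    (P := fun x v => ¬ x + x = x → v 0 ≤ x) ((IsDef.eq ((IsTerm.var 0).add (.var 0))
      (.var 0)).not.imp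
      (.le (.var _) (.var _))))))).iff fun v => ?_
  constructor
  · intro h
    rw [h]
    refine ⟨⟨1, by simp⟩, by norm_num, by norm_num, fun n hn => ?_⟩
    have : n ≠ 0 := by
      rintro rfl
      simp at hn
    exact_mod_cast Nat.one_le_iff_ne_zero.2 this
  · rintro ⟨⟨z, hz⟩, h1, h2, h3⟩
    have h4 := h3 1 (by norm_num)
    rw [hz] at *
    have h5 : (z : ℝ) ≠ 0 := fun h => h2 (by linarith)
    have h6 : (0 : ℝ) ≤ z := by linarith
    have h7 : z ≠ 0 := by exact_mod_cast h5
    have h8 : 0 ≤ z := by exact_mod_cast h6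
    have h9 : z ≤ 1 := by exact_mod_cast h4
    have : z = 1 := by omega
    rw [this]
    simp

theorem not_theoryDecidable {a : ℝ} (ha : QuadFree a) :
    ¬ (letI := sStruc a; TheoryDecidable sLang ℝ) := by
  let _ := sStruc a
  rintro ⟨eF, eR, f, hf, hfφ⟩
  have hpart : Partrec fun n : ℕ => Nat.Partrec.Code.eval (Denumerable.ofNat Nat.Partrec.Code (n - 1))
        0 :=
    Nat.Partrec.Code.eval_part.comp ((Computable.ofNat _).comp Primrec.pred.to_comp)
      (Computable.const 0)
  obtain ⟨Q, ⟨ψ, hψ⟩, hQ⟩ := NatDef.ex (P := fun y v => y ∈ Nat.Partrec.Code.eval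
    (Denumerable.ofNat Nat.Partrec.Code (v 0 - 1)) 0)
      ((NatDef.ofPartrec ha (Partrec.nat_iff.1 hpart)).rename (consEnv 1 fun _ => 0))
  obtain ⟨ω, hω⟩ := IsDef.eq_one a
  obtain ⟨A, hA⟩ : ∃ A : sLang.BoundedFormula Empty 2, ∀ (v : Empty → ℝ) (xs : Fin 2 → ℝ),
      A.Realize v xs ↔ xs 0 = 1 :=
    ⟨BoundedFormula.relabel (n := 2) (k := 0) (fun _ => Sum.inr 0) ω, fun v xs => by
      rw [BoundedFormula.realize_relabel]
      refine Iff.trans (iff_of_eq ?_) (hω fun _ => xs 0)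
      exact congrArg₂ _ rfl (Subsingleton.elim _ _)⟩
  obtain ⟨B, hB⟩ : ∃ B : sLang.BoundedFormula Empty 2, ∀ (v : Empty → ℝ) (xs : Fin 2 → ℝ),
      B.Realize v xs ↔ Q fun _ => xs 1 :=
    ⟨BoundedFormula.relabel (n := 2) (k := 0) (fun _ => Sum.inr 1) ψ, fun v xs => by
      rw [BoundedFormula.realize_relabel]
      refine Iff.trans (iff_of_eq ?_) (hψ fun _ => xs 1)
      exact congrArg₂ _ rfl (Subsingleton.elim _ _)⟩
  have key : ∀ n, ℝ ⊨ numeralSentence A B n ↔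
      (Nat.Partrec.Code.eval (Denumerable.ofNat Nat.Partrec.Code n) 0).Dom := by
    intro n
    have h1 : ℝ ⊨ numeralSentence A B n ↔ ∀ x y : ℝ, x = 1 →
        (n + 1 : ℕ) * x = y → Q fun _ => y := by
      refine forall_congr' fun x => forall_congr' fun y => ?_
      rw [BoundedFormula.realize_imp, BoundedFormula.realize_imp, hA, hB]
      refine imp_congr Iff.rfl (imp_congr (iff_of_eq ?_) Iff.rfl)
      exact congrArg₂ _ (realize_multipleTerm a n _) rfl
    refine h1.trans ((Iff.intro (fun H => H 1 _ rfl (mul_one _)) ?_).trans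
      ((hQ fun _ => n + 1).trans Part.dom_iff_mem.symm))
    rintro H _ _ rfl rfl
    rwa [mul_one]
  refine ComputablePred.halting_problem 0 ⟨Classical.decPred _, ?_⟩
  refine (hf.comp ((primrec_sentenceEncode_numeralSentence eF eR A B).to_comp.comp
    Computable.encode)).of_eq fun c => ?_
  rw [Bool.eq_iff_iff, hfφ, key]
  simp

theorem quadFree_of_not_root {a : ℝ}
    (h : ¬ ∃ p : Polynomial ℚ, p ≠ 0 ∧ p.degree ≤ 2 ∧ Polynomial.aeval a p = 0) : QuadFree a := by
  intro n₁ n₂ n₃ h0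
  by_contra hne
  refine h ⟨Polynomial.C (n₃ : ℚ) * Polynomial.X ^ 2 + Polynomial.C (n₂ : ℚ) * Polynomial.X +
    Polynomial.C (n₁ : ℚ), fun hp => hne ?_, Polynomial.degree_quadratic_le, ?_⟩
  · have e1 := congrArg (Polynomial.coeff · 0) hp
    have e2 := congrArg (Polynomial.coeff · 1) hp
    have e3 := congrArg (Polynomial.coeff · 2) hp
    simp only [Polynomial.coeff_add, Polynomial.coeff_C_mul, Polynomial.coeff_X_pow,
      Polynomial.coeff_X, Polynomial.coeff_C, Polynomial.coeff_zero] at e1 e2 e3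
    norm_num at e1 e2 e3
    exact ⟨e1, e2, e3⟩
  · simp
    linarith

end Undecidability

/-- The data of a unit `β > 1` of norm one and trace `t` in a quadratic order, together with a
representation of `a` as a quotient of elements of `ℤ[β]`. -/
structure QuadUnit (a : ℝ) where
  t : ℤ
  β : ℝ
  P : ℤ
  Q : ℤ
  R : ℤ
  one_lt : 1 < β
  sq_eq : β ^ 2 = t * β - 1
  R_ne : R ≠ 0
  mul_eq : R * a = P + Q * β

theorem exists_quadUnit_of_int {a : ℝ} {A B C : ℤ} (hA : A ≠ 0)
    (h : (A : ℝ) * a ^ 2 + B * a + C = 0) (hirr : Irrational a) : Nonempty (QuadUnit a) := by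
  obtain ⟨d, hd⟩ : ∃ d : ℤ, d = B ^ 2 - 4 * A * C := ⟨_, rfl⟩
  have hsq : (2 * A * a + B) ^ 2 = (d : ℝ) := by
    rw [hd]
    push_cast
    linear_combination 4 * (A : ℝ) * h
  have hirr' : Irrational (2 * A * a + B) := by
    have : ((2 * A : ℤ) : ℝ) * a + B = 2 * A * a + B := by push_cast; ring
    rw [← this]
    exact (hirr.intCast_mul (by simpa using hA)).add_intCast B
  have hd0 : 0 < d := by
    have : (0 : ℝ) < d := by
      rw [← hsq]
      exact sq_pos_of_pos (abs_pos.2 hirr'.ne_zero) |>.trans_eq (sq_abs _)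
    exact_mod_cast this
  have hns : ¬ IsSquare d := by
    rintro ⟨r, hr⟩
    rw [hr] at hsq
    push_cast at hsq
    rw [← sq, sq_eq_sq_iff_eq_or_eq_neg] at hsq
    rcases hsq with h | h
    · exact hirr' ⟨r, by rw [h]; simp⟩
    · exact hirr' ⟨-r, by rw [h]; simp⟩
  obtain ⟨x, y, hxy, hy⟩ := Pell.exists_of_not_isSquare hd0 hns
  obtain ⟨D, hD⟩ : ∃ D : ℝ, D = |2 * A * a + B| := ⟨_, rfl⟩
  have hDsq : D ^ 2 = d := by rw [hD, sq_abs, hsq]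
  have hD0 : 0 < D := by rw [hD]; exact abs_pos.2 hirr'.ne_zero
  have hX : |x| ^ 2 - d * |y| ^ 2 = 1 := by rw [sq_abs, sq_abs, hxy]
  have hXr : (|x| : ℤ) ^ 2 - (d : ℝ) * (|y| : ℤ) ^ 2 = 1 := by exact_mod_cast hX
  have hy1 : 1 ≤ |y| := Int.one_le_abs hy
  have hx1 : 1 ≤ |x| := by
    refine Int.one_le_abs ?_
    rintro rfl
    nlinarith
  have hxr : (1 : ℝ) ≤ (|x| : ℤ) := by exact_mod_cast hx1
  have hyr : (1 : ℝ) ≤ (|y| : ℤ) := by exact_mod_cast hy1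
  have hlt : 1 < (|x| : ℤ) + (|y| : ℤ) * D := by nlinarith
  have hbe : ((|x| : ℤ) + (|y| : ℤ) * D) ^ 2 = (2 * |x| : ℤ) * ((|x| : ℤ) + (|y| : ℤ) * D) - 1 := by
    push_cast at hXr ⊢
    linear_combination (|(y : ℝ)|) ^ 2 * hDsq - hXr
  rcases abs_choice (2 * A * a + B) with hs | hs
  · exact ⟨⟨2 * |x|, _, - B * |y| - |x|, 1, 2 * A * |y|, hlt, hbe,
      by simpa using ⟨hA, hy⟩, by
        push_cast
        linear_combination (-|(y : ℝ)|) * (hD.trans hs)⟩⟩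
  · exact ⟨⟨2 * |x|, _, - B * |y| + |x|, -1, 2 * A * |y|, hlt, hbe,
      by simpa using ⟨hA, hy⟩, by
        push_cast
        linear_combination (|(y : ℝ)|) * (hD.trans hs)⟩⟩

theorem exists_quadUnit_of_rat {a : ℝ} (h : ¬ Irrational a) : Nonempty (QuadUnit a) := by
  obtain ⟨q, rfl⟩ := not_not.1 h
  have h5 := Real.sq_sqrt (show (0 : ℝ) ≤ 5 by norm_num)
  have h5' : 1 < √5 := Real.lt_sqrt_of_sq_lt (by norm_num)
  refine ⟨⟨3, (3 + √5) / 2, q.num, 0, q.den, by linarith, ?_, by simp, ?_⟩⟩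
  · push_cast
    linear_combination h5 / 4
  · have := Rat.den_mul_eq_num q
    have h : ((q.den : ℚ) : ℝ) * q = ((q.num : ℚ) : ℝ) := by exact_mod_cast this
    simpa using h

theorem exists_quadUnit_of_root {a : ℝ}
    (h : ∃ p : Polynomial ℚ, p ≠ 0 ∧ p.degree ≤ 2 ∧ Polynomial.aeval a p = 0) :
    Nonempty (QuadUnit a) := by
  by_cases hirr : Irrational a
  swap
  · exact exists_quadUnit_of_rat hirr
  obtain ⟨p, hp0, hp2, hpa⟩ := h
  have hrat : ∀ q : ℚ, a ≠ q := fun q hq => hirr ⟨q, hq.symm⟩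
  rw [Polynomial.aeval_eq_sum_range' (n := 3)
    (Nat.lt_succ_of_le (Polynomial.natDegree_le_of_degree_le hp2))] at hpa
  simp only [Finset.sum_range_succ, Finset.sum_range_zero, Rat.smul_def, pow_zero, pow_one,
    mul_one, zero_add] at hpa
  obtain ⟨A, hA⟩ : ∃ A, A = p.coeff 2 := ⟨_, rfl⟩
  obtain ⟨B, hB⟩ : ∃ B, B = p.coeff 1 := ⟨_, rfl⟩
  obtain ⟨C, hC⟩ : ∃ C, C = p.coeff 0 := ⟨_, rfl⟩
  rw [← hA, ← hB, ← hC] at hpa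
  have hA0 : A ≠ 0 := by
    intro hA0
    rw [hA0] at hpa
    by_cases hB0 : B = 0
    · rw [hB0] at hpa
      have hC0 : C = 0 := by simpa using hpa
      refine hp0 (Polynomial.ext fun n => ?_)
      rw [Polynomial.coeff_zero]
      rcases n with _ | _ | _ | n
      · rw [← hC, hC0]
      · rw [← hB, hB0]
      · rw [← hA, hA0]
      · refine Polynomial.coeff_eq_zero_of_degree_lt (lt_of_le_of_lt hp2 ?_)
        have : ((2 : ℕ) : WithBot ℕ) < ((n + 1 + 1 + 1 : ℕ) : WithBot ℕ) := by
          rw [Nat.cast_lt]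
          omega
        exact this
    · have hB0' : (B : ℝ) ≠ 0 := by exact_mod_cast hB0
      refine hrat (-C / B) ?_
      push_cast
      rw [eq_div_iff hB0']
      simp at hpa
      linarith
  have hnum : ∀ q : ℚ, (q : ℝ) * q.den = q.num := fun q => by
    exact_mod_cast Rat.mul_den_eq_num q
  refine exists_quadUnit_of_int (A := A.num * B.den * C.den) (B := B.num * A.den * C.den)
    (C := C.num * A.den * B.den) (by simpa using hA0) ?_ hirr
  push_cast
  rw [← hnum, ← hnum, ← hnum]
  linear_combination (A.den : ℝ) * B.den * C.den * hpa

section ZeroWords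

open Filter Topology

namespace QuadUnit

variable {a : ℝ} (q : QuadUnit a)

/-- The element of `ℤ[β]` with the given coordinates. -/
noncomputable def ev (z : ℤ × ℤ) : ℝ := z.1 + z.2 * q.β

/-- The conjugate of the element of `ℤ[β]` with the given coordinates. -/
noncomputable def cj (z : ℤ × ℤ) : ℝ := z.1 + z.2 * q.β⁻¹

/-- Multiplication by `β` in coordinates. -/
def shift (z : ℤ × ℤ) : ℤ × ℤ := (-z.2, z.1 + q.t * z.2)

theorem β_pos : 0 < q.β := one_pos.trans q.one_lt

theorem inv_eq : q.β⁻¹ = q.t - q.β := by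
  refine inv_eq_of_mul_eq_one_right ?_
  linear_combination -q.sq_eq

theorem ev_add (z w : ℤ × ℤ) : q.ev (z + w) = q.ev z + q.ev w := by
  simp [ev]
  ring

theorem cj_add (z w : ℤ × ℤ) : q.cj (z + w) = q.cj z + q.cj w := by
  simp [cj]
  ring

theorem ev_shift (z : ℤ × ℤ) : q.ev (q.shift z) = q.β * q.ev z := by
  simp [ev, shift]
  linear_combination (-(z.2 : ℝ)) * q.sq_eq

theorem cj_shift (z : ℤ × ℤ) : q.cj (q.shift z) = q.β⁻¹ * q.cj z := by
  simp [cj, shift]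
  rw [inv_eq]
  linear_combination (-(z.2 : ℝ)) * q.sq_eq

theorem exists_coord_bound (C : ℝ) : ∃ K : ℕ, ∀ z : ℤ × ℤ, |q.ev z| ≤ C → |q.cj z| ≤ C →
    |z.1| ≤ K ∧ |z.2| ≤ K := by
  have hκ : 0 < q.β - q.β⁻¹ := sub_pos.2 ((inv_lt_one_of_one_lt₀ q.one_lt).trans q.one_lt)
  obtain ⟨B, hB⟩ : ∃ B, B = 2 * C / (q.β - q.β⁻¹) := ⟨_, rfl⟩
  obtain ⟨K, hK⟩ := exists_nat_ge (max B (C + B * q.β))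
  refine ⟨K, fun z h1 h2 => ?_⟩
  have h3 : |(z.2 : ℝ)| ≤ B := by
    rw [hB, le_div_iff₀ hκ]
    calc |(z.2 : ℝ)| * (q.β - q.β⁻¹) = |q.ev z - q.cj z| := by
          rw [show q.ev z - q.cj z = z.2 * (q.β - q.β⁻¹) by rw [ev, cj]; ring, abs_mul,
            abs_of_pos hκ]
      _ ≤ |q.ev z| + |q.cj z| := abs_sub _ _
      _ ≤ 2 * C := by linarith
  have h4 : |(z.1 : ℝ)| ≤ C + B * q.β := by
    have : (z.1 : ℝ) = q.ev z - z.2 * q.β := by rw [ev]; ring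
    calc |(z.1 : ℝ)| ≤ |q.ev z| + |z.2 * q.β| := this ▸ abs_sub _ _
      _ ≤ _ := by
        rw [abs_mul, abs_of_pos q.β_pos]
        exact add_le_add h1 (mul_le_mul_of_nonneg_right h3 q.β_pos.le)
  have h5 := h4.trans ((le_max_right _ _).trans hK)
  have h6 := h3.trans ((le_max_left _ _).trans hK)
  exact ⟨by exact_mod_cast h5, by exact_mod_cast h6⟩

/-- `s` and `y` witness the computation, by Horner's scheme, of the sum with coefficients `p` of the
nonnegative and `r` of the nonpositive powers of `β`. -/
structure Horner (p r s y : ℕ → ℤ × ℤ) : Prop where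
  s_eq : ∀ i, s i = p i + q.shift (s (i + 1))
  s_zero : ∀ᶠ i in atTop, s i = 0
  y_zero : y 0 = s 0 + r 0
  y_succ : ∀ i, y (i + 1) = q.shift (y i) + r (i + 1)

variable {q} {p r s y : ℕ → ℤ × ℤ} {S C : ℝ}

theorem Horner.tendsto (h : q.Horner p r s y) (hS : Tendsto (fun n => ∑ i ∈ Finset.range n,
    (q.ev (p i) * q.β ^ i + q.ev (r i) * q.β⁻¹ ^ i)) atTop (𝓝 S)) :
    Tendsto (fun n => q.ev (y n) * q.β⁻¹ ^ n) atTop (𝓝 S) := by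
  have hβ := mul_inv_cancel₀ q.β_pos.ne'
  have h1 : ∀ n, q.ev (s 0) = ∑ i ∈ Finset.range n, q.ev (p i) * q.β ^ i +
      q.ev (s n) * q.β ^ n := by
    intro n
    induction n with
    | zero => simp
    | succ n ih =>
      rw [ih, Finset.sum_range_succ, h.s_eq n, ev_add, ev_shift]
      ring
  have h2 : ∀ n, q.ev (y n) * q.β⁻¹ ^ n = q.ev (s 0) + ∑ i ∈ Finset.range (n + 1),
      q.ev (r i) * q.β⁻¹ ^ i := by
    intro n
    induction n with
    | zero => simp [h.y_zero, ev_add]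
    | succ n ih =>
      rw [Finset.sum_range_succ, ← add_assoc, ← ih, h.y_succ, ev_add, ev_shift]
      linear_combination (q.ev (y n) * q.β⁻¹ ^ n) * hβ
  refine ((tendsto_add_atTop_iff_nat 1).2 hS).congr' ?_
  filter_upwards [(tendsto_add_atTop_nat 1).eventually h.s_zero] with n hn
  rw [h2, h1 (n + 1), hn, Finset.sum_add_distrib]
  simp [ev]

theorem exists_horner (q : QuadUnit a) (r : ℕ → ℤ × ℤ) (hp : ∀ᶠ i in atTop, p i = 0) :
    ∃ s y, q.Horner p r s y := by
  have hs : ∃ s : ℕ → ℤ × ℤ, (∀ i, s i = p i + q.shift (s (i + 1))) ∧ ∀ᶠ i in atTop, s i = 0 := by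
    obtain ⟨M, hM⟩ := eventually_atTop.1 hp
    suffices ∀ (M : ℕ) (p : ℕ → ℤ × ℤ), (∀ i, M ≤ i → p i = 0) →
        ∃ s : ℕ → ℤ × ℤ, (∀ i, s i = p i + q.shift (s (i + 1))) ∧ ∀ i, M ≤ i → s i = 0 by
      obtain ⟨s, h1, h2⟩ := this M p hM
      exact ⟨s, h1, eventually_atTop.2 ⟨M, h2⟩⟩
    intro M
    induction M with
    | zero =>
      intro p hp
      exact ⟨fun _ => 0, fun i => by simp [hp, shift]; rfl, fun _ _ => rfl⟩
    | succ M ih =>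
      intro p hp
      obtain ⟨s, h1, h2⟩ := ih (fun i => p (i + 1)) fun i hi => hp _ (Nat.succ_le_succ hi)
      refine ⟨fun i => Nat.casesOn i (p 0 + q.shift (s 0)) s, fun i => ?_, fun i hi => ?_⟩
      · cases i with
        | zero => rfl
        | succ i => exact h1 i
      · cases i with
        | zero => omega
        | succ i => exact h2 i (Nat.le_of_succ_le_succ hi)
  obtain ⟨s, h1, h2⟩ := hs
  exact ⟨s, fun n => Nat.rec (s 0 + r 0) (fun i y => q.shift y + r (i + 1)) n, h1, h2, rfl,
    fun _ => rfl⟩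

theorem abs_le_of_tendsto_zero {β C : ℝ} (hβ : 1 < β) {Y b : ℕ → ℝ}
    (hY : ∀ i, Y (i + 1) = β * Y i + b i)
    (hb : ∀ i, |b i| ≤ C) (h0 : Tendsto (fun n => Y n * β⁻¹ ^ n) atTop (𝓝 0)) (i : ℕ) :
    |Y i| ≤ C / (β - 1) := by
  by_contra! hlt
  obtain ⟨c, hc⟩ : ∃ c, c = C / (β - 1) := ⟨_, rfl⟩
  rw [← hc] at hlt
  have hc' : β * c = c + C := by
    have : β - 1 ≠ 0 := by linarith
    rw [hc]
    field_simp
    ring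
  have hβ0 : 0 < β := by linarith
  have hc0 : 0 ≤ c := by
    rw [hc]
    exact div_nonneg ((abs_nonneg _).trans (hb 0)) (by linarith)
  have h1 : ∀ n, (|Y i| - c) * β ^ n ≤ |Y (i + n)| - c := by
    intro n
    induction n with
    | zero => simp
    | succ n ih =>
      have h2 : β * |Y (i + n)| ≤ |Y (i + (n + 1))| + C := by
        have h3 : β * Y (i + n) = Y (i + (n + 1)) - b (i + n) := by
          rw [← add_assoc, hY]
          ring
        calc β * |Y (i + n)| = |Y (i + (n + 1)) - b (i + n)| := by
              rw [← h3, abs_mul, abs_of_pos hβ0]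
          _ ≤ _ := (abs_sub _ _).trans (add_le_add le_rfl (hb _))
      have h4 := mul_le_mul_of_nonneg_left ih hβ0.le
      rw [pow_succ]
      linarith
  have h2 : ∀ n, (|Y i| - c) * β⁻¹ ^ i ≤ |Y (n + i) * β⁻¹ ^ (n + i)| := by
    intro n
    have hp : 0 < β⁻¹ ^ (n + i) := by positivity
    rw [abs_mul, abs_of_pos hp]
    calc (|Y i| - c) * β⁻¹ ^ i = (|Y i| - c) * β ^ n * β⁻¹ ^ (n + i) := by
          rw [pow_add, ← mul_assoc, mul_assoc _ (β ^ n), ← mul_pow,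
            mul_inv_cancel₀ hβ0.ne', one_pow,
            mul_one]
      _ ≤ _ := by
        refine mul_le_mul_of_nonneg_right ?_ hp.le
        rw [add_comm n i]
        linarith [h1 n]
  have h3 := ((tendsto_add_atTop_iff_nat i).2 h0).abs
  rw [abs_zero] at h3
  have h4 := ge_of_tendsto' h3 h2
  have h5 : 0 < (|Y i| - c) * β⁻¹ ^ i := mul_pos (by linarith) (by positivity)
  linarith

theorem Horner.bounded (h : q.Horner p r s y) (hpe : ∀ i, |q.ev (p i)| ≤ C)
    (hpc : ∀ i, |q.cj (p i)| ≤ C) (hre : ∀ i, |q.ev (r i)| ≤ C) (hrc : ∀ i, |q.cj (r i)| ≤ C)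
    (h0 : Tendsto (fun n => q.ev (y n) * q.β⁻¹ ^ n) atTop (𝓝 0)) (i : ℕ) :
    (|q.ev (s i)| ≤ C * q.β / (q.β - 1) + C ∧ |q.cj (s i)| ≤ C * q.β / (q.β - 1) + C) ∧
      |q.ev (y i)| ≤ C * q.β / (q.β - 1) + C ∧ |q.cj (y i)| ≤ C * q.β / (q.β - 1) + C := by
  have hβ1 := q.one_lt
  have hβ0 := q.β_pos
  have hC : 0 ≤ C := (abs_nonneg _).trans (hpe 0)
  obtain ⟨B, hB⟩ : ∃ B, B = C * q.β / (q.β - 1) := ⟨_, rfl⟩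
  have hne : q.β - 1 ≠ 0 := by linarith
  have hBC : C / (q.β - 1) = B - C := by
    rw [hB]
    field_simp
    ring
  have hBC' : B - C = q.β⁻¹ * B := by
    rw [hB]
    field_simp
    ring
  have hB0 : 0 ≤ B := by
    rw [hB]
    exact div_nonneg (mul_nonneg hC hβ0.le) (by linarith)
  have hinv1 : q.β⁻¹ < 1 := inv_lt_one_of_one_lt₀ hβ1
  have hinv0 : 0 < q.β⁻¹ := inv_pos.2 hβ0
  have hye : ∀ i, |q.ev (y i)| ≤ B - C := fun i => by
    rw [← hBC]
    exact abs_le_of_tendsto_zero hβ1 (Y := fun i => q.ev (y i)) (b := fun i => q.ev (r (i + 1)))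
      (fun i => by rw [h.y_succ, ev_add, ev_shift]) (fun i => hre _) h0 i
  have hse : ∀ i, |q.ev (s i)| ≤ B := by
    intro i
    induction i with
    | zero =>
      have : q.ev (s 0) = q.ev (y 0) - q.ev (r 0) := by
        rw [h.y_zero, ev_add]
        ring
      rw [this]
      linarith [abs_sub (q.ev (y 0)) (q.ev (r 0)), hye 0, hre 0]
    | succ i ih =>
      have : q.ev (s (i + 1)) = q.β⁻¹ * (q.ev (s i) - q.ev (p i)) := by
        rw [h.s_eq i, ev_add, ev_shift, add_sub_cancel_left, inv_mul_cancel_left₀ hβ0.ne']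
      rw [this, abs_mul, abs_of_pos hinv0]
      have h1 : |q.ev (s i) - q.ev (p i)| ≤ B + C :=
        (abs_sub _ _).trans (add_le_add ih (hpe i))
      have h2 := mul_le_mul_of_nonneg_left h1 hinv0.le
      have h3 : q.β⁻¹ * C ≤ C := mul_le_of_le_one_left hC hinv1.le
      linarith
  have hsc : ∀ i, |q.cj (s i)| ≤ B := by
    obtain ⟨M, hM⟩ := eventually_atTop.1 h.s_zero
    have h1 : ∀ n i, M ≤ i + n → |q.cj (s i)| ≤ B := by
      intro n
      induction n with
      | zero =>
        intro i hi
        rw [hM i hi]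
        simpa [cj] using hB0
      | succ n ih =>
        intro i hi
        have := mul_le_mul_of_nonneg_left (ih (i + 1) (by omega)) hinv0.le
        rw [h.s_eq i, cj_add, cj_shift]
        refine (abs_add_le _ _).trans ?_
        rw [abs_mul, abs_of_pos hinv0]
        linarith [hpc i]
    exact fun i => h1 M i (by omega)
  have hyc : ∀ i, |q.cj (y i)| ≤ B + C := by
    intro i
    induction i with
    | zero =>
      rw [h.y_zero, cj_add]
      exact (abs_add_le _ _).trans (add_le_add (hsc 0) (hrc 0))
    | succ i ih =>
      rw [h.y_succ, cj_add, cj_shift]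
      refine (abs_add_le _ _).trans ?_
      rw [abs_mul, abs_of_pos hinv0]
      have h2 := mul_le_mul_of_nonneg_left ih hinv0.le
      have h3 : q.β⁻¹ * C ≤ C := mul_le_of_le_one_left hC hinv1.le
      linarith [hrc (i + 1)]
  rw [← hB]
  exact ⟨⟨by linarith [hse i], by linarith [hsc i]⟩, by linarith [hye i], hyc i⟩

/-- Vanishing of a sum of powers of `β` is witnessed by bounded sequences. -/
theorem exists_eq_zero_iff (q : QuadUnit a) (C : ℝ) : ∃ K₀ : ℕ, ∀ K : ℕ, K₀ ≤ K →
    ∀ (p r : ℕ → ℤ × ℤ) (S : ℝ),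
    (∀ i, |q.ev (p i)| ≤ C) → (∀ i, |q.cj (p i)| ≤ C) → (∀ i, |q.ev (r i)| ≤ C) →
    (∀ i, |q.cj (r i)| ≤ C) → (∀ᶠ i in atTop, p i = 0) →
    Tendsto (fun n => ∑ i ∈ Finset.range n,
      (q.ev (p i) * q.β ^ i + q.ev (r i) * q.β⁻¹ ^ i)) atTop (𝓝 S) →
    (S = 0 ↔ ∃ s y, q.Horner p r s y ∧
      ∀ i, (|(s i).1| ≤ K ∧ |(s i).2| ≤ K) ∧ |(y i).1| ≤ K ∧ |(y i).2| ≤ K) := by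
  obtain ⟨K, hK⟩ := q.exists_coord_bound (C * q.β / (q.β - 1) + C)
  refine ⟨K, fun K' hK' p r S hpe hpc hre hrc hp hS => ⟨?_, ?_⟩⟩
  · rintro rfl
    obtain ⟨s, y, h⟩ := q.exists_horner r hp
    refine ⟨s, y, h, fun i => ?_⟩
    obtain ⟨h1, h2⟩ := h.bounded hpe hpc hre hrc (h.tendsto hS) i
    have hKK : (K : ℤ) ≤ K' := by exact_mod_cast hK'
    exact ⟨(hK _ h1.1 h1.2).imp hKK.trans' hKK.trans', (hK _ h2.1 h2.2).imp hKK.trans' hKK.trans'⟩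
  · rintro ⟨s, y, h, hsy⟩
    refine tendsto_nhds_unique (h.tendsto hS) ?_
    refine bdd_le_mul_tendsto_zero' (K' + K' * q.β) (Eventually.of_forall fun n => ?_)
      (tendsto_pow_atTop_nhds_zero_of_lt_one (inv_nonneg.2 q.β_pos.le)
        (inv_lt_one_of_one_lt₀ q.one_lt))
    obtain ⟨-, h1, h2⟩ := hsy n
    have h1' : |((y n).1 : ℝ)| ≤ K' := by exact_mod_cast h1
    have h2' : |((y n).2 : ℝ)| ≤ K' := by exact_mod_cast h2
    refine (abs_add_le _ _).trans (add_le_add h1' ?_)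
    rw [abs_mul, abs_of_pos q.β_pos]
    exact mul_le_mul_of_nonneg_right h2' q.β_pos.le

end QuadUnit

end ZeroWords

section Numeration

open Filter Topology

namespace QuadUnit

variable {a : ℝ} (q : QuadUnit a)

/-- The largest digit. -/
def T : ℕ := (q.t - 1).toNat

/-- The difference of the unit `β` and its inverse. -/
noncomputable def κ : ℝ := q.β - q.β⁻¹

/-- The integers whose multiples by `κ` are the differences `β ^ (n + 1) - β⁻¹ ^ (n + 1)`. -/
def W : ℕ → ℤ
  | 0 => 1
  | 1 => q.t
  | n + 2 => q.t * W (n + 1) - W n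

theorem inv_pos : 0 < q.β⁻¹ := _root_.inv_pos.2 q.β_pos

theorem inv_lt_one : q.β⁻¹ < 1 := inv_lt_one_of_one_lt₀ q.one_lt

theorem κ_pos : 0 < q.κ := sub_pos.2 (q.inv_lt_one.trans q.one_lt)

theorem κ_lt : q.κ < q.β := sub_lt_self _ q.inv_pos

theorem β_lt : q.β < q.t := by
  have := q.inv_eq
  linarith [q.inv_pos]

theorem two_le_t : 2 ≤ q.t := by
  have : (1 : ℝ) < q.t := q.one_lt.trans q.β_lt
  have : (1 : ℤ) < q.t := by exact_mod_cast this
  omega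

theorem coe_T : (q.T : ℤ) = q.t - 1 := by
  have := q.two_le_t
  rw [T]
  omega

theorem κ_mul_W (n : ℕ) : q.κ * q.W n = q.β ^ (n + 1) - q.β⁻¹ ^ (n + 1) := by
  have hβ := mul_inv_cancel₀ q.β_pos.ne'
  have ht : (q.t : ℝ) = q.β + q.β⁻¹ := by
    rw [inv_eq]
    ring
  induction n using Nat.twoStepInduction with
  | zero => simp [W, κ]
  | one =>
    simp only [W, κ, ht]
    ring
  | more n h1 h2 =>
    rw [W]
    push_cast
    rw [mul_sub, mul_left_comm, h1, h2, ht]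
    linear_combination (q.β ^ (n + 1) - q.β⁻¹ ^ (n + 1)) * hβ

theorem W_pos_lt (n : ℕ) : 0 < q.W n ∧ q.W n < q.W (n + 1) := by
  have ht := q.two_le_t
  induction n with
  | zero =>
    simp only [W]
    omega
  | succ n ih =>
    refine ⟨ih.1.trans ih.2, ?_⟩
    rw [W]
    linarith [mul_le_mul_of_nonneg_right ht (ih.1.trans ih.2).le, ih.2]

/-- The real number `x` is the sum of the integer with digits `u` and the number whose product with
`κ` has fractional digits `v`. -/
def Expands (u v : ℕ → ℤ) (x : ℝ) : Prop :=
  (∀ᶠ i in atTop, u i = 0) ∧ Tendsto (fun n => ∑ i ∈ Finset.range n,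
    (u i * (q.β ^ (i + 1) - q.β⁻¹ ^ (i + 1)) + v i * q.β⁻¹ ^ i)) atTop (𝓝 (q.κ * x))

variable {q} {u v : ℕ → ℤ} {x y : ℝ}

theorem Expands.unique (h : q.Expands u v x) (h' : q.Expands u v y) : x = y :=
  mul_left_cancel₀ q.κ_pos.ne' (tendsto_nhds_unique h.2 h'.2)

theorem Expands.nonneg (h : q.Expands u v x) (hu : ∀ i, 0 ≤ u i) (hv : ∀ i, 0 ≤ v i) : 0 ≤ x := by
  refine nonneg_of_mul_nonneg_right (ge_of_tendsto' h.2 fun n => Finset.sum_nonneg fun i _ => ?_)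
    q.κ_pos
  rw [← κ_mul_W]
  have h1 : (0 : ℝ) ≤ u i := by exact_mod_cast hu i
  have h2 : (0 : ℝ) ≤ v i := by exact_mod_cast hv i
  have h3 : (0 : ℝ) ≤ q.W i := by exact_mod_cast (q.W_pos_lt i).1.le
  have := q.κ_pos
  have := q.inv_pos
  positivity

theorem tendsto_integerPart (q : QuadUnit a) (hu : ∀ᶠ i in atTop, u i = 0) : ∃ z : ℤ,
    Tendsto (fun n => ∑ i ∈ Finset.range n, (u i * (q.β ^ (i + 1) - q.β⁻¹ ^ (i + 1)))) atTop
      (𝓝 (q.κ * z)) := by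
  obtain ⟨M, hM⟩ := eventually_atTop.1 hu
  refine ⟨∑ i ∈ Finset.range M, u i * q.W i, tendsto_const_nhds.congr' ?_⟩
  filter_upwards [eventually_ge_atTop M] with n hn
  rw [← Finset.sum_subset (Finset.range_mono hn)]
  · push_cast
    rw [Finset.mul_sum]
    refine Finset.sum_congr rfl fun i _ => ?_
    rw [← κ_mul_W]
    ring
  · intro i _ hi
    rw [hM i (not_lt.1 fun h => hi (Finset.mem_range.2 h))]
    simp

theorem Expands.exists_int (h : q.Expands u (fun _ => 0) x) : ∃ z : ℤ, x = z := by
  obtain ⟨z, hz⟩ := q.tendsto_integerPart h.1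
  refine ⟨z, h.unique ⟨h.1, ?_⟩⟩
  simpa using hz

theorem exists_expands (q : QuadUnit a) {T : ℕ} (hu : ∀ᶠ i in atTop, u i = 0)
    (hv : ∀ i, |v i| ≤ T) : ∃ x, q.Expands u v x := by
  obtain ⟨z, hz⟩ := q.tendsto_integerPart hu
  have hs : Summable fun i => (v i : ℝ) * q.β⁻¹ ^ i := by
    refine Summable.of_norm_bounded (g := fun i => (T : ℝ) * q.β⁻¹ ^ i)
      ((summable_geometric_of_lt_one q.inv_pos.le q.inv_lt_one).mul_left _) fun i => ?_
    rw [Real.norm_eq_abs, abs_mul, abs_of_pos (pow_pos q.inv_pos i)]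
    refine mul_le_mul_of_nonneg_right ?_ (pow_pos q.inv_pos i).le
    exact_mod_cast hv i
  refine ⟨z + (∑' i, (v i : ℝ) * q.β⁻¹ ^ i) / q.κ, hu, ?_⟩
  simp only [Finset.sum_add_distrib]
  rw [mul_add, mul_div_cancel₀ _ q.κ_pos.ne']
  exact hz.add hs.hasSum.tendsto_sum_nat

theorem exists_integer_digits (q : QuadUnit a) (m : ℕ) (n : ℤ) (h0 : 0 ≤ n) (hn : n < q.W m) :
    ∃ u : ℕ → ℤ, (∀ i, 0 ≤ u i ∧ u i ≤ q.T) ∧ (∀ i, m ≤ i → u i = 0) ∧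
      ∑ i ∈ Finset.range m, u i * q.W i = n := by
  induction m generalizing n with
  | zero =>
    refine ⟨fun _ => 0, fun _ => by simp, fun _ _ => rfl, ?_⟩
    simp only [W] at hn
    simp
    omega
  | succ m ih =>
    have hW := (q.W_pos_lt m).1
    obtain ⟨u, h1, h2, h3⟩ := ih (n % q.W m) (Int.emod_nonneg _ hW.ne') (Int.emod_lt_of_pos _ hW)
    refine ⟨Function.update u m (n / q.W m), fun i => ?_, fun i hi => ?_, ?_⟩
    · by_cases hi : i = m
      · subst hi
        rw [Function.update_self, coe_T]
        refine ⟨Int.ediv_nonneg h0 hW.le, Int.le_sub_one_of_lt (Int.ediv_lt_of_lt_mul hW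
          (hn.trans_le ?_))⟩
        cases i with
        | zero => simp [W]
        | succ i =>
          rw [W]
          linarith [(q.W_pos_lt i).1]
      · rw [Function.update_of_ne hi]
        exact h1 i
    · rw [Function.update_of_ne (by omega)]
      exact h2 i (by omega)
    · rw [Finset.sum_range_succ, Function.update_self, Finset.sum_congr rfl
        (g := fun i => u i * q.W i)
        fun i hi => by rw [Function.update_of_ne (Finset.mem_range.1 hi).ne], h3]
      exact Int.emod_add_ediv_mul n (q.W m)

theorem le_W (q : QuadUnit a) (n : ℕ) : (n : ℤ) < q.W n := by
  induction n with
  | zero => simp [W]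
  | succ n ih =>
    have := (q.W_pos_lt n).2
    push_cast
    omega

theorem exists_integer_expansion (q : QuadUnit a) (z : ℤ) : ∃ u : ℕ → ℤ,
    (∀ i, |u i| ≤ q.T) ∧ (0 ≤ z → ∀ i, 0 ≤ u i) ∧ (∀ᶠ i in atTop, u i = 0) ∧
    Tendsto (fun n => ∑ i ∈ Finset.range n, (u i * (q.β ^ (i + 1) - q.β⁻¹ ^ (i + 1)))) atTop
      (𝓝 (q.κ * z)) := by
  obtain ⟨u, h1, h2, h3⟩ := q.exists_integer_digits z.natAbs z.natAbs (by omega) (q.le_W _)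
  have h4 : ∀ n, z.natAbs ≤ n → ∑ i ∈ Finset.range n, u i * (q.β ^ (i + 1) - q.β⁻¹ ^ (i + 1)) =
      q.κ * z.natAbs := fun n hn => by
    rw [← Finset.sum_subset (Finset.range_mono hn)]
    · have h5 : (∑ i ∈ Finset.range z.natAbs, (u i : ℝ) * q.W i) = z.natAbs := by
        rw [← Int.cast_natCast z.natAbs, ← h3]
        push_cast
        rfl
      rw [← h5, Finset.mul_sum]
      refine Finset.sum_congr rfl fun i _ => ?_
      rw [← κ_mul_W]
      ring
    · intro i _ hi
      rw [h2 i (not_lt.1 fun h => hi (Finset.mem_range.2 h))]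
      simp
  rcases le_or_gt 0 z with hz | hz
  · refine ⟨u, fun i => abs_le.2 ⟨by linarith [h1 i], (h1 i).2⟩, fun _ i => (h1 i).1,
      eventually_atTop.2 ⟨_, h2⟩, tendsto_const_nhds.congr' ?_⟩
    filter_upwards [eventually_ge_atTop z.natAbs] with n hn
    rw [h4 n hn, Nat.cast_natAbs, abs_of_nonneg hz]
  · refine ⟨fun i => - u i, fun i => abs_le.2 ⟨by linarith [h1 i], by linarith [h1 i]⟩,
      fun h => absurd h (not_le.2 hz), (eventually_atTop.2 ⟨_, h2⟩).mono fun i hi => by simp [hi],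
      tendsto_const_nhds.congr' ?_⟩
    filter_upwards [eventually_ge_atTop z.natAbs] with n hn
    have h5 := h4 n hn
    rw [Nat.cast_natAbs, abs_of_neg hz] at h5
    push_cast at h5 ⊢
    simp only [neg_mul, Finset.sum_neg_distrib]
    linarith

theorem exists_fractional_expansion (q : QuadUnit a) (y : ℝ) (h0 : 0 ≤ y) (hy : y < q.β) :
    ∃ v : ℕ → ℤ, (∀ i, 0 ≤ v i ∧ v i ≤ q.T) ∧ (y = 0 → ∀ i, v i = 0) ∧
      Tendsto (fun n => ∑ i ∈ Finset.range n, v i * q.β⁻¹ ^ i) atTop (𝓝 y) := by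
  obtain ⟨Y, hY0, hY⟩ : ∃ Y : ℕ → ℝ, Y 0 = y ∧ ∀ i, Y (i + 1) = q.β * Int.fract (Y i) :=
    ⟨fun n => Nat.rec y (fun _ r => q.β * Int.fract r) n, rfl, fun _ => rfl⟩
  have hβ := mul_inv_cancel₀ q.β_pos.ne'
  have hYr : ∀ i, 0 ≤ Y i ∧ Y i < q.β := fun i => by
    cases i with
    | zero => exact hY0 ▸ ⟨h0, hy⟩
    | succ i =>
      rw [hY]
      exact ⟨mul_nonneg q.β_pos.le (Int.fract_nonneg _),
        mul_lt_of_lt_one_right q.β_pos (Int.fract_lt_one _)⟩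
  have hsum : ∀ n, ∑ i ∈ Finset.range n, (⌊Y i⌋ : ℝ) * q.β⁻¹ ^ i = y - Y n * q.β⁻¹ ^ n := by
    intro n
    induction n with
    | zero => simp [hY0]
    | succ n ih =>
      rw [Finset.sum_range_succ, ih, hY, ← Int.self_sub_fract (Y n)]
      simp only [Int.self_sub_fract]
      rw [Int.fract]
      linear_combination ((Y n - ⌊Y n⌋) * q.β⁻¹ ^ n) * hβ
  refine ⟨fun i => ⌊Y i⌋, fun i => ⟨Int.floor_nonneg.2 (hYr i).1, ?_⟩, fun hy0 i => ?_, ?_⟩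
  · rw [coe_T]
    exact Int.le_sub_one_of_lt (Int.floor_lt.2 ((hYr i).2.trans q.β_lt))
  · have : ∀ i, Y i = 0 := fun i => by
      induction i with
      | zero => rw [hY0, hy0]
      | succ i ih => rw [hY, ih, Int.fract_zero, mul_zero]
    simp [this]
  · simp only [hsum]
    have h1 : Tendsto (fun n => Y n * q.β⁻¹ ^ n) atTop (𝓝 0) :=
      bdd_le_mul_tendsto_zero' q.β (Eventually.of_forall fun n => by
        rw [abs_of_nonneg (hYr n).1]
        exact (hYr n).2.le) (tendsto_pow_atTop_nhds_zero_of_lt_one q.inv_pos.le q.inv_lt_one)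
    simpa using h1.const_sub y

theorem exists_expansion (q : QuadUnit a) (x : ℝ) : ∃ u v : ℕ → ℤ,
    (∀ i, |u i| ≤ q.T) ∧ (∀ i, |v i| ≤ q.T) ∧ q.Expands u v x ∧
      (0 ≤ x → (∀ i, 0 ≤ u i) ∧ ∀ i, 0 ≤ v i) ∧ ((∃ z : ℤ, x = z) → ∀ i, v i = 0) := by
  obtain ⟨u, h1, h2, h3, h4⟩ := q.exists_integer_expansion ⌊x⌋
  have hf : q.κ * Int.fract x < q.β :=
    (mul_lt_of_lt_one_right q.κ_pos (Int.fract_lt_one _)).trans q.κ_lt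
  obtain ⟨v, h5, h6, h7⟩ := q.exists_fractional_expansion (q.κ * Int.fract x)
    (mul_nonneg q.κ_pos.le (Int.fract_nonneg x)) hf
  refine ⟨u, v, h1, fun i => abs_le.2 ⟨by linarith [h5 i], (h5 i).2⟩, ⟨h3, ?_⟩,
    fun hx => ⟨h2 (Int.floor_nonneg.2 hx), fun i => (h5 i).1⟩, ?_⟩
  · simp only [Finset.sum_add_distrib]
    have := h4.add h7
    rwa [← mul_add, Int.floor_add_fract] at this
  · rintro ⟨z, rfl⟩
    exact h6 (by simp)

/-- Division by `β` in coordinates. -/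
def unshift (q : QuadUnit a) (z : ℤ × ℤ) : ℤ × ℤ := (z.2 + q.t * z.1, -z.1)

theorem ev_unshift (q : QuadUnit a) (z : ℤ × ℤ) : q.ev (q.unshift z) = q.β⁻¹ * q.ev z := by
  have hβ := mul_inv_cancel₀ q.β_pos.ne'
  have := q.inv_eq
  simp [ev, unshift]
  linear_combination (-(z.1 : ℝ)) * this - z.2 * hβ

theorem ev_smul (q : QuadUnit a) (n : ℤ) (z : ℤ × ℤ) : q.ev (n • z) = n * q.ev z := by
  simp [ev]
  ring

/-- The coefficient of a nonnegative power of `β` in a linear combination of expansions. -/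
def highCoeff (q : QuadUnit a) (c : Fin 3 → ℤ × ℤ) (u : Fin 3 → ℤ) : ℤ × ℤ :=
  u 0 • q.shift (c 0) + u 1 • q.shift (c 1) + u 2 • q.shift (c 2)

/-- The coefficient of a nonpositive power of `β` in a linear combination of expansions. -/
def lowCoeff (q : QuadUnit a) (c : Fin 3 → ℤ × ℤ) (u v : Fin 3 → ℤ) : ℤ × ℤ :=
  v 0 • c 0 + v 1 • c 1 + v 2 • c 2 + (- u 0) • q.unshift (c 0) + (- u 1) • q.unshift (c 1) +
    (- u 2) • q.unshift (c 2)

theorem exists_coeff_bound (q : QuadUnit a) (c : Fin 3 → ℤ × ℤ) : ∃ C : ℝ, ∀ u v : Fin 3 → ℤ,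
    (∀ j, |u j| ≤ q.T) → (∀ j, |v j| ≤ q.T) →
    (|q.ev (q.highCoeff c u)| ≤ C ∧ |q.cj (q.highCoeff c u)| ≤ C) ∧
      |q.ev (q.lowCoeff c u v)| ≤ C ∧ |q.cj (q.lowCoeff c u v)| ≤ C := by
  have hfin : {w : Fin 3 → ℤ | ∀ j, w j ∈ Set.Icc (-(q.T : ℤ)) q.T}.Finite :=
    Set.Finite.pi' fun _ => Set.finite_Icc _ _
  obtain ⟨C, hC⟩ := ((hfin.prod hfin).image fun w => |q.ev (q.highCoeff c w.1)| +
    |q.cj (q.highCoeff c w.1)| + |q.ev (q.lowCoeff c w.1 w.2)| +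
      |q.cj (q.lowCoeff c w.1 w.2)|).bddAbove
  refine ⟨C, fun u v hu hv => ?_⟩
  have := hC ⟨(u, v), ⟨fun j => abs_le.1 (hu j), fun j => abs_le.1 (hv j)⟩, rfl⟩
  beta_reduce at this
  have h1 := abs_nonneg (q.ev (q.highCoeff c u))
  have h2 := abs_nonneg (q.cj (q.highCoeff c u))
  have h3 := abs_nonneg (q.ev (q.lowCoeff c u v))
  have h4 := abs_nonneg (q.cj (q.lowCoeff c u v))
  exact ⟨⟨by linarith, by linarith⟩, by linarith, by linarith⟩

/-- Vanishing of a linear combination of expanded numbers is witnessed by bounded sequences. -/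
theorem exists_linear_eq_zero_iff (q : QuadUnit a) (c : Fin 3 → ℤ × ℤ) : ∃ K₀ : ℕ, ∀ K : ℕ, K₀ ≤ K →
    ∀ (u v : ℕ → Fin 3 → ℤ) (x : Fin 3 → ℝ), (∀ i j, |u i j| ≤ q.T) → (∀ i j, |v i j| ≤ q.T) →
    (∀ j, q.Expands (fun i => u i j) (fun i => v i j) (x j)) →
    (q.ev (c 0) * x 0 + q.ev (c 1) * x 1 + q.ev (c 2) * x 2 = 0 ↔ ∃ s y,
      q.Horner (fun i => q.highCoeff c (u i)) (fun i => q.lowCoeff c (u i) (v i)) s y ∧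
      ∀ i, (|(s i).1| ≤ K ∧ |(s i).2| ≤ K) ∧ |(y i).1| ≤ K ∧ |(y i).2| ≤ K) := by
  obtain ⟨C, hC⟩ := q.exists_coeff_bound c
  obtain ⟨K₀, hK₀⟩ := q.exists_eq_zero_iff C
  refine ⟨K₀, fun K hK u v x hu hv h => ?_⟩
  rw [← hK₀ K hK (fun i => q.highCoeff c (u i)) (fun i => q.lowCoeff c (u i) (v i))
    (q.κ * (q.ev (c 0) * x 0 + q.ev (c 1) * x 1 + q.ev (c 2) * x 2))
    (fun i => (hC _ _ (hu i) (hv i)).1.1) (fun i => (hC _ _ (hu i) (hv i)).1.2)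
    (fun i => (hC _ _ (hu i) (hv i)).2.1) (fun i => (hC _ _ (hu i) (hv i)).2.2) ?_ ?_]
  · rw [mul_eq_zero, or_iff_right q.κ_pos.ne']
  · filter_upwards [(h 0).1, (h 1).1, (h 2).1] with i h0 h1 h2
    rw [highCoeff, h0, h1, h2]
    simp
  · have h3 := (((h 0).2.const_mul (q.ev (c 0))).add ((h 1).2.const_mul (q.ev (c 1)))).add
      ((h 2).2.const_mul (q.ev (c 2)))
    convert h3 using 1
    · funext n
      simp only [Finset.mul_sum, ← Finset.sum_add_distrib]
      refine Finset.sum_congr rfl fun i _ => ?_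
      simp only [highCoeff, lowCoeff, ev_add, ev_smul, ev_shift, ev_unshift]
      push_cast
      ring
    · congr 1
      ring

end QuadUnit

end Numeration

section Ramsey

open Filter

theorem exists_eventually_eq_of_lt {N : ℕ} {u : ℕ → ℕ} (hu : ∀ᶠ i in hyperfilter ℕ, u i < N) :
    ∃ f, ∀ᶠ i in (hyperfilter ℕ : Filter ℕ), u i = f := by
  have := (Ultrafilter.eventually_exists_mem_iff (f := hyperfilter ℕ) (is := Set.Iio N)
    (P := fun f i => u i = f) (Set.finite_Iio N)).1 (hu.mono fun i hi => ⟨u i, hi, rfl⟩)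
  obtain ⟨f, -, hf⟩ := this
  exact ⟨f, hf⟩

/-- The infinite Ramsey theorem for pairs. -/
theorem exists_homogeneous {N : ℕ} {c : ℕ → ℕ → ℕ} (hc : ∀ i j, i < j → c i j < N) :
    ∃ (n : ℕ → ℕ) (f : ℕ), StrictMono n ∧ ∀ i j, i < j → c (n i) (n j) = f := by
  have hgt : ∀ i, ∀ᶠ j in (hyperfilter ℕ : Filter ℕ), i < j := fun i =>
    (Nat.hyperfilter_le_atTop) (eventually_gt_atTop i)
  choose g hg using fun i => exists_eventually_eq_of_lt ((hgt i).mono fun j => hc i j)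
  have hgN : ∀ i, g i < N := fun i => by
    obtain ⟨j, h1, h2⟩ := ((hg i).and (hgt i)).exists
    exact h1 ▸ hc i j h2
  obtain ⟨f, hf⟩ := exists_eventually_eq_of_lt (Eventually.of_forall hgN)
  obtain ⟨n, hn, hn'⟩ := exists_seq_of_forall_finset_exists (fun i => g i = f)
    (fun i j => i < j ∧ c i j = f) (fun s hs => by
      have : ∀ᶠ j in (hyperfilter ℕ : Filter ℕ), ∀ x ∈ s, x < j ∧ c x j = f :=
        (eventually_all_finset s).2 fun x hx => by
          filter_upwards [hgt x, hg x] with j h1 h2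
          exact ⟨h1, h2.trans (hs x hx)⟩
      exact (hf.and this).exists)
  exact ⟨n, f, strictMono_nat_of_lt_succ fun i => (hn' i _ i.lt_succ_self).1,
    fun i j h => (hn' i j h).2⟩

theorem exists_strictMono_eq {N : ℕ} {u : ℕ → ℕ} (hu : ∀ i, u i < N) :
    ∃ (n : ℕ → ℕ) (f : ℕ), StrictMono n ∧ ∀ i, u (n i) = f := by
  obtain ⟨n, f, hn, h⟩ := exists_homogeneous (N := N) (c := fun i _ => u i) fun i _ _ => hu i
  exact ⟨n, f, hn, fun i => h i _ i.lt_succ_self⟩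

end Ramsey

section Recognizers

variable {D : ℕ}

/-- The letter read at time `τ` by an automaton reading the first `k` words of `e`. -/
def letter (e : ℕ → ℕ → Fin D) : ℕ → ℕ → ℕ
  | 0, _ => 0
  | k + 1, τ => letter e k τ + e k τ * D ^ k

theorem letter_lt (e : ℕ → ℕ → Fin D) (k τ : ℕ) : letter e k τ < D ^ k := by
  induction k with
  | zero => simp [letter]
  | succ k ih =>
    rw [letter, pow_succ]
    nlinarith [(e k τ).isLt, Nat.zero_le (D ^ k)]

theorem letter_congr {e e' : ℕ → ℕ → Fin D} {k τ : ℕ} (h : ∀ i < k, e i τ = e' i τ) :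
    letter e k τ = letter e' k τ := by
  induction k with
  | zero => rfl
  | succ k ih =>
    rw [letter, letter, ih fun i hi => h i (hi.trans k.lt_succ_self), h k k.lt_succ_self]

theorem letter_div_mod (e : ℕ → ℕ → Fin D) {k i : ℕ} (τ : ℕ) (hi : i < k) :
    letter e k τ / D ^ i % D = e i τ := by
  have hD : 0 < D := (e 0 0).pos
  induction k with
  | zero => omega
  | succ k ih =>
    rw [letter]
    rcases (Nat.lt_succ_iff.1 hi).lt_or_eq with h | rfl
    · obtain ⟨j, rfl⟩ := Nat.exists_eq_add_of_lt h
      rw [show (e (i + j + 1) τ : ℕ) * D ^ (i + j + 1) = D ^ i * (D * (D ^ j * e (i + j + 1) τ)) by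
        ring, Nat.add_mul_div_left _ _ (pow_pos hD i), Nat.add_mul_mod_self_left, ih h]
    · rw [Nat.add_mul_div_right _ _ (pow_pos hD i), Nat.div_eq_of_lt (letter_lt e i τ), zero_add,
        Nat.mod_eq_of_lt (e i τ).isLt]

/-- A finite multiplication `m` on `{0, …, N - 1}`, an assignment `h` of elements to letters and a
set `p` of linked pairs recognize a property `Q` of tuples of infinite words that depends on the
first `k` words. -/
def Recognizes (N : ℕ) (h : ℕ → ℕ) (m : ℕ → ℕ → ℕ) (p : ℕ → ℕ → Bool) (k : ℕ)
    (Q : (ℕ → ℕ → Fin D) → Prop) : Prop :=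
  ∃ μ : (ℕ → ℕ → Fin D) → ℕ → ℕ → ℕ,
    (∀ e i j, i < j → μ e i j < N) ∧
    (∀ e i, μ e i (i + 1) = h (letter e k i)) ∧
    (∀ e i j l, i < j → j < l → μ e i l = m (μ e i j) (μ e j l)) ∧
    ∀ e n s f, StrictMono n → 0 < n 0 → (∀ i, μ e 0 (n i) = s) →
      (∀ i j, i < j → μ e (n i) (n j) = f) → (Q e ↔ p s f = true)

variable {N : ℕ} {h : ℕ → ℕ} {m : ℕ → ℕ → ℕ} {p : ℕ → ℕ → Bool} {k : ℕ}
  {Q : (ℕ → ℕ → Fin D) → Prop}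

theorem Recognizes.congr {h' : ℕ → ℕ} {m' : ℕ → ℕ → ℕ} {p' : ℕ → ℕ → Bool}
    {Q' : (ℕ → ℕ → Fin D) → Prop}
    (H : Recognizes N h m p k Q) (hh : ∀ x < D ^ k, h x = h' x)
    (hm : ∀ x < N, ∀ y < N, m x y = m' x y) (hp : ∀ x < N, ∀ y < N, p x y = p' x y)
    (hQ : ∀ e, Q e ↔ Q' e) : Recognizes N h' m' p' k Q' := by
  obtain ⟨μ, h1, h2, h3, h4⟩ := H
  refine ⟨μ, h1, fun e i => ?_, fun e i j l hij hjl => ?_, fun e n s f hn hn0 hs hf => ?_⟩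
  · rw [h2, hh _ (letter_lt e k i)]
  · rw [h3 e i j l hij hjl, hm _ (h1 e i j hij) _ (h1 e j l hjl)]
  · rw [← hQ, h4 e n s f hn hn0 hs hf, hp]
    · exact hs 0 ▸ h1 e _ _ hn0
    · exact hf 0 1 Nat.one_pos ▸ h1 e _ _ (hn Nat.one_pos)

theorem Recognizes.imp {N' : ℕ} {h' : ℕ → ℕ} {m' : ℕ → ℕ → ℕ} {p' : ℕ → ℕ → Bool}
    {Q' : (ℕ → ℕ → Fin D) → Prop}
    (H : Recognizes N h m p k Q) (H' : Recognizes N' h' m' p' k Q') :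
    Recognizes (N * N') (fun x => h x * N' + h' x)
      (fun x y => m (x / N') (y / N') * N' + m' (x % N') (y % N'))
      (fun x y => !(p (x / N') (y / N')) || p' (x % N') (y % N')) k fun e => Q e → Q' e := by
  obtain ⟨μ, h1, h2, h3, h4⟩ := H
  obtain ⟨μ', h1', h2', h3', h4'⟩ := H'
  have hd : ∀ e i j, i < j → (μ e i j * N' + μ' e i j) / N' = μ e i j := fun e i j hij => by
    have := h1' e i j hij
    rw [mul_comm, Nat.mul_add_div (by omega), Nat.div_eq_of_lt this, add_zero]
  have hm : ∀ e i j, i < j → (μ e i j * N' + μ' e i j) % N' = μ' e i j := fun e i j hij => by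
    rw [mul_comm, Nat.mul_add_mod, Nat.mod_eq_of_lt (h1' e i j hij)]
  refine ⟨fun e i j => μ e i j * N' + μ' e i j, fun e i j hij => ?_, fun e i => ?_,
    fun e i j l hij hjl => ?_, fun e n s f hn hn0 hs hf => ?_⟩
  · nlinarith [h1 e i j hij, h1' e i j hij]
  · beta_reduce
    rw [h2, h2']
  · beta_reduce
    rw [hd e _ _ hij, hd e _ _ hjl, hm e _ _ hij, hm e _ _ hjl, h3 e i j l hij hjl,
      h3' e i j l hij hjl]
  · have hpos : ∀ i, 0 < n i := fun i => hn0.trans_le (hn.monotone i.zero_le)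
    beta_reduce at hs hf ⊢
    rw [h4 e n (s / N') (f / N') hn hn0 (fun i => by rw [← hs i, hd e _ _ (hpos i)])
      fun i j hij => by rw [← hf i j hij, hd e _ _ (hn hij)],
      h4' e n (s % N') (f % N') hn hn0 (fun i => by rw [← hs i, hm e _ _ (hpos i)])
      fun i j hij => by rw [← hf i j hij, hm e _ _ (hn hij)] ]
    cases p (s / N') (f / N') <;> simp

/-- The index obtained by reading the letter of the variables listed in `l`. -/
def renameLetter (D : ℕ) : List ℕ → ℕ → ℕ
  | [], _ => 0
  | i :: l, x => x / D ^ i % D + D * renameLetter D l x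

theorem letter_succ' (e : ℕ → ℕ → Fin D) (k τ : ℕ) :
    letter e (k + 1) τ = e 0 τ + D * letter (fun i => e (i + 1)) k τ := by
  induction k with
  | zero => simp [letter]
  | succ k ih =>
    rw [letter, ih]
    simp only [letter]
    ring

theorem renameLetter_letter (e : ℕ → ℕ → Fin D) {k : ℕ} (τ : ℕ) {l : List ℕ} (hl : ∀ i ∈ l, i < k) :
    renameLetter D l (letter e k τ) = letter (fun i => e (l.getD i 0)) l.length τ := by
  induction l with
  | nil => rfl
  | cons i l ih =>
    rw [renameLetter, List.length_cons, letter_succ', letter_div_mod e τ (hl i List.mem_cons_self),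
      ih fun j hj => hl j (List.mem_cons_of_mem _ hj)]
    rfl

theorem Recognizes.rename {l : List ℕ} (H : Recognizes N h m p l.length Q) {k : ℕ}
    (hl : ∀ i ∈ l, i < k) :
    Recognizes N (fun x => h (renameLetter D l x)) m p k fun e => Q fun i => e (l.getD i 0) := by
  obtain ⟨μ, h1, h2, h3, h4⟩ := H
  refine ⟨fun e => μ fun i => e (l.getD i 0), fun e => h1 _, fun e i => ?_, fun e => h3 _,
    fun e => h4 _⟩
  beta_reduce
  rw [h2, renameLetter_letter e i hl]

theorem recognizes_false (k : ℕ) :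
    Recognizes 1 (fun _ => 0) (fun _ _ => 0) (fun _ _ => false) k
      fun _ : ℕ → ℕ → Fin D => False :=
  ⟨fun _ _ _ => 0, fun _ _ _ _ => Nat.one_pos, fun _ _ => rfl, fun _ _ _ _ _ _ => rfl,
    fun _ _ _ _ _ _ _ _ => by simp⟩

/-- The number with the given binary digits, lowest first. -/
def ofBits (l : List Bool) : ℕ := l.foldr (fun b n => 2 * n + b.toNat) 0

theorem testBit_ofBits (l : List Bool) (i : ℕ) : (ofBits l).testBit i = l.getD i false := by
  induction l generalizing i with
  | nil => simp [ofBits]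
  | cons b l ih =>
    have h : ofBits (b :: l) = Nat.bit b (ofBits l) := by cases b <;> rfl
    rw [h]
    cases i with
    | zero => simp
    | succ i => rw [Nat.testBit_bit_succ, ih, List.getD_cons_succ]

theorem ofBits_lt (l : List Bool) : ofBits l < 2 ^ l.length := by
  induction l with
  | nil => simp [ofBits]
  | cons b l ih =>
    have h : ofBits (b :: l) = 2 * ofBits l + b.toNat := rfl
    rw [h, List.length_cons, pow_succ]
    have := b.toNat_le
    omega

/-- The bit mask of the set of `c < N` with `q c`. -/
def mask (N : ℕ) (q : ℕ → Bool) : ℕ := ofBits ((List.range N).map q)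

theorem mask_lt (N : ℕ) (q : ℕ → Bool) : mask N q < 2 ^ N := by
  simpa [mask] using ofBits_lt ((List.range N).map q)

theorem testBit_mask {N : ℕ} (q : ℕ → Bool) (c : ℕ) :
    (mask N q).testBit c = true ↔ c < N ∧ q c = true := by
  rw [mask, testBit_ofBits]
  by_cases hc : c < N
  · simp [List.getD_eq_getElem?_getD, hc]
  · simp [List.getD_eq_getElem?_getD, hc]

theorem mask_congr {N : ℕ} {q q' : ℕ → Bool} (h : ∀ c < N, q c = q' c) : mask N q = mask N q' := by
  rw [mask, mask]
  congr 1
  exact List.map_congr_left fun c hc => h c (List.mem_range.1 hc)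

theorem exists_glue {α : Type*} {n : ℕ → ℕ} (hn : StrictMono n) (X : ℕ → ℕ → α) :
    ∃ x : ℕ → α, (∀ τ < n 0, x τ = X 0 τ) ∧
      ∀ i τ, n i ≤ τ → τ < n (i + 1) → x τ = X (i + 1) τ := by
  have hex : ∀ τ, ∃ i, τ < n i := fun τ => ⟨τ + 1, hn.le_apply⟩
  classical
  refine ⟨fun τ => X (Nat.find (hex τ)) τ, fun τ hτ => ?_, fun i τ h1 h2 => ?_⟩
  · beta_reduce
    rw [(Nat.find_eq_iff (hex τ)).2 ⟨hτ, fun _ h => absurd h (Nat.not_lt_zero _)⟩]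
  · beta_reduce
    rw [(Nat.find_eq_iff (hex τ)).2 ⟨h2, fun j hj => not_lt.2
      ((hn.monotone (Nat.lt_succ_iff.1 hj)).trans h1)⟩]

theorem Recognizes.all (H : Recognizes N h m p (k + 1) Q) :
    Recognizes (2 ^ N) (fun x => mask N fun c => decide (∃ d < D, h (x + d * D ^ k) = c))
      (fun A B => mask N fun c => decide (∃ a < N, ∃ b < N,
        A.testBit a = true ∧ B.testBit b = true ∧ m a b = c))
      (fun A E => !decide (∃ s < N, ∃ f < N, A.testBit s = true ∧ E.testBit f = true ∧
        m f f = f ∧ m s f = s ∧ p s f = false)) k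
      fun e => ∀ x, Q (Function.update e k x) := by
  classical
  obtain ⟨μ, h1, h2, h3, h4⟩ := H
  have hlet : ∀ e x τ, letter (Function.update e k x) (k + 1) τ =
      letter e k τ + (x τ : Fin D) * D ^ k := fun e x τ => by
    rw [letter, Function.update_self]
    congr 1
    exact letter_congr fun i hi => by rw [Function.update_of_ne hi.ne]
  have hloc : ∀ e x y i j, i < j → (∀ τ, i ≤ τ → τ < j → x τ = y τ) →
      μ (Function.update e k x) i j = μ (Function.update e k y) i j := by
    intro e x y i j hij hxy
    induction j, hij using Nat.le_induction with
    | base =>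
      rw [h2, h2, hlet, hlet, hxy i le_rfl i.lt_succ_self]
    | succ j hij ih =>
      rw [h3 _ i j _ hij j.lt_succ_self, h3 _ i j _ hij j.lt_succ_self,
        ih fun τ h h' => hxy τ h (h'.trans j.lt_succ_self), h2, h2, hlet, hlet,
        hxy j (Nat.le_of_lt hij) j.lt_succ_self]
  obtain ⟨μ', hμ'⟩ : ∃ μ' : (ℕ → ℕ → Fin D) → ℕ → ℕ → ℕ, ∀ e i j, μ' e i j =
    mask N fun c => decide (∃ x, μ (Function.update e k x) i j = c) := ⟨_, fun _ _ _ => rfl⟩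
  have hbit : ∀ e i j c, (μ' e i j).testBit c = true ↔
      c < N ∧ ∃ x, μ (Function.update e k x) i j = c := fun e i j c => by
    rw [hμ', testBit_mask, decide_eq_true_iff]
  refine ⟨μ', fun e i j _ => ?_, fun e i => ?_, fun e i j l hij hjl => ?_,
    fun e n A E hn hn0 hA hE => ?_⟩
  · rw [hμ']
    exact mask_lt _ _
  · rw [hμ']
    refine mask_congr fun c _ => decide_eq_decide.2 ?_
    simp only [h2, hlet]
    constructor
    · rintro ⟨x, hx⟩
      exact ⟨x i, (x i).isLt, hx⟩
    · rintro ⟨d, hd, hx⟩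
      exact ⟨fun _ => ⟨d, hd⟩, hx⟩
  · rw [hμ' e i l]
    refine mask_congr fun c _ => decide_eq_decide.2 ?_
    constructor
    · rintro ⟨x, hx⟩
      refine ⟨_, h1 _ _ _ hij, _, h1 _ _ _ hjl, (hbit _ _ _ _).2 ⟨h1 _ _ _ hij, x, rfl⟩,
        (hbit _ _ _ _).2 ⟨h1 _ _ _ hjl, x, rfl⟩, ?_⟩
      rw [← h3 _ i j l hij hjl, hx]
    · rintro ⟨a, ha, b, hb, hA, hB, hc⟩
      obtain ⟨-, x, hx⟩ := (hbit _ _ _ _).1 hA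
      obtain ⟨-, y, hy⟩ := (hbit _ _ _ _).1 hB
      refine ⟨fun τ => if τ < j then x τ else y τ, ?_⟩
      rw [h3 _ i j l hij hjl, ← hc, ← hx, ← hy]
      congr 1
      · exact hloc _ _ _ _ _ hij fun τ _ h => if_pos h
      · exact hloc _ _ _ _ _ hjl fun τ h _ => if_neg (not_lt.2 h)
  · have hp' : (!decide (∃ s < N, ∃ f < N, A.testBit s = true ∧ E.testBit f = true ∧
        m f f = f ∧ m s f = s ∧ p s f = false)) = true ↔ ∀ s < N, ∀ f < N, A.testBit s = true →
        E.testBit f = true → m f f = f → m s f = s → p s f = true := by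
      simp
    refine Iff.trans ?_ hp'.symm
    have hpos : ∀ i, 0 < n i := fun i => hn0.trans_le (hn.monotone i.zero_le)
    constructor
    · intro hQ s hs f hf hsA hfE hff hsf
      rw [← hA 0] at hsA
      obtain ⟨-, x₀, hx₀⟩ := (hbit _ _ _ _).1 hsA
      have hfE' : ∀ i, ∃ x, μ (Function.update e k x) (n i) (n (i + 1)) = f := fun i => by
        rw [← hE i (i + 1) i.lt_succ_self] at hfE
        exact ((hbit _ _ _ _).1 hfE).2
      choose X hX using hfE'
      obtain ⟨x, hx, hx'⟩ := exists_glue hn fun i => Nat.casesOn i x₀ X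
      have hs0 : μ (Function.update e k x) 0 (n 0) = s := by
        rw [← hx₀]
        exact hloc _ _ _ _ _ hn0 fun τ _ h => hx τ h
      have hf0 : ∀ i, μ (Function.update e k x) (n i) (n (i + 1)) = f := fun i => by
        rw [← hX i]
        exact hloc _ _ _ _ _ (hn i.lt_succ_self) fun τ h h' => hx' i τ h h'
      have hfij : ∀ i j, i < j → μ (Function.update e k x) (n i) (n j) = f := by
        intro i j hij
        induction j, hij using Nat.le_induction with
        | base => exact hf0 i
        | succ j hij ih => rw [h3 _ _ _ _ (hn hij) (hn j.lt_succ_self), ih, hf0, hff]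
      refine (h4 _ n s f hn hn0 (fun i => ?_) hfij).1 (hQ x)
      cases i with
      | zero => exact hs0
      | succ i => rw [h3 _ _ _ _ hn0 (hn i.succ_pos), hs0, hfij _ _ i.succ_pos, hsf]
    · intro hp x
      obtain ⟨r, f, hr, hf⟩ := exists_homogeneous (N := N)
        (c := fun i j => μ (Function.update e k x) (n i) (n j)) fun i j hij => h1 _ _ _ (hn hij)
      obtain ⟨q, s, hq, hs⟩ := exists_strictMono_eq (N := N)
        (u := fun i => μ (Function.update e k x) 0 (n (r i))) fun i => h1 _ _ _ (hpos _)
      have hmono : StrictMono fun i => n (r (q i)) := hn.comp (hr.comp hq)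
      have hf' : ∀ i j, i < j → μ (Function.update e k x) (n (r (q i))) (n (r (q j))) = f :=
        fun i j hij => hf _ _ (hq hij)
      refine (h4 _ _ s f hmono (hpos _) hs hf').2 (hp s ?_ f ?_ ?_ ?_ ?_ ?_)
      · exact hs 0 ▸ h1 _ _ _ (hpos _)
      · exact hf' 0 1 Nat.one_pos ▸ h1 _ _ _ (hmono Nat.one_pos)
      · rw [← hA (r (q 0)), hbit]
        exact ⟨hs 0 ▸ h1 _ _ _ (hpos _), x, hs 0⟩
      · rw [← hE (r (q 0)) (r (q 1)) (hr (hq Nat.one_pos)), hbit]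
        exact ⟨hf' 0 1 Nat.one_pos ▸ h1 _ _ _ (hmono Nat.one_pos), x, hf' 0 1 Nat.one_pos⟩
      · conv_lhs => rw [← hf' 0 1 Nat.one_pos]
        conv_lhs => enter [2]; rw [hf' 0 1 Nat.one_pos, ← hf' 1 2 (by norm_num)]
        rw [← h3 _ _ _ _ (hmono Nat.one_pos) (hmono (by norm_num))]
        exact hf' 0 2 (by norm_num)
      · conv_lhs => rw [← hs 0, ← hf' 0 1 Nat.one_pos]
        have := h3 (Function.update e k x) _ _ _ (hpos (r (q 0))) (hmono Nat.one_pos)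
        beta_reduce at this
        rw [← this]
        exact hs 1

end Recognizers

section Reg

open Filter

variable {D : ℕ}

/-- A property of tuples of infinite words over `Fin D` is regular if it is recognized by some
finite multiplication. -/
def Reg (k : ℕ) (Q : (ℕ → ℕ → Fin D) → Prop) : Prop :=
  ∃ N h m p, Recognizes N h m p k Q

variable {k : ℕ} {Q Q' : (ℕ → ℕ → Fin D) → Prop}

theorem Reg.iff (H : Reg k Q) (h : ∀ e, Q e ↔ Q' e) : Reg k Q' := by
  obtain ⟨N, _, _, _, H⟩ := H
  exact ⟨N, _, _, _, H.congr (fun _ _ => rfl) (fun _ _ _ _ => rfl) (fun _ _ _ _ => rfl) h⟩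

theorem Reg.imp (H : Reg k Q) (H' : Reg k Q') : Reg k fun e => Q e → Q' e := by
  obtain ⟨_, _, _, _, H⟩ := H
  obtain ⟨_, _, _, _, H'⟩ := H'
  exact ⟨_, _, _, _, H.imp H'⟩

theorem Reg.false (k : ℕ) : Reg k fun _ : ℕ → ℕ → Fin D => False :=
  ⟨_, _, _, _, recognizes_false k⟩

theorem Reg.not (H : Reg k Q) : Reg k fun e => ¬ Q e :=
  H.imp (.false k)

theorem Reg.and (H : Reg k Q) (H' : Reg k Q') : Reg k fun e => Q e ∧ Q' e :=
  (H.imp H'.not).not.iff fun _ => by tauto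

theorem Reg.or (H : Reg k Q) (H' : Reg k Q') : Reg k fun e => Q e ∨ Q' e :=
  (H.not.imp H').iff fun _ => by tauto

theorem Reg.all (H : Reg (k + 1) Q) : Reg k fun e => ∀ x, Q (Function.update e k x) := by
  obtain ⟨_, _, _, _, H⟩ := H
  exact ⟨_, _, _, _, H.all⟩

theorem Reg.ex (H : Reg (k + 1) Q) : Reg k fun e => ∃ x, Q (Function.update e k x) :=
  H.not.all.not.iff fun _ => by simp

theorem Reg.rename (l : List ℕ) (H : Reg l.length Q) (hl : ∀ i ∈ l, i < k) :
    Reg k fun e => Q fun i => e (l.getD i 0) := by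
  obtain ⟨_, _, _, _, H⟩ := H
  exact ⟨_, _, _, _, H.rename hl⟩

theorem Reg.of_finite {S : Type*} [Finite S] (μ : (ℕ → ℕ → Fin D) → ℕ → ℕ → S) (w : ℕ → S)
    (mul : S → S → S) (acc : S → S → Prop) (h2 : ∀ e i, μ e i (i + 1) = w (letter e k i))
    (h3 : ∀ e i j l, i < j → j < l → μ e i l = mul (μ e i j) (μ e j l))
    (h4 : ∀ e n s f, StrictMono n → 0 < n 0 → (∀ i, μ e 0 (n i) = s) →
      (∀ i j, i < j → μ e (n i) (n j) = f) → (Q e ↔ acc s f)) : Reg k Q := by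
  classical
  obtain ⟨N, ⟨φ⟩⟩ := Finite.exists_equiv_fin S
  let ψ : ℕ → S := fun i => if h : i < N then φ.symm ⟨i, h⟩ else w 0
  have hψ : ∀ s, ψ (φ s) = s := fun s => by simp [ψ]
  refine ⟨N, fun x => φ (w x), fun x y => φ (mul (ψ x) (ψ y)),
    fun x y => decide (acc (ψ x) (ψ y)), fun e i j => φ (μ e i j), fun e i j _ => (φ _).isLt,
    fun e i => ?_, fun e i j l hij hjl => ?_, fun e n s f hn hn0 hs hf => ?_⟩
  · beta_reduce
    rw [h2]
  · beta_reduce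
    rw [hψ, hψ, h3 e i j l hij hjl]
  · beta_reduce at hs hf ⊢
    rw [decide_eq_true_iff]
    exact h4 e n _ _ hn hn0 (fun i => by rw [← hs i, hψ]) fun i j hij => by rw [← hf i j hij, hψ]

/-- The tuple of digits making up a letter. -/
def letterDigits [NeZero D] (k ℓ : ℕ) : Fin k → Fin D := fun i =>
  ⟨ℓ / D ^ (i : ℕ) % D, Nat.mod_lt _ (NeZero.pos D)⟩

theorem letterDigits_letter [NeZero D] (e : ℕ → ℕ → Fin D) (k τ : ℕ) :
    (letterDigits k (letter e k τ) : Fin k → Fin D) = fun i : Fin k => e i τ :=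
  funext fun i => Fin.ext (letter_div_mod e τ i.isLt)

theorem Reg.first [NeZero D] (I : (Fin k → Fin D) → Prop) :
    Reg k fun e : ℕ → ℕ → Fin D => I fun i => e i 0 :=
  Reg.of_finite (fun e i _ => fun v : Fin k => e v i) (letterDigits k) (fun s _ => s)
    (fun s _ => I s) (fun e i => (letterDigits_letter e k i).symm) (fun _ _ _ _ _ _ => rfl)
    fun e n s f hn hn0 hs _ => by rw [← hs 0]

theorem Reg.eventually [NeZero D] (G : (Fin k → Fin D) → Prop) :
    Reg k fun e : ℕ → ℕ → Fin D => ∀ᶠ τ in atTop, G fun i => e i τ := by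
  refine Reg.of_finite (S := Prop) (fun e i j => ∀ τ, i ≤ τ → τ < j → G fun v => e v τ)
    (fun ℓ => G (letterDigits (D := D) k ℓ)) (fun s s' => s ∧ s') (fun _ f => f) (fun e i => ?_)
    (fun e i j l hij hjl => ?_) fun e n s f hn hn0 _ hf => ?_
  · rw [letterDigits_letter]
    refine propext ⟨fun h => h i le_rfl i.lt_succ_self, fun h τ h1 h2 => ?_⟩
    rwa [show τ = i by omega]
  · refine propext ⟨fun h => ⟨fun τ h1 h2 => h τ h1 (h2.trans hjl),
      fun τ h1 h2 => h τ (hij.le.trans h1) h2⟩, fun h τ h1 h2 => ?_⟩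
    rcases lt_or_ge τ j with hj | hj
    exacts [h.1 τ h1 hj, h.2 τ hj h2]
  · rw [eventually_atTop]
    constructor
    · rintro ⟨M, hM⟩
      rw [← hf M (M + 1) M.lt_succ_self]
      exact fun τ h1 _ => hM τ (hn.le_apply.trans h1)
    · refine fun h => ⟨n 0, fun τ hτ => ?_⟩
      have := hf 0 (τ + 1) τ.succ_pos
      rw [← this] at h
      exact h τ hτ (lt_of_lt_of_le τ.lt_succ_self hn.le_apply)

theorem Reg.local [NeZero D] (Δ : (Fin k → Fin D) → (Fin k → Fin D) → Prop) :
    Reg k fun e : ℕ → ℕ → Fin D => ∀ τ, Δ (fun i => e i τ) fun i => e i (τ + 1) := by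
  refine Reg.of_finite (S := (Fin k → Fin D) × (Fin k → Fin D) × Prop)
    (fun e i j => (fun v => e v i, fun v => e v (j - 1),
      ∀ τ, i ≤ τ → τ + 1 < j → Δ (fun v => e v τ) fun v => e v (τ + 1)))
    (fun ℓ => (letterDigits k ℓ, letterDigits k ℓ, True))
    (fun s s' => (s.1, s'.2.1, (s.2.2 ∧ s'.2.2) ∧ Δ s.2.1 s'.1))
    (fun s f => s.2.2 ∧ f.2.2 ∧ Δ s.2.1 f.1 ∧ Δ f.2.1 f.1) (fun e i => ?_)
    (fun e i j l hij hjl => ?_) fun e n s f hn hn0 hs hf => ?_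
  · rw [letterDigits_letter]
    refine Prod.ext rfl (Prod.ext rfl (propext ⟨fun _ => trivial, fun _ τ h1 h2 => ?_⟩))
    omega
  · refine Prod.ext rfl (Prod.ext rfl (propext ⟨fun h => ⟨⟨fun τ h1 h2 => h τ h1 (h2.trans hjl),
      fun τ h1 h2 => h τ (hij.le.trans h1) h2⟩, ?_⟩, fun h τ h1 h2 => ?_⟩))
    · have := h (j - 1) (by omega) (by omega)
      rwa [Nat.sub_add_cancel (by omega)] at this
    · rcases lt_trichotomy (τ + 1) j with hj | hj | hj
      · exact h.1.1 τ h1 hj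
      · have := h.2
        rwa [← hj] at this
      · exact h.1.2 τ (by omega) h2
  · obtain ⟨s1, s2, s3⟩ := s
    obtain ⟨f1, f2, f3⟩ := f
    simp only [Prod.mk.injEq] at hs hf
    have hpos : ∀ i, 0 < n i := fun i => hn0.trans_le (hn.monotone i.zero_le)
    have hn01 := hn Nat.one_pos
    constructor
    · intro h
      refine ⟨?_, ?_, ?_, ?_⟩
      · rw [← (hs 0).2.2]
        exact fun τ _ _ => h τ
      · rw [← (hf 0 1 Nat.one_pos).2.2]
        exact fun τ _ _ => h τ
      · have := h (n 0 - 1)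
        rwa [Nat.sub_add_cancel (hpos 0), (hs 0).2.1, (hf 0 1 Nat.one_pos).1] at this
      · have := h (n 1 - 1)
        rwa [Nat.sub_add_cancel (hpos 1), (hf 0 1 Nat.one_pos).2.1, (hf 1 2 (by norm_num)).1]
            at this
    · rintro ⟨h, -, -, -⟩ τ
      rw [← (hs (τ + 2)).2.2] at h
      exact h τ τ.zero_le (lt_of_lt_of_le (Nat.lt_succ_self _) hn.le_apply)

end Reg

namespace QuadUnit

open Filter

variable {a : ℝ} (q : QuadUnit a) {D : ℕ} (c : Fin D → ℤ × ℤ)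

/-- The letters, decoded by `c`, represent all pairs of integers of absolute value at most `K`. -/
structure Decodes (K : ℕ) : Prop where
  bound : ∀ d, |(c d).1| ≤ K ∧ |(c d).2| ≤ K
  surj : ∀ z : ℤ × ℤ, |z.1| ≤ K → |z.2| ≤ K → ∃ d, c d = z

theorem exists_decodes (K : ℕ) : ∃ (D : ℕ) (_ : NeZero D) (c : Fin D → ℤ × ℤ), Decodes c K := by
  have hfin : {z : ℤ × ℤ | |z.1| ≤ K ∧ |z.2| ≤ K}.Finite :=
    ((Set.finite_Icc (-(K : ℤ)) K).prod (Set.finite_Icc (-(K : ℤ)) K)).subset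
      fun z hz => ⟨abs_le.1 hz.1, abs_le.1 hz.2⟩
  have := hfin.to_subtype
  obtain ⟨D, ⟨φ⟩⟩ := Finite.exists_equiv_fin {z : ℤ × ℤ | |z.1| ≤ K ∧ |z.2| ≤ K}
  refine ⟨D, ⟨?_⟩, fun d => φ.symm d, fun d => (φ.symm d).2,
    fun z h1 h2 => ⟨φ ⟨z, h1, h2⟩, by simp⟩⟩
  rintro rfl
  exact (φ ⟨0, by simp⟩).elim0

variable {c} in
theorem Decodes.exists_word {K : ℕ} (hc : Decodes c K) (s : ℕ → ℤ × ℤ)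
    (hs : ∀ i, |(s i).1| ≤ K ∧ |(s i).2| ≤ K) : ∃ w : ℕ → Fin D, ∀ i, c (w i) = s i :=
  Classical.axiomOfChoice fun i => hc.surj (s i) (hs i).1 (hs i).2

/-- The integer nearest to `z` of absolute value at most `T`. -/
def clamp (z : ℤ) : ℤ := max (-q.T) (min q.T z)

theorem abs_clamp (z : ℤ) : |q.clamp z| ≤ q.T := by
  rw [clamp, abs_le]
  omega

variable {q} in
theorem clamp_of_abs_le {z : ℤ} (hz : |z| ≤ q.T) : q.clamp z = z := by
  rw [abs_le] at hz
  rw [clamp]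
  omega

/-- The digits before the point of the expansion denoted by a word. -/
def highDigit (d : Fin D) : ℤ := q.clamp (c d).1

/-- The digits after the point of the expansion denoted by a word. -/
def lowDigit (d : Fin D) : ℤ := q.clamp (c d).2

/-- A word denotes an expansion if it has finitely many digits before the point. -/
def Valid (x : ℕ → Fin D) : Prop := ∀ᶠ i in atTop, q.highDigit c (x i) = 0

open Classical in
/-- The real number denoted by a word. -/
noncomputable def val (x : ℕ → Fin D) : ℝ :=
  if h : ∃ y, q.Expands (fun i => q.highDigit c (x i)) (fun i => q.lowDigit c (x i)) y then h.choose
  else 0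

variable {q c} {x x' : ℕ → Fin D}

theorem Valid.expands (h : q.Valid c x) :
    q.Expands (fun i => q.highDigit c (x i)) (fun i => q.lowDigit c (x i)) (q.val c x) := by
  have : ∃ y, q.Expands (fun i => q.highDigit c (x i)) (fun i => q.lowDigit c (x i)) y :=
    q.exists_expands h fun i => q.abs_clamp (c (x i)).2
  rw [val, dif_pos this]
  exact this.choose_spec

theorem val_of_not_valid (h : ¬ q.Valid c x) : q.val c x = 0 :=
  dif_neg fun ⟨_, hy⟩ => h hy.1

theorem val_eq {u v : ℕ → ℤ} {y : ℝ} (hu : ∀ i, |u i| ≤ q.T) (hv : ∀ i, |v i| ≤ q.T)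
    (hx : ∀ i, c (x i) = (u i, v i)) (h : q.Expands u v y) : q.Valid c x ∧ q.val c x = y := by
  have h1 : (fun i => q.highDigit c (x i)) = u := funext fun i => by
    rw [highDigit, hx, clamp_of_abs_le (hu i)]
  have h2 : (fun i => q.lowDigit c (x i)) = v := funext fun i => by
    rw [lowDigit, hx, clamp_of_abs_le (hv i)]
  have h3 : q.Valid c x := by
    have := h.1
    rwa [← h1] at this
  refine ⟨h3, h3.expands.unique ?_⟩
  rwa [h1, h2]

variable (q c) in
/-- The word `x'` denotes an expansion of the value of the word `x`. -/
def Normalizes (x x' : ℕ → Fin D) : Prop :=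
  q.Valid c x ∧ (∀ i, q.highDigit c (x' i) = q.highDigit c (x i) ∧
    q.lowDigit c (x' i) = q.lowDigit c (x i)) ∨
  ¬ q.Valid c x ∧ ∀ i, q.highDigit c (x' i) = 0 ∧ q.lowDigit c (x' i) = 0

theorem Normalizes.expands (h : q.Normalizes c x x') :
    q.Expands (fun i => q.highDigit c (x' i)) (fun i => q.lowDigit c (x' i)) (q.val c x) := by
  rcases h with ⟨h, h'⟩ | ⟨h, h'⟩
  · simp only [h']
    exact h.expands
  · simp only [h', val_of_not_valid h]
    exact ⟨.of_forall fun _ => rfl, by simp⟩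

variable {K : ℕ}

theorem exists_normalizes (hc : Decodes c K) (x : ℕ → Fin D) : ∃ x', q.Normalizes c x x' := by
  by_cases h : q.Valid c x
  · exact ⟨x, .inl ⟨h, fun _ => ⟨rfl, rfl⟩⟩⟩
  · obtain ⟨d, hd⟩ := hc.surj 0 (by simp) (by simp)
    refine ⟨fun _ => d, .inr ⟨h, fun _ => ?_⟩⟩
    rw [highDigit, lowDigit, hd, clamp_of_abs_le (by simp)]
    exact ⟨rfl, clamp_of_abs_le (by simp)⟩

variable [NeZero D]

theorem reg_valid : Reg 1 fun e => q.Valid c (e 0) :=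
  Reg.eventually fun d : Fin 1 → Fin D => q.highDigit c (d 0) = 0

theorem reg_normalizes : Reg 2 fun e => q.Normalizes c (e 0) (e 1) :=
  ((reg_valid.rename [0] (by simp)).and (Reg.local fun d _ : Fin 2 → Fin D =>
    q.highDigit c (d 1) = q.highDigit c (d 0) ∧ q.lowDigit c (d 1) = q.lowDigit c (d 0))).or
  ((reg_valid.rename [0] (by simp)).not.and (Reg.local fun d _ : Fin 2 → Fin D =>
    q.highDigit c (d 1) = 0 ∧ q.lowDigit c (d 1) = 0))

theorem reg_horner (f : Fin 3 → ℤ × ℤ) : Reg 5 fun e => q.Horner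
    (fun i => q.highCoeff f fun j => q.highDigit c (e j i))
    (fun i => q.lowCoeff f (fun j => q.highDigit c (e j i)) fun j => q.lowDigit c (e j i))
    (fun i => c (e 3 i)) fun i => c (e 4 i) := by
  have h1 := Reg.local fun d d' : Fin 5 → Fin D =>
    c (d 3) = (q.highCoeff f fun j => q.highDigit c (d (j.castLE (by norm_num)))) +
      q.shift (c (d' 3))
  have h2 := Reg.eventually fun d : Fin 5 → Fin D => c (d 3) = 0
  have h3 := Reg.first fun d : Fin 5 → Fin D => c (d 4) = c (d 3) + q.lowCoeff f
    (fun j => q.highDigit c (d (j.castLE (by norm_num))))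
      fun j => q.lowDigit c (d (j.castLE (by norm_num)))
  have h4 := Reg.local fun d d' : Fin 5 → Fin D => c (d' 4) = q.shift (c (d 4)) + q.lowCoeff f
    (fun j => q.highDigit c (d' (j.castLE (by norm_num))))
      fun j => q.lowDigit c (d' (j.castLE (by norm_num)))
  exact (h1.and (h2.and (h3.and h4))).iff fun e =>
    ⟨fun ⟨h1, h2, h3, h4⟩ => ⟨h1, h2, h3, h4⟩, fun ⟨h1, h2, h3, h4⟩ => ⟨h1, h2, h3, h4⟩⟩

theorem exists_reg_linear (q : QuadUnit a) (f : Fin 3 → ℤ × ℤ) : ∃ K₀ : ℕ, ∀ K : ℕ, K₀ ≤ K →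
    ∀ {D : ℕ} [NeZero D] {c : Fin D → ℤ × ℤ}, Decodes c K → Reg 3 fun e =>
      q.ev (f 0) * q.val c (e 0) + q.ev (f 1) * q.val c (e 1) + q.ev (f 2) * q.val c (e 2) = 0 := by
  obtain ⟨K₀, hK₀⟩ := q.exists_linear_eq_zero_iff f
  refine ⟨K₀, fun K hK D _ c hc => ?_⟩
  have hN := reg_normalizes (q := q) (c := c)
  have hN : Reg 8 fun e => ∀ j : Fin 3, q.Normalizes c (e j) (e (3 + j)) :=
    ((hN.rename [0, 3] (by simp)).and ((hN.rename [1, 4] (by simp)).and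
      (hN.rename [2, 5] (by simp)))).iff fun e => by simp [Fin.forall_fin_succ]
  have hH : Reg 8 fun e => q.Horner
      (fun i => q.highCoeff f fun j => q.highDigit c (e (3 + j) i))
      (fun i => q.lowCoeff f (fun j => q.highDigit c (e (3 + j) i))
        fun j => q.lowDigit c (e (3 + j) i))
      (fun i => c (e 6 i)) fun i => c (e 7 i) :=
    ((reg_horner (q := q) (c := c) f).rename [3, 4, 5, 6, 7] (by simp)).iff fun e => by
      have : ∀ j : Fin 3, [3, 4, 5, 6, 7].getD j 0 = 3 + (j : ℕ) := by decide
      simp only [this]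
      rfl
  refine ((hN.and hH).ex.ex.ex.ex.ex).iff fun e => ?_
  have hu : ∀ x₃ x₄ x₅ x₆ x₇ : ℕ → Fin D, ∃ e' : ℕ → ℕ → Fin D, Function.update
      (Function.update (Function.update (Function.update (Function.update e 3 x₃) 4 x₄) 5 x₅) 6 x₆)
        7 x₇ = e' ∧ (∀ j : Fin 3, e' j = e j) ∧ (∀ j : Fin 3, e' (3 + j) = ![x₃, x₄, x₅] j) ∧
          e' 6 = x₆ ∧ e' 7 = x₇ := fun x₃ x₄ x₅ x₆ x₇ =>
    ⟨_, rfl, by simp [Fin.forall_fin_succ], by simp [Fin.forall_fin_succ], by simp, by simp⟩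
  have key := fun (w : Fin 3 → ℕ → Fin D) (hw : ∀ j : Fin 3, q.Normalizes c (e j) (w j)) =>
    hK₀ K hK (fun i j => q.highDigit c (w j i)) (fun i j => q.lowDigit c (w j i))
      (fun j => q.val c (e j)) (fun _ _ => q.abs_clamp _) (fun _ _ => q.abs_clamp _)
      fun j => (hw j).expands
  constructor
  · rintro ⟨x₃, x₄, x₅, x₆, x₇, h⟩
    obtain ⟨e', h1, h2, h3, h4, h5⟩ := hu x₃ x₄ x₅ x₆ x₇
    rw [h1] at h
    simp only [h2, h3, h4, h5] at h
    exact (key _ h.1).2 ⟨_, _, h.2, fun i => ⟨hc.bound _, hc.bound _⟩⟩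
  · intro h
    choose w hw using fun j : Fin 3 => exists_normalizes (q := q) hc (e j)
    obtain ⟨s, y, h6, h7⟩ := (key w hw).1 h
    obtain ⟨x₆, h8⟩ := hc.exists_word s fun i => (h7 i).1
    obtain ⟨x₇, h9⟩ := hc.exists_word y fun i => (h7 i).2
    refine ⟨w 0, w 1, w 2, x₆, x₇, ?_⟩
    obtain ⟨e', h1, h2, h3, h4, h5⟩ := hu (w 0) (w 1) (w 2) x₆ x₇
    have h10 : ∀ j, ![w 0, w 1, w 2] j = w j := by simp [Fin.forall_fin_succ]
    rw [h1]
    simp only [h2, h3, h4, h5, h8, h9, h10]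
    exact ⟨hw, h6⟩

/-- Real numbers are denoted by infinite words over a finite alphabet in such a way that all
relations of the structure are regular. -/
theorem exists_presentation (q : QuadUnit a) : ∃ (D : ℕ) (_ : NeZero D) (val : (ℕ → Fin D) → ℝ),
    Function.Surjective val ∧ (Reg 2 fun e => val (e 0) = val (e 1)) ∧
    (Reg 2 fun e => val (e 0) < val (e 1)) ∧ (Reg 1 fun e => ∃ z : ℤ, val (e 0) = z) ∧
    (Reg 3 fun e => val (e 0) + val (e 1) = val (e 2)) ∧
      Reg 2 fun e => a * val (e 0) = val (e 1) := by
  obtain ⟨K₁, h₁⟩ := q.exists_reg_linear ![(1, 0), (-1, 0), (0, 0)]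
  obtain ⟨K₂, h₂⟩ := q.exists_reg_linear ![(1, 0), (1, 0), (-1, 0)]
  obtain ⟨K₃, h₃⟩ := q.exists_reg_linear ![(q.P, q.Q), (-q.R, 0), (0, 0)]
  obtain ⟨D, hD, c, hc⟩ := exists_decodes (max (max K₁ K₂) (max K₃ q.T))
  have hT : (q.T : ℤ) ≤ (max (max K₁ K₂) (max K₃ q.T) : ℕ) := by
    exact_mod_cast (le_max_right _ _).trans (le_max_right _ _)
  have hx : ∀ x : ℝ, ∃ w : ℕ → Fin D, q.Valid c w ∧ q.val c w = x ∧
      (0 ≤ x → ∀ i, 0 ≤ q.highDigit c (w i) ∧ 0 ≤ q.lowDigit c (w i)) ∧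
      ((∃ z : ℤ, x = z) → ∀ i, q.lowDigit c (w i) = 0) := fun x => by
    obtain ⟨u, v, hu, hv, h1, h2, h3⟩ := q.exists_expansion x
    obtain ⟨w, hw⟩ := hc.exists_word (fun i => (u i, v i))
      fun i => ⟨(hu i).trans hT, (hv i).trans hT⟩
    obtain ⟨h4, h5⟩ := val_eq hu hv hw h1
    refine ⟨w, h4, h5, fun hx i => ?_, fun hx i => ?_⟩
    · rw [highDigit, lowDigit, hw, clamp_of_abs_le (hu i), clamp_of_abs_le (hv i)]
      exact ⟨(h2 hx).1 i, (h2 hx).2 i⟩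
    · rw [lowDigit, hw, clamp_of_abs_le (hv i), h3 hx]
  have hadd := (h₂ _ ((le_max_right _ _).trans (le_max_left _ _)) hc).iff (Q' := fun e =>
    q.val c (e 0) + q.val c (e 1) = q.val c (e 2)) fun e => by
      simp [ev, ← sub_eq_add_neg, sub_eq_zero]
  have heq := ((h₁ _ ((le_max_left _ _).trans (le_max_left _ _)) hc).rename (k := 2) [0, 1, 0]
    (by simp)).iff (Q' := fun e => q.val c (e 0) = q.val c (e 1)) fun e => by
      simp [ev, ← sub_eq_add_neg, sub_eq_zero]
  have hlam := ((h₃ _ ((le_max_left _ _).trans (le_max_right _ _)) hc).rename (k := 2) [0, 1, 0]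
    (by simp)).iff (Q' := fun e => a * q.val c (e 0) = q.val c (e 1)) fun e => by
      have hR : (q.R : ℝ) ≠ 0 := by exact_mod_cast q.R_ne
      rw [← mul_right_inj' hR (b := a * q.val c (e 0)), ← mul_assoc, q.mul_eq]
      simp [ev, ← sub_eq_add_neg, sub_eq_zero]
  have hZ : Reg 1 fun e => ∃ z : ℤ, q.val c (e 0) = z := by
    refine ((heq.rename (k := 2) [0, 1] (by simp)).and ((reg_valid (q := q) (c := c)).rename [1]
      (by simp) |>.and (Reg.local fun d _ : Fin 2 → Fin D => q.lowDigit c (d 1) = 0))).ex.iff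
        fun e => ?_
    simp only [List.getD_cons_zero, List.getD_cons_succ, Fin.coe_ofNat_eq_mod, Nat.one_mod,
      Function.update_self, ne_eq, zero_ne_one, not_false_eq_true, Function.update_of_ne]
    constructor
    · rintro ⟨x, h1, h2, h3⟩
      have := h2.expands
      simp only [h3] at this
      exact h1 ▸ this.exists_int
    · intro h
      obtain ⟨w, h1, h2, -, h3⟩ := hx (q.val c (e 0))
      exact ⟨w, h2.symm, h1, h3 h⟩
  refine ⟨D, hD, q.val c, fun x => (hx x).imp fun _ h => h.2.1, heq, ?_, hZ, hadd, hlam⟩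
  have hle : Reg 2 fun e => q.val c (e 0) ≤ q.val c (e 1) := by
    refine ((hadd.rename (k := 3) [0, 2, 1] (by simp)).and ((reg_valid (q := q) (c := c)).rename [2]
      (by simp) |>.and (Reg.local fun d _ : Fin 3 → Fin D =>
        0 ≤ q.highDigit c (d 2) ∧ 0 ≤ q.lowDigit c (d 2)))).ex.iff fun e => ?_
    simp only [List.getD_cons_zero, List.getD_cons_succ, Fin.coe_ofNat_eq_mod, Nat.reduceMod,
      Function.update_self, ne_eq, OfNat.zero_ne_ofNat, OfNat.one_ne_ofNat, not_false_eq_true,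
      Function.update_of_ne]
    constructor
    · rintro ⟨x, h1, h2, h3⟩
      have := h2.expands.nonneg (fun i => (h3 i).1) fun i => (h3 i).2
      linarith
    · intro h
      obtain ⟨w, h1, h2, h3, -⟩ := hx (q.val c (e 1) - q.val c (e 0))
      exact ⟨w, by rw [h2]; ring, h1, h3 (sub_nonneg.2 h)⟩
  exact (hle.and heq.not).iff fun e => lt_iff_le_and_ne.symm

end QuadUnit

section Prim

variable {α β γ σ : Type*} [Primcodable α] [Primcodable β] [Primcodable γ] [Primcodable σ]

attribute [fun_prop] Primrec

@[fun_prop]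
theorem primrec_id' : Primrec fun x : α => x := .id

@[fun_prop]
theorem primrec_const' (x : σ) : Primrec fun _ : α => x := .const x

@[fun_prop]
theorem primrec_comp' {f : β → σ} {g : α → β} (hf : Primrec f) (hg : Primrec g) :
    Primrec fun x => f (g x) := hf.comp hg

@[fun_prop]
theorem primrec_prodMk {f : α → β} {g : α → γ} (hf : Primrec f) (hg : Primrec g) :
    Primrec fun x => (f x, g x) := hf.pair hg

@[fun_prop]
theorem primrec_fst {f : α → β × γ} (hf : Primrec f) : Primrec fun x => (f x).1 :=
  Primrec.fst.comp hf

@[fun_prop]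
theorem primrec_snd {f : α → β × γ} (hf : Primrec f) : Primrec fun x => (f x).2 :=
  Primrec.snd.comp hf

@[fun_prop]
theorem primrec_add {f g : α → ℕ} (hf : Primrec f) (hg : Primrec g) : Primrec fun x => f x + g x :=
  Primrec.nat_add.comp hf hg

@[fun_prop]
theorem primrec_sub {f g : α → ℕ} (hf : Primrec f) (hg : Primrec g) : Primrec fun x => f x - g x :=
  Primrec.nat_sub.comp hf hg

@[fun_prop]
theorem primrec_mul {f g : α → ℕ} (hf : Primrec f) (hg : Primrec g) : Primrec fun x => f x * g x :=
  Primrec.nat_mul.comp hf hg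

@[fun_prop]
theorem primrec_div {f g : α → ℕ} (hf : Primrec f) (hg : Primrec g) : Primrec fun x => f x / g x :=
  Primrec.nat_div.comp hf hg

@[fun_prop]
theorem primrec_mod {f g : α → ℕ} (hf : Primrec f) (hg : Primrec g) : Primrec fun x => f x % g x :=
  Primrec.nat_mod.comp hf hg

@[fun_prop]
theorem primrec_pow {f g : α → ℕ} (hf : Primrec f) (hg : Primrec g) : Primrec fun x => f x ^ g x :=
  (Primrec₂.unpaired'.1 Nat.Primrec.pow).comp hf hg

@[fun_prop]
theorem primrec_beq {f g : α → ℕ} (hf : Primrec f) (hg : Primrec g) : Primrec fun x => f x == g x :=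
  Primrec.beq.comp hf hg

@[fun_prop]
theorem primrec_and {f g : α → Bool} (hf : Primrec f) (hg : Primrec g) :
    Primrec fun x => f x && g x :=
  Primrec.and.comp hf hg

@[fun_prop]
theorem primrec_or {f g : α → Bool} (hf : Primrec f) (hg : Primrec g) :
    Primrec fun x => f x || g x :=
  Primrec.or.comp hf hg

@[fun_prop]
theorem primrec_not {f : α → Bool} (hf : Primrec f) : Primrec fun x => !f x :=
  Primrec.not.comp hf

@[fun_prop]
theorem primrec_cond {b : α → Bool} {f g : α → σ} (hb : Primrec b) (hf : Primrec f)
    (hg : Primrec g) : Primrec fun x => bif b x then f x else g x :=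
  Primrec.cond hb hf hg

@[fun_prop]
theorem primrec_cons {f : α → β} {g : α → List β} (hf : Primrec f) (hg : Primrec g) :
    Primrec fun x => f x :: g x :=
  Primrec.list_cons.comp hf hg

@[fun_prop]
theorem primrec_append {f g : α → List β} (hf : Primrec f) (hg : Primrec g) :
    Primrec fun x => f x ++ g x :=
  Primrec.list_append.comp hf hg

@[fun_prop]
theorem primrec_unpair {f : α → ℕ} (hf : Primrec f) : Primrec fun x => (f x).unpair :=
  Primrec.unpair.comp hf

@[fun_prop]
theorem primrec_headI [Inhabited β] {f : α → List β} (hf : Primrec f) :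
    Primrec fun x => (f x).headI :=
  Primrec.list_headI.comp hf

@[fun_prop]
theorem primrec_tail {f : α → List β} (hf : Primrec f) : Primrec fun x => (f x).tail :=
  Primrec.list_tail.comp hf

@[fun_prop]
theorem primrec_length {f : α → List β} (hf : Primrec f) : Primrec fun x => (f x).length :=
  Primrec.list_length.comp hf

@[fun_prop]
theorem primrec_getD {f : α → List β} {g : α → ℕ} (hf : Primrec f) (hg : Primrec g) (d : β) :
    Primrec fun x => (f x).getD (g x) d :=
  (Primrec.list_getD d).comp hf hg

@[fun_prop]
theorem primrec_range {f : α → ℕ} (hf : Primrec f) : Primrec fun x => List.range (f x) :=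
  Primrec.list_range.comp hf

@[fun_prop]
theorem primrec_map {f : α → List β} {g : α → β → σ} (hf : Primrec f)
    (hg : Primrec fun p : α × β => g p.1 p.2) : Primrec fun x => (f x).map (g x) :=
  Primrec.list_map hf hg

@[fun_prop]
theorem primrec_foldr {f : α → List β} {g : α → β → σ → σ} {s : α → σ} (hf : Primrec f)
    (hg : Primrec fun p : α × β × σ => g p.1 p.2.1 p.2.2) (hs : Primrec s) :
    Primrec fun x => (f x).foldr (g x) (s x) :=
  Primrec.list_foldr (h := fun x p => g x p.1 p.2) hf hs hg

@[fun_prop]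
theorem primrec_natRec {f : α → ℕ} {g : α → ℕ → σ → σ} {s : α → σ} (hf : Primrec f)
    (hg : Primrec fun p : α × ℕ × σ => g p.1 p.2.1 p.2.2) (hs : Primrec s) :
    Primrec fun x => (Nat.rec (s x) (g x) (f x) : σ) :=
  Primrec.nat_rec' (h := fun x p => g x p.1 p.2) hf hs hg

/-- Bounded existential quantification. -/
def anyBelow (n : ℕ) (q : ℕ → Bool) : Bool := (List.range n).foldr (fun i b => q i || b) false

theorem anyBelow_iff {n : ℕ} {q : ℕ → Bool} : anyBelow n q = true ↔ ∃ i < n, q i = true := by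
  have h : ∀ l : List ℕ, l.foldr (fun i b => q i || b) false = true ↔ ∃ i ∈ l, q i = true := by
    intro l
    induction l with
    | nil => simp
    | cons a l ih => simp [ih]
  simp [anyBelow, h]

@[fun_prop]
theorem primrec_anyBelow {f : α → ℕ} {q : α → ℕ → Bool} (hf : Primrec f)
    (hq : Primrec fun p : α × ℕ => q p.1 p.2) : Primrec fun x => anyBelow (f x) (q x) := by
  unfold anyBelow
  fun_prop

@[fun_prop]
theorem primrec_mask {f : α → ℕ} {q : α → ℕ → Bool} (hf : Primrec f)
    (hq : Primrec fun p : α × ℕ => q p.1 p.2) : Primrec fun x => mask (f x) (q x) := by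
  unfold mask ofBits
  have h : Primrec fun b : Bool => b.toNat := Primrec.dom_bool _
  fun_prop

@[fun_prop]
theorem primrec_testBit {f g : α → ℕ} (hf : Primrec f) (hg : Primrec g) :
    Primrec fun x => (f x).testBit (g x) := by
  have h : ∀ a b : ℕ, a.testBit b = (a / 2 ^ b % 2 == 1) := fun a b => by
    rw [Nat.testBit_eq_decide_div_mod_eq, beq_eq_decide]
  simp only [h]
  fun_prop

@[fun_prop]
theorem primrec_renameLetter (D : ℕ) {f : α → List ℕ} {g : α → ℕ} (hf : Primrec f)
    (hg : Primrec g) :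
    Primrec fun x => renameLetter D (f x) (g x) := by
  have h : ∀ (l : List ℕ) (x : ℕ),
      renameLetter D l x = l.foldr (fun i n => x / D ^ i % D + D * n) 0 := fun l x => by
    induction l with
    | nil => rfl
    | cons i l ih => rw [renameLetter, ih, List.foldr_cons]
  simp only [h]
  fun_prop

end Prim

section Tab

/-- Tables of finite multiplications with an assignment to letters and a set of linked pairs. -/
abbrev Tab : Type := ℕ × List ℕ × List ℕ × List Bool

namespace Tab

/-- The value of a letter. -/
def val (t : Tab) (x : ℕ) : ℕ := t.2.1.getD x 0

/-- The product of two elements. -/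
def mul (t : Tab) (x y : ℕ) : ℕ := t.2.2.1.getD (x * t.1 + y) 0

/-- Membership in the set of linked pairs. -/
def acc (t : Tab) (x y : ℕ) : Bool := t.2.2.2.getD (x * t.1 + y) false

/-- The table of the given functions. -/
def mk (N L : ℕ) (h : ℕ → ℕ) (m : ℕ → ℕ → ℕ) (p : ℕ → ℕ → Bool) : Tab :=
  (N, (List.range L).map h, (List.range (N * N)).map fun z => m (z / N) (z % N),
    (List.range (N * N)).map fun z => p (z / N) (z % N))

variable {α : Type*} [Primcodable α]

@[fun_prop]
theorem primrec_val {f : α → Tab} {g : α → ℕ} (hf : Primrec f) (hg : Primrec g) :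
    Primrec fun x => (f x).val (g x) := by
  unfold val
  fun_prop

@[fun_prop]
theorem primrec_mul {f : α → Tab} {g h : α → ℕ} (hf : Primrec f) (hg : Primrec g) (hh : Primrec h) :
    Primrec fun x => (f x).mul (g x) (h x) := by
  unfold mul
  fun_prop

@[fun_prop]
theorem primrec_acc {f : α → Tab} {g h : α → ℕ} (hf : Primrec f) (hg : Primrec g) (hh : Primrec h) :
    Primrec fun x => (f x).acc (g x) (h x) := by
  unfold acc
  fun_prop

@[fun_prop]
theorem primrec_mk {N L : α → ℕ} {h : α → ℕ → ℕ} {m : α → ℕ → ℕ → ℕ} {p : α → ℕ → ℕ → Bool}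
    (hN : Primrec N) (hL : Primrec L) (hh : Primrec fun z : α × ℕ => h z.1 z.2)
    (hm : Primrec fun z : α × ℕ × ℕ => m z.1 z.2.1 z.2.2)
    (hp : Primrec fun z : α × ℕ × ℕ => p z.1 z.2.1 z.2.2) :
    Primrec fun x => mk (N x) (L x) (h x) (m x) (p x) := by
  unfold mk
  have h1 : Primrec fun z : α × ℕ => m z.1 (z.2 / N z.1) (z.2 % N z.1) :=
    hm.comp (g := fun z : α × ℕ => (z.1, z.2 / N z.1, z.2 % N z.1)) (by fun_prop)
  have h2 : Primrec fun z : α × ℕ => p z.1 (z.2 / N z.1) (z.2 % N z.1) :=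
    hp.comp (g := fun z : α × ℕ => (z.1, z.2 / N z.1, z.2 % N z.1)) (by fun_prop)
  fun_prop

variable {N L : ℕ} {h : ℕ → ℕ} {m : ℕ → ℕ → ℕ} {p : ℕ → ℕ → Bool}

theorem val_mk {x : ℕ} (hx : x < L) : (mk N L h m p).val x = h x := by
  simp [val, mk, List.getD_eq_getElem?_getD, hx]

theorem mul_add_lt {x y : ℕ} (hx : x < N) (hy : y < N) : x * N + y < N * N := by
  nlinarith

theorem mul_add_div {x y : ℕ} (hy : y < N) : (x * N + y) / N = x := by
  rw [mul_comm, Nat.mul_add_div (by omega), Nat.div_eq_of_lt hy, add_zero]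

theorem mul_mk {x y : ℕ} (hx : x < N) (hy : y < N) : (mk N L h m p).mul x y = m x y := by
  simp [mul, mk, List.getD_eq_getElem?_getD, mul_add_lt hx hy, mul_add_div hy, Nat.mod_eq_of_lt hy]

theorem acc_mk {x y : ℕ} (hx : x < N) (hy : y < N) : (mk N L h m p).acc x y = p x y := by
  simp [acc, mk, List.getD_eq_getElem?_getD, mul_add_lt hx hy, mul_add_div hy, Nat.mod_eq_of_lt hy]

variable {D k : ℕ} {Q Q' : (ℕ → ℕ → Fin D) → Prop}

/-- The table recognizes a property of tuples of infinite words. -/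
def Rec (t : Tab) (k : ℕ) (Q : (ℕ → ℕ → Fin D) → Prop) : Prop :=
  t.2.1.length = D ^ k ∧ Recognizes t.1 t.val t.mul t.acc k Q

theorem Rec.iff {t : Tab} (H : t.Rec k Q) (h : ∀ e, Q e ↔ Q' e) : t.Rec k Q' :=
  ⟨H.1, H.2.congr (fun _ _ => rfl) (fun _ _ _ _ => rfl) (fun _ _ _ _ => rfl) h⟩

theorem rec_mk (H : Recognizes N h m p k Q) (hL : L = D ^ k) : (mk N L h m p).Rec k Q := by
  subst hL
  exact ⟨by simp [mk], H.congr (fun _ hx => (val_mk hx).symm) (fun _ hx _ hy => (mul_mk hx hy).symm)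
    (fun _ hx _ hy => (acc_mk hx hy).symm) fun _ => Iff.rfl⟩

theorem exists_rec (H : Reg k Q) : ∃ t : Tab, t.Rec k Q := by
  obtain ⟨N, h, m, p, H⟩ := H
  exact ⟨_, rec_mk H rfl⟩

/-- The table of an implication. -/
def imp (t t' : Tab) : Tab :=
  mk (t.1 * t'.1) t.2.1.length (fun x => t.val x * t'.1 + t'.val x)
    (fun x y => t.mul (x / t'.1) (y / t'.1) * t'.1 + t'.mul (x % t'.1) (y % t'.1))
    fun x y => !t.acc (x / t'.1) (y / t'.1) || t'.acc (x % t'.1) (y % t'.1)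

theorem Rec.imp {t t' : Tab} (H : t.Rec k Q) (H' : t'.Rec k Q') :
    (t.imp t').Rec k fun e => Q e → Q' e :=
  rec_mk (H.2.imp H'.2) H.1

@[fun_prop]
theorem primrec_imp {f g : α → Tab} (hf : Primrec f) (hg : Primrec g) :
    Primrec fun x => (f x).imp (g x) := by
  unfold imp
  fun_prop

/-- The table of the property that never holds. -/
def bot (D k : ℕ) : Tab := mk 1 (D ^ k) (fun _ => 0) (fun _ _ => 0) fun _ _ => false

theorem rec_bot (D k : ℕ) : (bot D k).Rec k fun _ : ℕ → ℕ → Fin D => False :=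
  rec_mk (recognizes_false k) rfl

@[fun_prop]
theorem primrec_bot (D : ℕ) {f : α → ℕ} (hf : Primrec f) : Primrec fun x => bot D (f x) := by
  unfold bot
  fun_prop

/-- The table of a property after a change of variables. -/
def rename (D : ℕ) (l : List ℕ) (k : ℕ) (t : Tab) : Tab :=
  mk t.1 (D ^ k) (fun x => t.val (renameLetter D l x)) t.mul t.acc

theorem Rec.rename {t : Tab} {l : List ℕ} (H : t.Rec l.length Q) (hl : ∀ i ∈ l, i < k) :
    (t.rename D l k).Rec k fun e => Q fun i => e (l.getD i 0) :=
  rec_mk (H.2.rename hl) rfl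

@[fun_prop]
theorem primrec_rename (D : ℕ) {f : α → List ℕ} {g : α → ℕ} {t : α → Tab} (hf : Primrec f)
    (hg : Primrec g) (ht : Primrec t) : Primrec fun x => (t x).rename D (f x) (g x) := by
  unfold rename
  fun_prop

/-- The table of a universal quantification over the last variable. -/
def all (D : ℕ) (t : Tab) : Tab :=
  mk (2 ^ t.1) (t.2.1.length / D)
    (fun x => mask t.1 fun c => anyBelow D fun d => t.val (x + d * (t.2.1.length / D)) == c)
    (fun A B => mask t.1 fun c => anyBelow t.1 fun a => anyBelow t.1 fun b =>
      A.testBit a && (B.testBit b && t.mul a b == c))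
    fun A E => !anyBelow t.1 fun s => anyBelow t.1 fun f => A.testBit s && (E.testBit f &&
      (t.mul f f == f && (t.mul s f == s && !t.acc s f)))

theorem Rec.all [NeZero D] {t : Tab} (H : t.Rec (k + 1) Q) :
    (t.all D).Rec k fun e => ∀ x, Q (Function.update e k x) := by
  have hL : t.2.1.length / D = D ^ k := by
    rw [H.1, pow_succ, Nat.mul_div_cancel _ (NeZero.pos D)]
  refine rec_mk (H.2.all.congr (fun x _ => ?_) (fun A _ B _ => ?_) (fun A _ E _ => ?_)
    fun _ => Iff.rfl) hL
  · exact mask_congr fun c _ => by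
      rw [Bool.eq_iff_iff, decide_eq_true_iff, anyBelow_iff]
      simp [hL]
  · exact mask_congr fun c _ => by
      rw [Bool.eq_iff_iff, decide_eq_true_iff, anyBelow_iff]
      simp [anyBelow_iff]
  · congr 1
    rw [Bool.eq_iff_iff, decide_eq_true_iff, anyBelow_iff]
    simp [anyBelow_iff]

@[fun_prop]
theorem primrec_all (D : ℕ) {f : α → Tab} (hf : Primrec f) : Primrec fun x => (f x).all D := by
  unfold all
  fun_prop

end Tab

end Tab

section Parse

open FirstOrder Language

/-- Tables for the basic relations of the structure. -/
structure Atoms (a : ℝ) (D : ℕ) where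
  val : (ℕ → Fin D) → ℝ
  surj : Function.Surjective val
  eqTab : Tab
  ltTab : Tab
  intTab : Tab
  addTab : Tab
  mulTab : Tab
  rec_eq : eqTab.Rec 2 fun e => val (e 0) = val (e 1)
  rec_lt : ltTab.Rec 2 fun e => val (e 0) < val (e 1)
  rec_int : intTab.Rec 1 fun e => ∃ z : ℤ, val (e 0) = z
  rec_add : addTab.Rec 3 fun e => val (e 0) + val (e 1) = val (e 2)
  rec_mul : mulTab.Rec 2 fun e => a * val (e 0) = val (e 1)

theorem QuadUnit.exists_atoms {a : ℝ} (q : QuadUnit a) :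
    ∃ (D : ℕ) (_ : NeZero D), Nonempty (Atoms a D) := by
  obtain ⟨D, hD, val, hval, h1, h2, h3, h4, h5⟩ := q.exists_presentation
  obtain ⟨_, h1⟩ := Tab.exists_rec h1
  obtain ⟨_, h2⟩ := Tab.exists_rec h2
  obtain ⟨_, h3⟩ := Tab.exists_rec h3
  obtain ⟨_, h4⟩ := Tab.exists_rec h4
  obtain ⟨_, h5⟩ := Tab.exists_rec h5
  exact ⟨D, hD, ⟨⟨val, hval, _, _, _, _, _, h1, h2, h3, h4, h5⟩⟩⟩

namespace Atoms

variable {a : ℝ} {D : ℕ} (S : Atoms a D)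

/-- The table recognizes the graph of a function of `k` real numbers. -/
def RecFun (t : Tab) (k : ℕ) (F : (Fin k → ℝ) → ℝ) : Prop :=
  t.Rec (k + 1) fun e => S.val (e k) = F fun i => S.val (e i)

/-- The table of the graph of a function with its value placed at variable `j`. -/
def place (D k j K : ℕ) (t : Tab) : Tab := t.rename D (List.range k ++ [j]) K

/-- The table of a variable. -/
def varTab (k i : ℕ) : Tab := S.eqTab.rename D [k, i] (k + 1)

/-- The table of a scalar multiple. -/
def smulTab (k : ℕ) (t : Tab) : Tab :=
  ((place D k (k + 1) (k + 2) t).imp (S.mulTab.rename D [k + 1, k] (k + 2))).all D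

/-- The table of a sum. -/
def sumTab (k : ℕ) (t t' : Tab) : Tab :=
  (((place D k (k + 1) (k + 3) t).imp ((place D k (k + 2) (k + 3) t').imp
    (S.addTab.rename D [k + 1, k + 2, k] (k + 3)))).all D).all D

/-- The table of a unary relation between values of functions. -/
def relTab₁ (D : ℕ) (r : Tab) (k : ℕ) (t : Tab) : Tab :=
  (t.imp (r.rename D [k] (k + 1))).all D

/-- The table of a binary relation between values of functions. -/
def relTab₂ (D : ℕ) (r : Tab) (k : ℕ) (t t' : Tab) : Tab :=
  (((place D k k (k + 2) t).imp ((place D k (k + 1) (k + 2) t').imp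
    (r.rename D [k, k + 1] (k + 2)))).all D).all D

variable {S} {k : ℕ} {t t' : Tab} {F F' : (Fin k → ℝ) → ℝ}

theorem RecFun.place (H : S.RecFun t k F) {j K : ℕ} (hk : k ≤ K) (hj : j < K) :
    (place D k j K t).Rec K fun e => S.val (e j) = F fun i => S.val (e i) := by
  have H' : t.Rec (List.range k ++ [j]).length fun e => S.val (e k) = F fun i => S.val (e i) := by
    rw [List.length_append, List.length_range]
    exact H
  refine (H'.rename (k := K) fun i hi => ?_).iff fun e => ?_
  · simp only [List.mem_append, List.mem_range, List.mem_singleton] at hi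
    omega
  · simp [List.getD_eq_getElem?_getD]

theorem recFun_varTab (i : Fin k) : S.RecFun (S.varTab k i) k fun v => v i :=
  S.rec_eq.rename (l := [k, i]) (by simp)

theorem update_of_fin {α : Type*} (e : ℕ → α) (x : α) {j : ℕ} (hj : k ≤ j) (i : Fin k) :
    Function.update e j x i = e i :=
  Function.update_of_ne (by omega) _ _

variable [NeZero D]

theorem RecFun.smul (H : S.RecFun t k F) : S.RecFun (S.smulTab k t) k fun v => a * F v := by
  refine ((H.place (by omega) (by omega)).imp
    (S.rec_mul.rename (l := [k + 1, k]) (by simp))).all.iff fun e => ?_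
  simp [update_of_fin]
  rw [← S.surj.forall (p := fun y => (y = F fun i => S.val (e i)) → a * y = S.val (e k)), forall_eq]
  exact eq_comm

theorem RecFun.add (H : S.RecFun t k F) (H' : S.RecFun t' k F') :
    S.RecFun (S.sumTab k t t') k fun v => F v + F' v := by
  refine ((H.place (by omega) (by omega)).imp ((H'.place (by omega) (by omega)).imp
    (S.rec_add.rename (l := [k + 1, k + 2, k]) (by simp; omega)))).all.all.iff fun e => ?_
  simp [update_of_fin, show k ≤ k + 1 + 1 by omega, show k ≠ k + 1 + 1 by omega]
  rw [← S.surj.forall₂ (p := fun y z => (y = F fun i => S.val (e i)) →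
    (z = F' fun i => S.val (e i)) → y + z = S.val (e k))]
  simp [eq_comm]

theorem RecFun.rel₁ {r : Tab} {R : ℝ → Prop} (hr : r.Rec 1 fun e => R (S.val (e 0)))
    (H : S.RecFun t k F) : (relTab₁ D r k t).Rec k fun e => R (F fun i => S.val (e i)) := by
  refine (Tab.Rec.imp H (hr.rename (l := [k]) (by simp))).all.iff fun e => ?_
  simp [update_of_fin]
  rw [← S.surj.forall (p := fun y => (y = F fun i => S.val (e i)) → R y), forall_eq]

theorem RecFun.rel₂ {r : Tab} {R : ℝ → ℝ → Prop}
    (hr : r.Rec 2 fun e => R (S.val (e 0)) (S.val (e 1)))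
    (H : S.RecFun t k F) (H' : S.RecFun t' k F') : (relTab₂ D r k t t').Rec k fun e =>
      R (F fun i => S.val (e i)) (F' fun i => S.val (e i)) := by
  refine ((H.place (by omega) (by omega)).imp ((H'.place (by omega) (by omega)).imp
    (hr.rename (l := [k, k + 1]) (by simp)))).all.all.iff fun e => ?_
  simp [update_of_fin]
  rw [← S.surj.forall₂ (p := fun y z => (y = F fun i => S.val (e i)) →
    (z = F' fun i => S.val (e i)) → R y z)]
  simp

end Atoms

end Parse

section Program

namespace Atoms

variable {a : ℝ} {D : ℕ} (S : Atoms a D)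

/-- One step of the right-to-left evaluation of a term with `k` variables, on a stack of tables. -/
def termStep (k n : ℕ) (l : List Tab) : List Tab :=
  bif n % 2 == 0 then S.varTab k (n / 4) :: l
  else bif n == 5 then S.smulTab k l.headI :: l.tail
  else S.sumTab k l.headI l.tail.headI :: l.tail.tail

/-- The table of the term with the given code. -/
def termTab (k n : ℕ) : Tab := ((Denumerable.ofNat (List ℕ) n).foldr (S.termStep k) []).headI

/-- The state of the right-to-left evaluation of a formula: the table of a lone term, if there is
one, and a stack of pairs of tables. -/
abbrev State : Type := (Bool × ℕ × Tab) × List (Tab × Tab)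

/-- Evaluation of a term. -/
def onTerm (k : ℕ) (t : Tab) (s : State) : State :=
  bif s.1.1 then ((false, 0, default),
    (relTab₂ D S.eqTab k t s.1.2.2, relTab₂ D S.ltTab k t s.1.2.2) :: s.2)
  else ((true, k, t), s.2)

/-- Evaluation of a logical symbol. -/
def onSymbol (D n : ℕ) (s : State) : State :=
  (s.1, bif n == 0 then (s.2.headI.1.imp s.2.tail.headI.1, default) :: s.2.tail.tail
    else bif n == 1 then (s.2.headI.1.all D, default) :: s.2.tail
    else (Tab.bot D (n - 2), default) :: s.2)

/-- Evaluation of the unary relation. -/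
def onUnary (s : State) : State :=
  ((false, 0, default), (relTab₁ D S.intTab s.1.2.1 s.1.2.2, default) :: s.2)

/-- Evaluation of the binary relation. -/
def onBinary (s : State) : State := (s.1, (s.2.headI.2, default) :: s.2.tail)

/-- One step of the right-to-left evaluation of a formula, on the last two states. -/
def step (n : ℕ) (s : State × State) : State × State :=
  (s.2, bif n % 2 == 0 then S.onTerm (n / 2).unpair.1
      (S.termTab (n / 2).unpair.1 (n / 2).unpair.2) s.2
    else bif n % 4 == 3 then onSymbol D (n / 4) s.2
    else bif n == 9 then S.onUnary s.1
    else onBinary s.1)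

/-- The table of the formula with the given code. -/
def formulaTab (n : ℕ) : Tab :=
  ((Denumerable.ofNat (List ℕ) n).foldr S.step default).2.2.headI.1

/-- The powers of the value of the only letter. -/
def power (t : Tab) (n : ℕ) : ℕ := Nat.rec (t.val 0) (fun _ x => t.mul x (t.val 0)) n

/-- The truth of the sentence with the given table. -/
def holds (t : Tab) : Bool := anyBelow t.1 fun r =>
  t.mul (power t r) (power t r) == power t r && t.acc (power t r) (power t r)

variable {α : Type*} [Primcodable α]

@[fun_prop]
theorem primrec_place (D : ℕ) {k j K : α → ℕ} {t : α → Tab} (hk : Primrec k) (hj : Primrec j)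
    (hK : Primrec K) (ht : Primrec t) : Primrec fun x => place D (k x) (j x) (K x) (t x) := by
  unfold place
  fun_prop

@[fun_prop]
theorem primrec_varTab {k i : α → ℕ} (hk : Primrec k) (hi : Primrec i) :
    Primrec fun x => S.varTab (k x) (i x) := by
  unfold varTab
  fun_prop

@[fun_prop]
theorem primrec_smulTab {k : α → ℕ} {t : α → Tab} (hk : Primrec k) (ht : Primrec t) :
    Primrec fun x => S.smulTab (k x) (t x) := by
  unfold smulTab
  fun_prop

@[fun_prop]
theorem primrec_sumTab {k : α → ℕ} {t t' : α → Tab} (hk : Primrec k) (ht : Primrec t)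
    (ht' : Primrec t') : Primrec fun x => S.sumTab (k x) (t x) (t' x) := by
  unfold sumTab
  fun_prop

@[fun_prop]
theorem primrec_relTab₁ (D : ℕ) (r : Tab) {k : α → ℕ} {t : α → Tab} (hk : Primrec k)
    (ht : Primrec t) : Primrec fun x => relTab₁ D r (k x) (t x) := by
  unfold relTab₁
  fun_prop

@[fun_prop]
theorem primrec_relTab₂ (D : ℕ) (r : Tab) {k : α → ℕ} {t t' : α → Tab} (hk : Primrec k)
    (ht : Primrec t) (ht' : Primrec t') : Primrec fun x => relTab₂ D r (k x) (t x) (t' x) := by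
  unfold relTab₂
  fun_prop

@[fun_prop]
theorem primrec_termStep {k n : α → ℕ} {l : α → List Tab} (hk : Primrec k) (hn : Primrec n)
    (hl : Primrec l) : Primrec fun x => S.termStep (k x) (n x) (l x) := by
  unfold termStep
  fun_prop

@[fun_prop]
theorem primrec_termTab {k n : α → ℕ} (hk : Primrec k) (hn : Primrec n) :
    Primrec fun x => S.termTab (k x) (n x) := by
  unfold termTab
  have := Primrec.ofNat (List ℕ)
  fun_prop

@[fun_prop]
theorem primrec_onTerm {k : α → ℕ} {t : α → Tab} {s : α → State} (hk : Primrec k) (ht : Primrec t)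
    (hs : Primrec s) : Primrec fun x => S.onTerm (k x) (t x) (s x) := by
  unfold onTerm
  fun_prop

@[fun_prop]
theorem primrec_onSymbol (D : ℕ) {n : α → ℕ} {s : α → State} (hn : Primrec n) (hs : Primrec s) :
    Primrec fun x => onSymbol D (n x) (s x) := by
  unfold onSymbol
  fun_prop

@[fun_prop]
theorem primrec_onUnary {s : α → State} (hs : Primrec s) : Primrec fun x => S.onUnary (s x) := by
  unfold onUnary
  fun_prop

@[fun_prop]
theorem primrec_onBinary {s : α → State} (hs : Primrec s) : Primrec fun x => onBinary (s x) := by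
  unfold onBinary
  fun_prop

@[fun_prop]
theorem primrec_step {n : α → ℕ} {s : α → State × State} (hn : Primrec n) (hs : Primrec s) :
    Primrec fun x => S.step (n x) (s x) := by
  unfold step
  fun_prop

@[fun_prop]
theorem primrec_formulaTab {n : α → ℕ} (hn : Primrec n) : Primrec fun x => S.formulaTab (n x) := by
  unfold formulaTab
  have := Primrec.ofNat (List ℕ)
  fun_prop

@[fun_prop]
theorem primrec_power {t : α → Tab} {n : α → ℕ} (ht : Primrec t) (hn : Primrec n) :
    Primrec fun x => power (t x) (n x) := by
  unfold power
  fun_prop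

@[fun_prop]
theorem primrec_holds {t : α → Tab} (ht : Primrec t) : Primrec fun x => holds (t x) := by
  unfold holds
  fun_prop

end Atoms

end Program

section Hold

namespace Atoms

open Tab

variable {D : ℕ} {t : Tab} {Q : (ℕ → ℕ → Fin D) → Prop}

theorem exists_power_eq {t : Tab} {N : ℕ} (hN : ∀ n, power t n < N) (n : ℕ) :
    ∃ r < N, power t r = power t n := by
  classical
  obtain ⟨m, hm⟩ : ∃ m, m = Nat.find (⟨n, rfl⟩ : ∃ r, power t r = power t n) := ⟨_, rfl⟩
  have h1 : power t m = power t n := hm ▸ Nat.find_spec (⟨n, rfl⟩ : ∃ r, power t r = power t n)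
  have h2 : ∀ r < m, power t r ≠ power t n := fun r hr =>
    Nat.find_min (⟨n, rfl⟩ : ∃ r, power t r = power t n) (hm ▸ hr)
  refine ⟨m, ?_, h1⟩
  by_contra! hle
  obtain ⟨i, hi, j, hj, hij, he⟩ := Finset.exists_ne_map_eq_of_card_lt_of_maps_to
    (s := Finset.range (N + 1)) (t := Finset.range N) (f := power t) (by simp)
    (fun i _ => by simpa using hN i)
  have key : ∀ i j, i < j → j ≤ N → power t i ≠ power t j := by
    intro i j hij hj he
    have hs : ∀ d, power t (i + d) = power t (j + d) := by
      intro d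
      induction d with
      | zero => exact he
      | succ d ih =>
        change t.mul (power t (i + d)) (t.val 0) = t.mul (power t (j + d)) (t.val 0)
        rw [ih]
    refine h2 (i + (m - j)) (by omega) ?_
    rw [hs, ← h1]
    congr 1
    omega
  simp only [Finset.mem_range] at hi hj
  rcases lt_or_gt_of_ne hij with h | h
  · exact key i j h (by omega) he
  · exact key j i h (by omega) he.symm

theorem holds_iff (H : t.Rec 0 Q) (e : ℕ → ℕ → Fin D) : holds t = true ↔ Q e := by
  obtain ⟨-, μ, hlt, hval, hmul, hacc⟩ := H
  have hp : ∀ n i, μ e i (i + n + 1) = power t n := by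
    intro n i
    induction n with
    | zero => exact hval e i
    | succ n ih =>
      rw [← add_assoc, hmul e i (i + n + 1) (i + n + 1 + 1) (by omega) (by omega), ih, hval]
      rfl
  have hpw : ∀ i j, i < j → μ e i j = power t (j - i - 1) := by
    intro i j hij
    rw [← hp (j - i - 1) i]
    congr 1
    omega
  have hQ : ∀ r, t.mul (power t r) (power t r) = power t r →
      (Q e ↔ t.acc (power t r) (power t r) = true) := by
    intro r hr
    have hb : ∀ d i, μ e i (i + (d + 1) * (r + 1)) = power t r := by
      intro d i
      induction d with
      | zero => rw [← hp r i]; congr 1; ring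
      | succ d ih =>
        rw [hmul e i (i + (d + 1) * (r + 1)) _ (by nlinarith) (by nlinarith), ih,
          show i + (d + 1 + 1) * (r + 1) = i + (d + 1) * (r + 1) + r + 1 by ring, hp, hr]
    refine hacc e (fun i => (i + 1) * (r + 1)) _ _ (fun i j hij => ?_) (by simp) (fun i => ?_)
      fun i j hij => ?_
    · exact Nat.mul_lt_mul_of_pos_right (by omega) (by omega)
    · simpa using hb i 0
    · obtain ⟨d, rfl⟩ := Nat.exists_eq_add_of_lt hij
      rw [← hb d ((i + 1) * (r + 1))]
      congr 1
      ring
  simp only [holds, anyBelow_iff, Bool.and_eq_true, beq_iff_eq]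
  constructor
  · rintro ⟨r, -, hr, h⟩
    exact (hQ r hr).2 h
  · intro h
    obtain ⟨n, f, hn, hf⟩ := exists_homogeneous (hlt e)
    have h01 : n 0 < n 1 := hn (by omega)
    have h12 : n 1 < n 2 := hn (by omega)
    have hff : t.mul f f = f := by
      have := hmul e (n 0) (n 1) (n 2) h01 h12
      rwa [hf 0 1 (by omega), hf 1 2 (by omega), hf 0 2 (by omega), eq_comm] at this
    have hN : ∀ n, power t n < t.1 := fun n => by
      rw [← hp n 0]
      exact hlt e _ _ (by omega)
    obtain ⟨r, hr, he⟩ := exists_power_eq hN (n 1 - n 0 - 1)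
    rw [← hpw _ _ h01, hf 0 1 (by omega)] at he
    have hr' : t.mul (power t r) (power t r) = power t r := by rw [he, hff]
    exact ⟨r, hr, hr', (hQ r hr').1 h⟩

end Atoms

end Hold

section Eval

open FirstOrder Language

/-- The Gödel numbering of the function symbols. -/
@[reducible]
def encodableFunctions : ∀ n, Encodable (sLang.Functions n)
  | 0 => inferInstanceAs (Encodable Empty)
  | 1 => inferInstanceAs (Encodable Unit)
  | 2 => inferInstanceAs (Encodable Unit)
  | _ + 3 => inferInstanceAs (Encodable Empty)

/-- The Gödel numbering of the relation symbols. -/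
@[reducible]
def encodableRelations : ∀ n, Encodable (sLang.Relations n)
  | 0 => inferInstanceAs (Encodable Empty)
  | 1 => inferInstanceAs (Encodable Unit)
  | 2 => inferInstanceAs (Encodable Unit)
  | _ + 3 => inferInstanceAs (Encodable Empty)

attribute [local instance] encodableFunctions encodableRelations

open Encodable in
theorem ofNat_encode_list {α : Type*} [Encodable α] (l : List α) :
    Denumerable.ofNat (List ℕ) (encode l) = l.map encode := by
  have : encode l = encode (l.map encode : List ℕ) := by
    induction l with
    | nil => rfl
    | cons x l ih =>
      rw [List.map_cons, Encodable.encode_list_cons, Encodable.encode_list_cons, ih]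
      rfl
  rw [this, Denumerable.ofNat_encode]

namespace Atoms

variable {a : ℝ} {D : ℕ} (S : Atoms a D)

/-- The symbols that encode formulas. -/
abbrev Token : Type :=
  (Σ k, sLang.Term (Empty ⊕ Fin k)) ⊕ ((Σ n, sLang.Relations n) ⊕ ℕ)

theorem step_inl {k : ℕ} (t : sLang.Term (Empty ⊕ Fin k)) (s : State × State) :
    S.step (Encodable.encode (Sum.inl ⟨k, t⟩ : Token)) s =
      (s.2, S.onTerm k (S.termTab k (Encodable.encode t)) s.2) := by
  have : Encodable.encode (Sum.inl ⟨k, t⟩ : Token) = 2 * Nat.pair k (Encodable.encode t) := rfl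
  simp [step, this]

theorem step_inr (n : ℕ) (s : State × State) :
    S.step (Encodable.encode (Sum.inr (Sum.inr n) : Token)) s = (s.2, onSymbol D n s.2) := by
  have : Encodable.encode (Sum.inr (Sum.inr n) : Token) = 2 * (2 * n + 1) + 1 := rfl
  have h1 : (2 * (2 * n + 1) + 1) % 2 = 1 := by omega
  have h2 : (2 * (2 * n + 1) + 1) % 4 = 3 := by omega
  have h3 : (2 * (2 * n + 1) + 1) / 4 = n := by omega
  simp [step, this, h1, h2, h3]

theorem step_unary (r : sLang.Relations 1) (s : State × State) :
    S.step (Encodable.encode (Sum.inr (Sum.inl ⟨1, r⟩) : Token)) s = (s.2, S.onUnary s.1) := by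
  have : Encodable.encode (Sum.inr (Sum.inl ⟨1, r⟩) : Token) = 9 := rfl
  simp [step, this]

theorem step_binary (r : sLang.Relations 2) (s : State × State) :
    S.step (Encodable.encode (Sum.inr (Sum.inl ⟨2, r⟩) : Token)) s = (s.2, onBinary s.1) := by
  have : Encodable.encode (Sum.inr (Sum.inl ⟨2, r⟩) : Token) = 25 := rfl
  simp [step, this]

variable [NeZero D]

theorem exists_foldr_termStep {k : ℕ} (t : sLang.Term (Empty ⊕ Fin k)) (st : List Tab) :
    letI := sStruc a
    ∃ T, (t.listEncode.map Encodable.encode).foldr (S.termStep k) st = T :: st ∧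
      S.RecFun T k fun v => t.realize (Sum.elim default v) := by
  let _ := sStruc a
  induction t generalizing st with
  | var i =>
    rcases i with i | i
    · exact i.elim
    · refine ⟨S.varTab k i, ?_, S.recFun_varTab i⟩
      have : Encodable.encode (Sum.inl (Sum.inr i) : (Empty ⊕ Fin k) ⊕ (Σ i, sLang.Functions i)) =
        2 * (2 * (i : ℕ) + 1) := rfl
      simp only [Term.listEncode, List.map_cons, List.map_nil, List.foldr_cons, List.foldr_nil,
        this]
      have h2 : 2 * (2 * (i : ℕ) + 1) / 4 = i := by omega
      simp [termStep, h2]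
  | @func n f ts ih =>
    match n, f with
    | 1, f =>
      obtain ⟨T, h, H⟩ := ih 0 st
      refine ⟨S.smulTab k T, ?_, H.smul⟩
      have : Encodable.encode (Sum.inr ⟨1, f⟩ : (Empty ⊕ Fin k) ⊕ (Σ i, sLang.Functions i)) = 5 :=
        rfl
      simp [Term.listEncode, List.finRange_succ, this, h, termStep]
    | 2, f =>
      obtain ⟨T', h', H'⟩ := ih 1 st
      obtain ⟨T, h, H⟩ := ih 0 (T' :: st)
      refine ⟨S.sumTab k T T', ?_, H.add H'⟩
      have : Encodable.encode (Sum.inr ⟨2, f⟩ : (Empty ⊕ Fin k) ⊕ (Σ i, sLang.Functions i)) = 13 :=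
        rfl
      simp [Term.listEncode, List.finRange_succ, this, h, h', termStep]

theorem recFun_termTab {k : ℕ} (t : sLang.Term (Empty ⊕ Fin k)) :
    letI := sStruc a
    S.RecFun (S.termTab k (Encodable.encode t)) k fun v => t.realize (Sum.elim default v) := by
  let _ := sStruc a
  obtain ⟨T, h, H⟩ := S.exists_foldr_termStep t []
  have : S.termTab k (Encodable.encode t) = T := by
    change ((Denumerable.ofNat (List ℕ) (Encodable.encode t.listEncode)).foldr _ []).headI = T
    rw [ofNat_encode_list, h]
    rfl
  rwa [this]

theorem exists_foldr_step {n : ℕ} (φ : sLang.BoundedFormula Empty n) (s : State × State)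
    (hs : s.2.1.1 = false) :
    letI := sStruc a
    ∃ s' : State × State, ∃ c : Tab × Tab, (φ.listEncode.map Encodable.encode).foldr S.step s = s' ∧
      s'.2.1.1 = false ∧ s'.2.2 = c :: s.2.2 ∧
      c.1.Rec n fun e => φ.Realize default fun i : Fin n => S.val (e i) := by
  let _ := sStruc a
  induction φ generalizing s with
  | @falsum n =>
    refine ⟨_, (Tab.bot D n, default), rfl, ?_⟩
    simp only [BoundedFormula.listEncode, List.map_cons, List.map_nil, List.foldr_cons,
      List.foldr_nil]
    erw [step_inr]
    exact ⟨hs, by simp [onSymbol], Tab.rec_bot D n⟩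
  | @equal n t₁ t₂ =>
    refine ⟨_, (relTab₂ D S.eqTab n (S.termTab n (Encodable.encode t₁))
      (S.termTab n (Encodable.encode t₂)), relTab₂ D S.ltTab n (S.termTab n (Encodable.encode t₁))
      (S.termTab n (Encodable.encode t₂))), rfl, ?_⟩
    simp only [BoundedFormula.listEncode, List.map_cons, List.map_nil, List.foldr_cons,
      List.foldr_nil]
    erw [step_inl, step_inl]
    simp only [onTerm, hs, cond_true, cond_false, true_and]
    exact RecFun.rel₂ S.rec_eq (S.recFun_termTab t₁) (S.recFun_termTab t₂)
  | @rel n m R ts =>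
    match m, R with
    | 1, R =>
      refine ⟨_, (relTab₁ D S.intTab n (S.termTab n (Encodable.encode (ts 0))), default), rfl, ?_⟩
      simp only [BoundedFormula.listEncode, List.finRange_succ, List.finRange_zero, List.map_cons,
        List.map_nil, List.foldr_cons, List.foldr_nil, List.cons_append, List.nil_append]
      erw [step_unary, step_inr, step_inl]
      simp only [onUnary, onTerm, hs, cond_false, true_and]
      exact RecFun.rel₁ (R := fun x => ∃ z : ℤ, x = z) S.rec_int (S.recFun_termTab (ts 0))
    | 2, R =>
      refine ⟨_, (relTab₂ D S.ltTab n (S.termTab n (Encodable.encode (ts 0)))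
        (S.termTab n (Encodable.encode (ts 1))), default), rfl, ?_⟩
      simp only [BoundedFormula.listEncode, List.finRange_succ, List.finRange_zero, List.map_cons,
        List.map_nil, List.foldr_cons, List.foldr_nil, List.cons_append, List.nil_append]
      erw [step_binary, step_inr, step_inl, step_inl]
      simp only [onBinary, onTerm, hs, cond_true, cond_false, true_and]
      exact ⟨rfl, RecFun.rel₂ S.rec_lt (S.recFun_termTab (ts 0)) (S.recFun_termTab (ts 1))⟩
  | @imp n φ ψ ih₁ ih₂ =>
    obtain ⟨s₂, c₂, h₂, hf₂, hc₂, H₂⟩ := ih₂ s hs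
    obtain ⟨s₁, c₁, h₁, hf₁, hc₁, H₁⟩ := ih₁ s₂ hf₂
    refine ⟨_, (c₁.1.imp c₂.1, default), rfl, ?_⟩
    simp only [BoundedFormula.listEncode, List.cons_append, List.map_cons, List.map_append,
      List.foldr_cons, List.foldr_append, h₁, h₂]
    erw [step_inr]
    exact ⟨hf₁, by simp [onSymbol, hc₁, hc₂], H₁.imp H₂⟩
  | @all n φ ih =>
    obtain ⟨s₁, c₁, h₁, hf₁, hc₁, H₁⟩ := ih s hs
    refine ⟨_, (c₁.1.all D, default), rfl, ?_⟩
    simp only [BoundedFormula.listEncode, List.map_cons, List.foldr_cons, h₁]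
    erw [step_inr]
    refine ⟨hf₁, by simp [onSymbol, hc₁], H₁.all.iff fun e => ?_⟩
    rw [BoundedFormula.realize_all, S.surj.forall]
    refine forall_congr' fun x => ?_
    have : (fun i : Fin (n + 1) => S.val (Function.update e n x i)) =
        Fin.snoc (fun i : Fin n => S.val (e i)) (S.val x) := by
      funext i
      refine Fin.lastCases ?_ (fun i => ?_) i
      · simp
      · simp [update_of_fin]
    rw [this]

theorem holds_formulaTab_iff (φ : sLang.Sentence) :
    letI := sStruc a
    holds (S.formulaTab (sentenceEncode encodableFunctions encodableRelations φ)) = true ↔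
      ℝ ⊨ φ := by
  let _ := sStruc a
  obtain ⟨s, c, h, -, hc, H⟩ := S.exists_foldr_step φ default rfl
  have : S.formulaTab (sentenceEncode encodableFunctions encodableRelations φ) = c.1 := by
    rw [formulaTab, sentenceEncode, ofNat_encode_list, h, hc]
    rfl
  rw [this, holds_iff H fun _ _ => 0]
  rw [Sentence.Realize, Formula.Realize]
  exact iff_of_eq (congrArg₂ (BoundedFormula.Realize φ) (Subsingleton.elim _ _)
    (Subsingleton.elim _ _))

end Atoms

theorem theoryDecidable_of_quadUnit {a : ℝ} (q : QuadUnit a) :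
    letI := sStruc a
    TheoryDecidable sLang ℝ := by
  obtain ⟨D, _, ⟨S⟩⟩ := q.exists_atoms
  refine ⟨encodableFunctions, encodableRelations, fun n => Atoms.holds (S.formulaTab n), ?_,
    S.holds_formulaTab_iff⟩
  have : Primrec fun n => Atoms.holds (S.formulaTab n) := by fun_prop
  exact this.to_comp

end Eval

theorem theorem_A (a : ℝ) :
    (letI := sStruc a; TheoryDecidable sLang ℝ) ↔
      ∃ p : Polynomial ℚ, p ≠ 0 ∧ p.degree ≤ 2 ∧ Polynomial.aeval a p = 0 := by
  constructor
  · intro h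
    by_contra hp
    exact not_theoryDecidable (quadFree_of_not_root hp) h
  · intro h
    obtain ⟨q⟩ := exists_quadUnit_of_root h
    exact theoryDecidable_of_quadUnit q
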